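/- The only rational points on the smooth projective plane quartic curve C₁ : 6x³y + y³z + z³x = 0 are (1 : 0 : 0), (0 : 1 : 0), (0 : 0 : 1), and (1 : −1 : 2). Equivalently, every triple of coprime integers (x, y, z), not all zero, satisfying 6x³y + y³z + z³x = 0 equals ±(1,0,0), ±(0,1,0), ±(0,0,1), or ±(1,−1,2). -/

import Mathlib

local notation "nN" => (by norm_num)
local notation "oO" => (by omega)
section
theorem irr7 (n : ℚ) (k : ℤ) (hk : padicValRat 2 n = k) (ao : ¬ (7:ℤ)∣k) :
    Irreducible (Polynomial.X ^ 7 - Polynomial.C n : Polynomial ℚ) := by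
  apply X_pow_sub_C_irreducible_of_prime nN
  intro b hb
  apply ao
  rw [← hk, ← hb]
  have hp : Fact (Nat.Prime 2) := ⟨Nat.prime_two⟩
  rcases eq_or_ne b 0 with rfl | nk
  · simp
  · rw [padicValRat.pow]; exact ⟨_, rfl⟩
noncomputable def pbas {K : Type*} [Field K] [NumberField K] (hd : Module.finrank ℚ K =7)
    (cy : K) (n : ℚ) (dg : cy ^ 7 = (n : K)) (hirr : Irreducible (Polynomial.X ^ 7 - Polynomial.C n : Polynomial ℚ)) :
    Module.Basis (Fin 7) ℚ K :=
  basisOfLinearIndependentOfCardEqFinrank (b := fun i : Fin 7 => cy ^ (i : ℕ)) (by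
    have hm : minpoly ℚ cy = Polynomial.X ^ 7 - Polynomial.C n := by
      symm; apply minpoly.eq_of_irreducible_of_monic hirr
      · simp [dg]
      · exact Polynomial.monic_X_pow_sub_C n nN
    have := linearIndependent_pow (K := ℚ) cy
    rw [hm, Polynomial.natDegree_X_pow_sub_C] at this
    exact this) (by simp [hd])
theorem pbasa {K : Type*} [Field K] [NumberField K] (hd : Module.finrank ℚ K =7)
    (cy : K) (n : ℚ) (dg : cy ^ 7 = (n : K)) (hirr) (i : Fin 7) : pbas hd cy n dg hirr i = cy ^ (i:ℕ) := by
  simp [pbas]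
set_option maxHeartbeats 4000000 in
theorem mh {K : Type*} [Field K] [NumberField K] (hd : Module.finrank ℚ K =7)
    (cy : K) (n : ℚ) (dg : cy ^ 7 = (n : K)) (hirr : Irreducible (Polynomial.X ^ 7 - Polynomial.C n : Polynomial ℚ))
    (a b c : ℚ) : Algebra.norm ℚ ((a:K) + b * cy + c * cy ^ 2) =
      a ^ 7 + n * (b ^ 7 -7 * a * b ^ 5 * c +14 * a ^ 2 * b ^ 3 * c ^ 2 -7 * a ^ 3 * b * c ^ 3) + n ^ 2 * c ^ 7 := by
  let M : Matrix (Fin 7) (Fin 7) ℚ := !![a,0,0,0,0,n*c,n*b; b,a,0,0,0,0,n*c; c,b,a,0,0,0,0; 0,c,b,a,0,0,0; 0,0,c,b,a,0,0; 0,0,0,c,b,a,0; 0,0,0,0,c,b,a]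
  have fw : Algebra.leftMulMatrix (pbas hd cy n dg hirr) ((a:K) + b * cy + c * cy ^ 2) = M := by
    rw [Algebra.leftMulMatrix_apply, ← LinearEquiv.eq_symm_apply]
    apply (pbas hd cy n dg hirr).ext
    intro j
    rw [LinearMap.toMatrix_symm, Matrix.toLin_self]
    simp only [pbasa, Fin.sum_univ_succ, Algebra.smul_def]
    fin_cases j <;> simp [M] <;>
      first
      | ring1
      | linear_combination (c:K) * dg
      | linear_combination ((b:K) + c * cy) * dg
  rw [Algebra.norm_eq_matrix_det (pbas hd cy n dg hirr), fw]
  simp [M, Matrix.det_succ_row_zero, Fin.sum_univ_succ, Fin.succAbove]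
  ring
end
section
open NumberField Module
open scoped Matrix
class MF (K : Type*) [Field K] [NumberField K] where
  th : K
  bv : th ^ 7 =18
  hd : finrank ℚ K =7
namespace MF
section
variable {K : Type*} [Field K] [NumberField K] [MF K]
theorem irrN (k m : ℕ) (ao : ¬ (7:ℤ)∣k) (hm : ¬ 2∣m) (n : ℚ) (hn : n =2^k*m) :
    Irreducible (Polynomial.X ^ 7 - Polynomial.C n : Polynomial ℚ) := by
  apply irr7 n k _ ao
  have hp : Fact (Nat.Prime 2) := ⟨Nat.prime_two⟩
  have jm : m≠0 := by rintro rfl; simp at hm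
  have : n = ((2^k*m:ℕ):ℚ) := by rw [hn]; push_cast; rfl
  rw [this, padicValRat.of_nat, padicValNat.mul (by positivity) jm, padicValNat.prime_pow,
    padicValNat.eq_zero_of_not_dvd hm]
  simp
theorem lf : Irreducible (Polynomial.X ^ 7 - Polynomial.C 18 : Polynomial ℚ) :=
  irrN 1 9 nN nN _ nN
theorem iw : (th:K)^7 = ((18:ℚ):K) := by rw [bv]; norm_num
noncomputable def bas : Basis (Fin 7) ℚ K := pbas hd (th:K) 18 iw lf
theorem basa (i) : (bas i : K) = th ^ (i:ℕ) := pbasa _ _ _ _ _ _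
theorem minpoly_th : minpoly ℚ (th:K) = Polynomial.X ^ 7 - Polynomial.C 18 := by
  symm; apply minpoly.eq_of_irreducible_of_monic lf
  · simp [bv]
  · exact Polynomial.monic_X_pow_sub_C _ nN
theorem normt : Algebra.norm ℚ (th:K) =18 := by
  have := mh hd (th:K) 18 iw lf 0 1 0
  simpa using this
theorem discr_bas : |Algebra.discr ℚ (bas : Basis (Fin 7) ℚ K)| =7^7*18^6 := by
  let pb : PowerBasis ℚ K := ⟨th,7, bas, fun i => basa i⟩
  have h := Algebra.discr_powerBasis_eq_norm ℚ pb
  change Algebra.discr ℚ (bas : Basis (Fin 7) ℚ K) = _ at h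
  rw [h]
  change |_ * Algebra.norm ℚ (Polynomial.aeval (th:K) (Polynomial.derivative (minpoly ℚ (th:K))))| = _
  rw [minpoly_th, abs_mul, abs_pow, abs_neg, abs_one, one_pow, one_mul]
  simp only [Polynomial.derivative_sub, Polynomial.derivative_X_pow, Polynomial.derivative_C, sub_zero, map_mul, map_pow, Polynomial.aeval_X]
  rw [normt]
  have : (Polynomial.aeval (th:K)) (Polynomial.C ((7:ℕ):ℚ)) = algebraMap ℚ K 7 := by simp
  rw [this, Algebra.norm_algebraMap, hd]
  norm_num
noncomputable def et : K := th^4/3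
noncomputable def ka : K := (4096+1024*th+256*th^2+64*th^3+16*th^4+4*th^5+th^6)/7
theorem th_ne : (th:K)≠0 := by
  intro h; have := bv (K:=K); rw [h] at this; norm_num at this
theorem nt : (et:K)^7 =48 := by
  unfold et
  linear_combination (th^21/2187+18*th^14/2187+324*th^7/2187+5832/2187)* (bv (K:=K))
theorem kae : ((th:K)-4)*ka = -2338 := by
  unfold ka
  linear_combination (bv (K:=K))/7
theorem int_th : IsIntegral ℤ (th:K) := by
  refine ⟨Polynomial.X^7 - Polynomial.C 18, Polynomial.monic_X_pow_sub_C _ nN,?_⟩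
  simp [bv]
theorem int_et : IsIntegral ℤ (et:K) := by
  refine ⟨Polynomial.X^7 - Polynomial.C 48, Polynomial.monic_X_pow_sub_C _ nN,?_⟩
  simp [nt]
open Polynomial in
theorem int_ka : IsIntegral ℤ (ka:K) := by
  have hk : (ka:K)≠0 := by
    intro h; have := kae (K:=K); rw [h] at this; norm_num at this
  refine ⟨X^7 - C 4096 * X^6 + C (3*1024*2338) * X^5 - C (5*256*2338^2)*X^4 + C (5*64*2338^3) * X^3 - C (3*16*2338^4) * X^2 + C (4*2338^5) * X - C (2338^6/7), by monicity!,?_⟩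
  have aa : (th:K)*ka =4*ka -2338 := by linear_combination (kae (K:=K))
  have ab : 18*(ka:K)^7 = (4*ka-2338)^7 := by
    rw [← aa, mul_pow, bv (K:=K)]
  rw [eval₂_sub]
  simp only [eval₂_sub, eval₂_add, eval₂_mul, eval₂_pow, eval₂_X, eval₂_C]
  simp
  linear_combination -ab/16366
noncomputable def ah : 𝓞 K := ⟨th, int_th⟩
noncomputable def cu : 𝓞 K := ⟨et, int_et⟩
noncomputable def ju : 𝓞 K := ⟨ka, int_ka⟩
@[simp] theorem coet : algebraMap (𝓞 K) K ah = th := rfl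
@[simp] theorem coee : algebraMap (𝓞 K) K cu = et := rfl
@[simp] theorem coek : algebraMap (𝓞 K) K ju = ka := rfl
set_option maxHeartbeats 1000000 in
theorem discr_le : |(discr K : ℚ)| ≤7^5*6^6 := by
  let w : Fin 7→𝓞 K := ![1, ah, ah^2, ah^3, cu, ah*cu, -(ju+ju) + ah^2*cu]
  let P : Matrix (Fin 7) (Fin 7) ℚ := !![1,0,0,0,0,0,0; 0,1,0,0,0,0,0; 0,0,1,0,0,0,0; 0,0,0,1,0,0,0;
    0,0,0,0,1/3,0,0; 0,0,0,0,0,1/3,0; -8192/7,-2048/7,-512/7,-128/7,-32/7,-8/7,1/21]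
  have aa : (fun i => (w i : K)) = P.map (algebraMap ℚ K) *ᵥ (bas : Basis (Fin 7) ℚ K) := by
    funext i
    simp only [Matrix.mulVec, dotProduct, Fin.sum_univ_succ, basa]
    fin_cases i <;> simp [w, P, et, ka] <;> ring
  have ab : P.det =1/189 := by
    rw [Matrix.det_of_isLowerTriangular P]
    · simp [P, Fin.prod_univ_succ]; norm_num
    · intro i j hij
      fin_cases i <;> fin_cases j <;> first | rfl | exact absurd hij (by decide)
  have ae : |Algebra.discr ℚ (fun i => (w i : K))| =7^5*6^6 := by
    rw [aa, Algebra.discr_of_matrix_mulVec, ab, abs_mul, discr_bas]; norm_num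
  let cw := RingOfIntegers.basis K
  have hc : Fintype.card (Free.ChooseBasisIndex ℤ (𝓞 K)) =7 := by
    rw [← finrank_eq_card_basis cw, RingOfIntegers.rank, hd]
  let b := cw.reindex (Fintype.equivFinOfCardEq hc)
  have au : Algebra.discr ℤ w = (b.toMatrix w).det^2 * discr K := by
    rw [← discr_eq_discr K b, ← Algebra.discr_of_matrix_vecMul]
    congr 1
    funext i
    rw [← b.sum_toMatrix_smul_self w i]
    simp [Matrix.vecMul, dotProduct, mul_comm]
  have bh : (Algebra.discr ℤ w : ℚ) = Algebra.discr ℚ (fun i => (w i : K)) := by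
    have := Algebra.discr_localizationLocalization ℤ (nonZeroDivisors ℤ) (Rₘ := ℚ) K b
    have hb2 : (fun i => (w i : K)) = (b.localizationLocalization ℚ (nonZeroDivisors ℤ) K) ᵥ* ((b.toMatrix w).map (algebraMap ℤ ℚ)).map (algebraMap ℚ K) := by
      funext i
      rw [← b.sum_toMatrix_smul_self w i]
      simp [Matrix.vecMul, dotProduct, mul_comm]
    rw [hb2, Algebra.discr_of_matrix_vecMul, this, au, ← discr_eq_discr K b, ← RingHom.mapMatrix_apply, ← RingHom.map_det]
    simp
  rw [← ae, ← bh, au]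
  have : (b.toMatrix w).det≠0 := by
    intro ak
    rw [au, ak] at bh
    rw [← bh] at ae; norm_num at ae
  rw [Int.cast_mul, Int.cast_pow, abs_mul]
  have cf : (1:ℚ) ≤ |((b.toMatrix w).det:ℚ)^2| := by
    rw [abs_of_nonneg (sq_nonneg _)]
    have : 1 ≤ (b.toMatrix w).det^2 := by have := sq_pos_of_ne_zero this; omega
    exact_mod_cast this
  nlinarith [abs_nonneg (discr K : ℚ)]
theorem mink : (4 / Real.pi) ^ InfinitePlace.nrComplexPlaces K *
  ((finrank ℚ K).factorial / (finrank ℚ K) ^ (finrank ℚ K) * √|(discr K:ℝ)|) <354 := by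
  have aa := InfinitePlace.card_add_two_mul_card_eq_rank K
  rw [hd] at aa ⊢
  have ab : InfinitePlace.nrComplexPlaces K ≤3 := by omega
  have hp := Real.pi_gt_d4
  have hp2 : Real.pi <4 := by linarith [Real.pi_lt_d2]
  have ae : (4 / Real.pi) ^ InfinitePlace.nrComplexPlaces K ≤ (1.27328:ℝ)^3 := by
    calc _ ≤ (4/Real.pi)^3 := pow_le_pow_right₀ (by rw [le_div_iff₀] <;> linarith) ab
      _ ≤ _ := by
        gcongr
        rw [div_le_iff₀] <;> linarith
  have au : √|(discr K:ℝ)| ≤28003 := by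
    apply Real.sqrt_le_iff.mpr ⟨by norm_num,?_⟩
    have := discr_le (K:=K)
    have h : |(discr K:ℝ)| ≤7^5*6^6 := by exact_mod_cast this
    refine h.trans nN
  calc _ ≤ (1.27328:ℝ)^3 * (Nat.factorial 7 / ((7:ℕ):ℝ)^7 *28003) := by gcongr
    _ <354 := by norm_num [Nat.factorial]
end
end MF
end
section
open NumberField Module Ideal
namespace MF
section
variable {K : Type*} [Field K] [NumberField K] [MF K]
noncomputable def V (dp ar az cj dn cs dm : ℚ) : K :=
  dp + ar*th + az*th^2 + cj*th^3 + dn*th^4 + cs*th^5 + dm*th^6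
theorem V_mul (dp ar az cj dn cs dm cw br bn da dy cz ds : ℚ) :
  (V dp ar az cj dn cs dm * V cw br bn da dy cz ds : K) =
  V (dp*cw+18*(ar*ds+az*cz+cj*dy+dn*da+cs*bn+dm*br))
    (dp*br+ar*cw+18*(az*ds+cj*cz+dn*dy+cs*da+dm*bn))
    (dp*bn+ar*br+az*cw+18*(cj*ds+dn*cz+cs*dy+dm*da))
    (dp*da+ar*bn+az*br+cj*cw+18*(dn*ds+cs*cz+dm*dy))
    (dp*dy+ar*da+az*bn+cj*br+dn*cw+18*(cs*ds+dm*cz))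
    (dp*cz+ar*dy+az*da+cj*bn+dn*br+cs*cw+18*(dm*ds))
    (dp*ds+ar*cz+az*dy+cj*da+dn*bn+cs*br+dm*cw) := by
  unfold V
  push_cast
  linear_combination ((ar*ds+az*cz+cj*dy+dn*da+cs*bn+dm*br)
    + (az*ds+cj*cz+dn*dy+cs*da+dm*bn)*th + (cj*ds+dn*cz+cs*dy+dm*da)*th^2
    + (dn*ds+cs*cz+dm*dy)*th^3 + (cs*ds+dm*cz)*th^4 + dm*ds*th^5)*(bv (K:=K))
noncomputable def OE (k js ew eb jr dt jq la : ℤ) : 𝓞 K :=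
  (k:𝓞 K)*ju + (js:𝓞 K) + (ew:𝓞 K)*ah + (eb:𝓞 K)*ah^2 + (jr:𝓞 K)*ah^3 + (dt:𝓞 K)*cu + (jq:𝓞 K)*(ah*cu) + (la:𝓞 K)*(ah^2*cu)
theorem OEc (k js ew eb jr dt jq la : ℤ) :
  algebraMap (𝓞 K) K (OE k js ew eb jr dt jq la) = V (k*4096/7+js) (k*1024/7+ew) (k*256/7+eb) (k*64/7+jr)
    (k*16/7+dt/3) (k*4/7+jq/3) (k/7+la/3) := by
  unfold OE V
  simp only [map_add, map_mul, map_pow, map_intCast, coet, coee, coek, ka, et]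
  push_cast
  ring
noncomputable def cc : 𝓞 K := OE 3 (-1754) (-439) (-110) (-28) (-21) (-5) (-1)
noncomputable def ea : 𝓞 K := OE 2 (-1169) (-293) (-73) (-18) (-14) (-3) (-1)
noncomputable def bw : 𝓞 K := OE 1 (-585) (-147) (-37) (-9) (-6) (-1) 0
noncomputable def di : 𝓞 K := OE 1 651 (-244) (-463) 540 (-1407) 948 (-522)
theorem Oe {x y : 𝓞 K} (h : algebraMap (𝓞 K) K x = algebraMap (𝓞 K) K y) : x = y :=
  FaithfulSMul.algebraMap_injective _ _ h
theorem OEm {bg ep gu fn gs fm gr gq ax aw ag gp gm gl gk gj gi z1 z2 z3 z4 z5 z6 ek : ℤ}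
    (ak : (gi*4096/7+z1:ℚ) = (bg*4096/7+ep:ℚ)*(ax*4096/7+aw:ℚ)+18*((bg*1024/7+gu:ℚ)*(ax/7+gj/3:ℚ)+(bg*256/7+fn:ℚ)*(ax*4/7+gk/3:ℚ)+(bg*64/7+gs:ℚ)*(ax*16/7+gl/3:ℚ)+(bg*16/7+fm/3:ℚ)*(ax*64/7+gm:ℚ)+(bg*4/7+gr/3:ℚ)*(ax*256/7+gp:ℚ)+(bg/7+gq/3:ℚ)*(ax*1024/7+ag:ℚ)))
    (aa : (gi*1024/7+z2:ℚ) = (bg*4096/7+ep:ℚ)*(ax*1024/7+ag:ℚ)+(bg*1024/7+gu:ℚ)*(ax*4096/7+aw:ℚ)+18*((bg*256/7+fn:ℚ)*(ax/7+gj/3:ℚ)+(bg*64/7+gs:ℚ)*(ax*4/7+gk/3:ℚ)+(bg*16/7+fm/3:ℚ)*(ax*16/7+gl/3:ℚ)+(bg*4/7+gr/3:ℚ)*(ax*64/7+gm:ℚ)+(bg/7+gq/3:ℚ)*(ax*256/7+gp:ℚ)))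
    (ab : (gi*256/7+z3:ℚ) = (bg*4096/7+ep:ℚ)*(ax*256/7+gp:ℚ)+(bg*1024/7+gu:ℚ)*(ax*1024/7+ag:ℚ)+(bg*256/7+fn:ℚ)*(ax*4096/7+aw:ℚ)+18*((bg*64/7+gs:ℚ)*(ax/7+gj/3:ℚ)+(bg*16/7+fm/3:ℚ)*(ax*4/7+gk/3:ℚ)+(bg*4/7+gr/3:ℚ)*(ax*16/7+gl/3:ℚ)+(bg/7+gq/3:ℚ)*(ax*64/7+gm:ℚ)))
    (ae : (gi*64/7+z4:ℚ) = (bg*4096/7+ep:ℚ)*(ax*64/7+gm:ℚ)+(bg*1024/7+gu:ℚ)*(ax*256/7+gp:ℚ)+(bg*256/7+fn:ℚ)*(ax*1024/7+ag:ℚ)+(bg*64/7+gs:ℚ)*(ax*4096/7+aw:ℚ)+18*((bg*16/7+fm/3:ℚ)*(ax/7+gj/3:ℚ)+(bg*4/7+gr/3:ℚ)*(ax*4/7+gk/3:ℚ)+(bg/7+gq/3:ℚ)*(ax*16/7+gl/3:ℚ)))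
    (au : (gi*16/7+z5/3:ℚ) = (bg*4096/7+ep:ℚ)*(ax*16/7+gl/3:ℚ)+(bg*1024/7+gu:ℚ)*(ax*64/7+gm:ℚ)+(bg*256/7+fn:ℚ)*(ax*256/7+gp:ℚ)+(bg*64/7+gs:ℚ)*(ax*1024/7+ag:ℚ)+(bg*16/7+fm/3:ℚ)*(ax*4096/7+aw:ℚ)+18*((bg*4/7+gr/3:ℚ)*(ax/7+gj/3:ℚ)+(bg/7+gq/3:ℚ)*(ax*4/7+gk/3:ℚ)))
    (bh : (gi*4/7+z6/3:ℚ) = (bg*4096/7+ep:ℚ)*(ax*4/7+gk/3:ℚ)+(bg*1024/7+gu:ℚ)*(ax*16/7+gl/3:ℚ)+(bg*256/7+fn:ℚ)*(ax*64/7+gm:ℚ)+(bg*64/7+gs:ℚ)*(ax*256/7+gp:ℚ)+(bg*16/7+fm/3:ℚ)*(ax*1024/7+ag:ℚ)+(bg*4/7+gr/3:ℚ)*(ax*4096/7+aw:ℚ)+18*((bg/7+gq/3:ℚ)*(ax/7+gj/3:ℚ)))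
    (cf : (gi/7+ek/3:ℚ) = (bg*4096/7+ep:ℚ)*(ax/7+gj/3:ℚ)+(bg*1024/7+gu:ℚ)*(ax*4/7+gk/3:ℚ)+(bg*256/7+fn:ℚ)*(ax*16/7+gl/3:ℚ)+(bg*64/7+gs:ℚ)*(ax*64/7+gm:ℚ)+(bg*16/7+fm/3:ℚ)*(ax*256/7+gp:ℚ)+(bg*4/7+gr/3:ℚ)*(ax*1024/7+ag:ℚ)+(bg/7+gq/3:ℚ)*(ax*4096/7+aw:ℚ)) :
    (OE bg ep gu fn gs fm gr gq * OE ax aw ag gp gm gl gk gj : 𝓞 K) = OE gi z1 z2 z3 z4 z5 z6 ek := by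
  apply Oe
  rw [map_mul, OEc, OEc, OEc, V_mul, ak, aa, ab, ae, au, bh, cf]
theorem OE7 : (7:𝓞 K) = OE 0 7 0 0 0 0 0 0 := by simp [OE]
theorem ob : (1:𝓞 K) = OE 0 1 0 0 0 0 0 0 := by simp [OE]
theorem OEt : (ah:𝓞 K) = OE 0 0 1 0 0 0 0 0 := by simp [OE]
theorem OEt4 : (ah-4:𝓞 K) = OE 0 (-4) 1 0 0 0 0 0 := by simp [OE]; ring
theorem p33 : (ea*ea : 𝓞 K) = OE 1 (-583) (-146) (-37) (-8) (-9) 0 (-1) := by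
  rw [ea]
  apply OEm <;> norm_num
theorem p233 : (cc*(ea*ea) : 𝓞 K) = OE 1 (-580) (-149) (-36) (-9) (-9) 0 (-2) := by
  rw [p33, cc]
  apply OEm <;> norm_num
theorem fi : cc*(ea*ea)*OE (-3) 1757 440 109 27 21 5 1 = (ah:𝓞 K) := by
  rw [p233, OEt]
  apply OEm <;> norm_num
theorem gg : (bw*bw : 𝓞 K) = OE 1 (-591) (-146) (-33) (-6) (-3) (-2) (-2) := by
  rw [bw]
  apply OEm <;> norm_num
theorem ggg : (bw*(bw*bw) : 𝓞 K) = OE 1 (-543) (-109) (-22) (-12) (-30) (-15) 0 := by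
  rw [gg, bw]
  apply OEm <;> norm_num
theorem g6' : ((bw*(bw*bw))*(bw*(bw*bw)) : 𝓞 K) = OE 1 (-147) 4598 3797 1150 (-2028) (-3096) (-1605) := by
  rw [ggg]
  apply OEm <;> norm_num
theorem kd : bw^6*di = (7:𝓞 K) := by
  have h : (bw^6:𝓞 K) = (bw*(bw*bw))*(bw*(bw*bw)) := by ring
  rw [h, g6', OE7, di]
  apply OEm <;> norm_num
theorem gh : (bw*di : 𝓞 K) = OE 0 (-485) 115 72 (-136) 396 (-295) 177 := by
  rw [bw, di]
  apply OEm <;> norm_num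
theorem gh4 : bw*di*OE (-3) 2444 671 (-11) (-181) (-351) (-37) 123 = (ah-4:𝓞 K) := by
  rw [gh, OEt4]
  apply OEm <;> norm_num
end
end MF
end
section
open NumberField Module Ideal
namespace MF
section
variable {K : Type*} [Field K] [NumberField K]
theorem primea (P : Ideal (𝓞 K)) (aj : P.IsPrime) (ak : P ≠ ⊥) :
    ∃ p f : ℕ, p.Prime∧0 < f∧absNorm P = p ^ f∧(p : 𝓞 K)∈P := by
  have hm : P.IsMaximal := aj.isMaximal ak
  have hn : absNorm P≠0 := by rwa [Ne, absNorm_eq_zero_iff]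
  have hf : Finite (𝓞 K⧸P) := (absNorm_ne_zero_iff P).1 hn
  let _ := Fintype.ofFinite (𝓞 K⧸P)
  let _ := Ideal.Quotient.field P
  obtain ⟨p, hp⟩ := CharP.exists (𝓞 K⧸P)
  obtain ⟨n, hpp, hc⟩ := FiniteField.card (𝓞 K⧸P) p
  refine ⟨p, n, hpp, n.pos,?_,?_⟩
  · rw [← hc, absNorm_apply, Submodule.cardQuot_apply, Nat.card_eq_fintype_card]
  · rw [← Ideal.Quotient.eq_zero_iff_mem, map_natCast]; exact CharP.cast_eq_zero _ p
theorem prin_prod (Q : Ideal (𝓞 K)) (ak : Q ≠ ⊥)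
    (h : ∀ P : Ideal (𝓞 K), P.IsPrime→P ≠ ⊥ → P∣Q→Submodule.IsPrincipal P) : Submodule.IsPrincipal Q := by
  rw [← mem_isPrincipalSubmonoid_iff, ← Ideal.prod_normalizedFactors_eq_self ak]
  refine Submonoid.multiset_prod_mem _ _ (fun J hJ ↦ mem_isPrincipalSubmonoid_iff.mp ?_)
  have := (mem_normalizedFactors_iff ak).mp hJ
  refine h J this.1 ?_ ((UniqueFactorizationMonoid.dvd_of_mem_normalizedFactors hJ))
  rintro rfl
  exact ak (by simpa using this.2)
theorem prin_cancel (P Q : Ideal (𝓞 K)) (e : 𝓞 K) (he : span {e} = P * Q) (ak : e≠0)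
    (cp : Submodule.IsPrincipal Q) : Submodule.IsPrincipal P := by
  obtain ⟨⟨q, hq⟩⟩ := cp
  rw [submodule_span_eq] at hq
  have hd : e∈span {q} := by
    rw [← hq]
    have : e∈P * Q := by rw [← he]; exact mem_span_singleton_self e
    exact (Ideal.mul_le_right : P * Q ≤ Q) this
  obtain ⟨r, rfl⟩ := mem_span_singleton.1 hd
  have jw : q≠0 := by rintro rfl; simp at ak
  refine ⟨⟨r,?_⟩⟩
  rw [submodule_span_eq]
  rw [hq, ← span_singleton_mul_span_singleton, mul_comm] at he
  exact (mul_right_cancel₀ (by simpa using jw) he).symm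
variable (K) in
def Good (p : ℕ) : Prop := ∀ P : Ideal (𝓞 K), P.IsPrime→absNorm P = p→Submodule.IsPrincipal P
variable (K) in
def G237 : Prop := ∀ P : Ideal (𝓞 K), P.IsPrime→P ≠ ⊥ → ((2:𝓞 K)∈P∨(3:𝓞 K)∈P∨(7:𝓞 K)∈P)→Submodule.IsPrincipal P
theorem stepP (fx : G237 K) (D : List ℕ) (dv : ∀ q∈D, q.Prime∧Good K q)
    (P : Ideal (𝓞 K)) (e : 𝓞 K) (he : e∈P) (k m : ℕ) (hk : absNorm P = k) (nf : k≠0)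
    (bz : (Algebra.norm ℤ e).natAbs = k * m) (jm : m≠0) (hm : m∣42^40 * D.prod)
    (hsq : ∀ q∈D, ¬ q^2∣m) : Submodule.IsPrincipal P := by
  obtain ⟨Q, cp⟩ := dvd_iff_le.mpr ((span_singleton_le_iff_mem P).mpr he)
  have nm : absNorm Q = m := by
    have := congrArg absNorm cp
    rw [absNorm_span_singleton, bz, map_mul, hk] at this
    exact (Nat.eq_of_mul_eq_mul_left (Nat.pos_of_ne_zero nf) this).symm
  have he0 : e≠0 := by
    rintro rfl; simp at bz; rcases bz with h | h <;> contradiction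
  have hQ0 : Q ≠ ⊥ := by rintro rfl; simp at nm; exact jm nm.symm
  apply prin_cancel P Q e cp he0
  apply prin_prod Q hQ0
  intro R jy hR0 hRQ
  obtain ⟨p, f, hp, hf, hpf, hpR⟩ := primea R jy hR0
  have hd : p^f∣m := by rw [← hpf, ← nm]; exact absNorm_dvd_absNorm_of_le (le_of_dvd hRQ)
  have hd1 : p∣m := (dvd_pow_self p hf.ne').trans hd
  rcases (hp.dvd_mul).1 (hd1.trans hm) with h | h
  · have h42 := hp.dvd_of_dvd_pow h
    rw [show 42 =2*(3*7) by norm_num, hp.dvd_mul, hp.dvd_mul, Nat.prime_dvd_prime_iff_eq hp nN,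
      Nat.prime_dvd_prime_iff_eq hp nN, Nat.prime_dvd_prime_iff_eq hp nN] at h42
    apply fx R jy hR0
    rcases h42 with rfl | rfl | rfl <;> simp_all
  · rw [Prime.dvd_prod_iff hp.prime] at h
    obtain ⟨q, hq, hpq⟩ := h
    rw [Nat.prime_dvd_prime_iff_eq hp (dv q hq).1] at hpq
    subst hpq
    apply (dv p hq).2 R jy
    rw [hpf]
    have : f <2 := by
      by_contra hc; exact hsq p hq ((pow_dvd_pow p oO).trans hd)
    have : f =1 := by omega
    rw [this, pow_one]
theorem toZMod (p : ℕ) (hp : p.Prime) (P : Ideal (𝓞 K)) (aj : absNorm P = p) :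
    ∃ bs : 𝓞 K →+* ZMod p, ∀ x, bs x =0 ↔ x∈P := by
  have hn : absNorm P≠0 := by rw [aj]; exact hp.ne_zero
  have hf : Finite (𝓞 K⧸P) := (absNorm_ne_zero_iff P).1 hn
  let _ := Fintype.ofFinite (𝓞 K⧸P)
  have hc : Fintype.card (𝓞 K⧸P) = p := by
    rw [← aj, absNorm_apply, Submodule.cardQuot_apply, Nat.card_eq_fintype_card]
  let cy := ZMod.ringEquivOfPrime (𝓞 K⧸P) hp hc
  refine ⟨(cy.symm : (𝓞 K⧸P) →+* ZMod p).comp (Ideal.Quotient.mk P), fun x => ?_⟩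
  simp [Ideal.Quotient.eq_zero_iff_mem]
theorem prino (P : Ideal (𝓞 K)) (aj : P.IsPrime) (e : 𝓞 K) (he : e∈P)
    (h : (Algebra.norm ℤ e).natAbs.Prime) : Submodule.IsPrincipal P := by
  have aa : absNorm (span {e}) = (Algebra.norm ℤ e).natAbs := absNorm_span_singleton e
  have ab : Irreducible (absNorm (span {e})) := by rw [aa]; exact h
  have ae := isPrime_of_irreducible_absNorm ab
  have au : (span {e}).IsMaximal := by
    apply ae.isMaximal; rintro hb; rw [hb] at aa; simp at aa; rw [← aa] at h; exact Nat.not_prime_zero h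
  have := au.eq_of_le aj.ne_top ((span_singleton_le_iff_mem P).mpr he)
  exact ⟨⟨e, by rw [submodule_span_eq, this]⟩⟩
variable [MF K]
theorem normtO : Algebra.norm ℤ (ah : 𝓞 K) =18 := by
  have := Algebra.coe_norm_int (ah : 𝓞 K)
  have h : ((Algebra.norm ℤ (ah : 𝓞 K) : ℤ):ℚ) =18 := by
    rw [this]; exact normt
  exact_mod_cast h
theorem normt4 : Algebra.norm ℤ (ah -4 : 𝓞 K) = -16366 := by
  have := Algebra.coe_norm_int (ah -4 : 𝓞 K)
  have ab := mh hd (th:K) 18 iw lf (-4) 1 0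
  have h : ((Algebra.norm ℤ (ah -4 : 𝓞 K) : ℤ):ℚ) = -16366 := by
    rw [this]; norm_num at ab; rw [← ab]; congr 1; change algebraMap (𝓞 K) K (ah -4) = _; rw [map_sub, coet, map_ofNat]; ring
  exact_mod_cast h
theorem normn (n : ℕ) : Algebra.norm ℤ (n : 𝓞 K) = n^7 := by
  have := Algebra.coe_norm_int (n : 𝓞 K)
  have ab : Algebra.norm ℚ (algebraMap ℚ K n) = _ := Algebra.norm_algebraMap (n:ℚ)
  change _ = Algebra.norm ℚ (algebraMap (𝓞 K) K n) at this
  rw [hd] at ab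
  rw [map_natCast (algebraMap (𝓞 K) K)] at this
  rw [map_natCast (algebraMap ℚ K)] at ab
  rw [ab] at this
  exact_mod_cast this
theorem normd (P : Ideal (𝓞 K)) (aj : P.IsPrime) (p : ℕ) (hp : p.Prime) (h : (p : 𝓞 K)∈P) (x) (hx : x∈P) :
    (p:ℤ)∣Algebra.norm ℤ x := by
  rcases eq_or_ne P ⊥ with rfl | ak
  · simp at hx; simp [hx]
  obtain ⟨q, f, hq, hf, hqf, hqP⟩ := primea P aj ak
  have hd := absNorm_dvd_norm_of_mem hx
  have ni := absNorm_dvd_norm_of_mem h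
  rw [normn, hqf] at ni
  rw [hqf] at hd
  have : q∣p^7 := by
    have : q∣q^f := dvd_pow_self _ hf.ne'
    exact_mod_cast (Int.natCast_dvd_natCast.2 this).trans ni
  have := (Nat.prime_dvd_prime_iff_eq hq hp).1 (hq.dvd_of_dvd_pow this)
  subst this
  refine dvd_trans ?_ hd
  exact_mod_cast dvd_pow_self _ hf.ne'
theorem relt : (ah : 𝓞 K)^7 =18 := by
  apply Oe; rw [map_pow, coet, bv, map_ofNat]
theorem rele : (cu : 𝓞 K)^7 =48 := by
  apply Oe; rw [map_pow, coee, nt, map_ofNat]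
theorem relk : 7*(ju : 𝓞 K) =4096+1024*ah+256*ah^2+64*ah^3+48*cu+12*(ah*cu)+3*(ah^2*cu) := by
  apply Oe
  simp only [map_add, map_mul, map_pow, map_ofNat, coet, coee, coek, ka, et]
  ring
theorem exP (p : ℕ) (hp : p.Prime) : ∃ P : Ideal (𝓞 K), P.IsPrime∧(p : 𝓞 K)∈P := by
  have : span {(p : 𝓞 K)} ≠ ⊤ := by
    intro h
    rw [span_singleton_eq_top] at h
    have ab := h.map (Algebra.norm ℤ)
    rw [normn, isUnit_pow_iff nN, Int.isUnit_iff] at ab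
    have := hp.two_le; omega
  obtain ⟨P, aj, hle⟩ := Ideal.exists_le_maximal _ this
  exact ⟨P, aj.isPrime, hle (mem_span_singleton_self _)⟩
theorem mi (P : Ideal (𝓞 K)) (aj : P.IsPrime) (a b : 𝓞 K) (ha : a∈P) (hb : b∈P) (u v : 𝓞 K) (h : u*a+v*b =1) : False :=
  aj.ne_top ((eq_top_iff_one P).2 (h ▸ P.add_mem (P.mul_mem_left _ ha) (P.mul_mem_left _ hb)))
theorem p3m (P : Ideal (𝓞 K)) (aj : P.IsPrime) (h : (3 : 𝓞 K)∈P) : ea∈P := by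
  have ht : ah∈P := aj.mem_of_pow_mem 7 (by rw [relt, show (18:𝓞 K) =6*3 by norm_num]; exact P.mul_mem_left _ h)
  have he : cu∈P := aj.mem_of_pow_mem 7 (by rw [rele, show (48:𝓞 K) =16*3 by norm_num]; exact P.mul_mem_left _ h)
  have ao : 7 * ea∈P := by
    have : (7 * ea : 𝓞 K) =3*3 + (-3+ah+2*ah^2)*ah + (-2+3*ah-ah^2)*cu := by
      unfold ea OE; push_cast; linear_combination 2*relk (K:=K)
    rw [this]
    exact P.add_mem (P.add_mem (P.mul_mem_left _ h) (P.mul_mem_left _ ht)) (P.mul_mem_left _ he)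
  rcases aj.mem_or_mem ao with h' | h'
  · exact (mi P aj _ _ h' h 1 (-2) nN).elim
  · exact h'
theorem iy (P : Ideal (𝓞 K)) (aj : P.IsPrime) (h : (2 : 𝓞 K)∈P) : cc∈P := by
  have ht : ah∈P := aj.mem_of_pow_mem 7 (by rw [relt, show (18:𝓞 K) =9*2 by norm_num]; exact P.mul_mem_left _ h)
  have he : cu∈P := aj.mem_of_pow_mem 7 (by rw [rele, show (48:𝓞 K) =24*2 by norm_num]; exact P.mul_mem_left _ h)
  have ao : 7 * cc∈P := by
    have : (7 * cc : 𝓞 K) =5*2 + (-1-2*ah-4*ah^2)*ah + (-3+ah+2*ah^2)*cu := by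
      unfold cc OE; push_cast; linear_combination 3*relk (K:=K)
    rw [this]
    exact P.add_mem (P.add_mem (P.mul_mem_left _ h) (P.mul_mem_left _ ht)) (P.mul_mem_left _ he)
  rcases aj.mem_or_mem ao with h' | h'
  · exact (mi P aj _ _ h' h 1 (-3) nN).elim
  · exact h'
theorem es : (Algebra.norm ℤ (cc : 𝓞 K)).natAbs =2∧(Algebra.norm ℤ (ea : 𝓞 K)).natAbs =3 := by
  obtain ⟨P, aj, ab⟩ := exP (K:=K) 2 Nat.prime_two
  obtain ⟨Q, cp, ae⟩ := exP (K:=K) 3 Nat.prime_three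
  have bl := normd P aj 2 Nat.prime_two ab cc (iy P aj (by exact_mod_cast ab))
  have dj := normd Q cp 3 Nat.prime_three ae ea (p3m Q cp (by exact_mod_cast ae))
  have h := congrArg (Algebra.norm ℤ) (fi (K:=K))
  rw [map_mul, map_mul, map_mul, normtO] at h
  obtain ⟨a, ha⟩ := bl
  obtain ⟨b, hb⟩ := dj
  rw [ha, hb] at h ⊢
  have aa : (a*b*b)*Algebra.norm ℤ (OE (-3) 1757 440 109 27 21 5 1 : 𝓞 K) =1 := by
    push_cast at h; linarith
  have ab := IsUnit.of_mul_eq_one _ aa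
  have hb := isUnit_of_mul_isUnit_right ab
  have ha := isUnit_of_mul_isUnit_left (isUnit_of_mul_isUnit_left ab)
  rw [Int.isUnit_iff] at ha hb
  rcases ha with rfl | rfl <;> rcases hb with rfl | rfl <;> simp
theorem normg : (Algebra.norm ℤ (bw : 𝓞 K)).natAbs =7∧(Algebra.norm ℤ (di : 𝓞 K)).natAbs =7 := by
  have aa := congrArg Int.natAbs (congrArg (Algebra.norm ℤ) (kd (K:=K)))
  have ab := congrArg Int.natAbs (congrArg (Algebra.norm ℤ) (gh4 (K:=K)))
  rw [normt4, map_mul, map_mul] at ab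
  have ao := normn (K:=K) 7
  rw [show (((7:ℕ)):𝓞 K) =7 by norm_num] at ao
  rw [ao, map_mul, map_pow] at aa
  simp only [Int.natAbs_mul, Int.natAbs_pow] at aa ab
  norm_num at aa ab
  set a := (Algebra.norm ℤ (bw : 𝓞 K)).natAbs
  set b := (Algebra.norm ℤ (di : 𝓞 K)).natAbs
  have ha : a∣7^7 := ⟨a^5*b, by rw [← mul_assoc, ← pow_succ', aa]; norm_num⟩
  obtain ⟨i, hi, hai⟩ := (Nat.dvd_prime_pow nN).1 ha
  have hb : b∣7^7 := ⟨a^6, by rw [mul_comm, aa]; norm_num⟩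
  obtain ⟨j, hj, hbj⟩ := (Nat.dvd_prime_pow nN).1 hb
  rw [hai, hbj, ← pow_mul, ← pow_add] at aa
  have ae : i*6+j =7 := Nat.pow_right_injective (le_refl 2 |>.trans (by norm_num : 2 ≤7)) (by simpa using aa)
  have : i ≤1 := by omega
  interval_cases i
  · have : j =7 := by omega
    subst this
    have : b∣16366 := by
      rw [mul_comm a b, mul_assoc] at ab
      exact ⟨_, ab.symm⟩
    rw [hbj] at this
    norm_num at this
  · have : j =1 := by omega
    subst this; exact ⟨hai, hbj⟩
theorem kf : G237 K := by
  intro P aj ak h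
  rcases h with h | h | h
  · exact prino P aj _ (iy P aj h) (by rw [es.1]; norm_num)
  · exact prino P aj _ (p3m P aj h) (by rw [es.2]; norm_num)
  · rw [← kd] at h
    rcases aj.mem_or_mem h with h | h
    · exact prino P aj _ (aj.mem_of_pow_mem _ h) (by rw [normg.1]; norm_num)
    · exact prino P aj _ h (by rw [normg.2]; norm_num)
end
end MF
end
section
open NumberField Module Ideal
namespace MF
section
variable {K : Type*} [Field K] [NumberField K] [MF K]
noncomputable def psi (i : ℕ) : 𝓞 K := match i with
  | 2 => ah^2 | 3 => ah^3 | 4 => cu | 5 => ah*cu | 6 => ah^2*cu | _ => ah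
def nn (i : ℕ) : ℤ := match i with
  | 2 => 324 | 3 => 5832 | 4 => 48 | 5 => 864 | 6 => 15552 | _ => 18
def ex (i : ℕ) : ℕ := match i with
  | 2 => 2 | 3 => 3 | 4 => 4 | 5 => 5 | 6 => 6 | _ => 1
def ss (i : ℕ) : ℤ := match i with
  | 4 => 1 | 5 => 1 | 6 => 1 | _ => 3
abbrev Cert := ℕ×ℤ×ℤ×ℤ
def Nc (c : Cert) : ℤ := match c with
  | (i,a,b,c) => a*a*a*a*a*a*a + nn i*(b*b*b*b*b*b*b -7*a*b*b*b*b*b*c +14*a*a*b*b*b*c*c -7*a*a*a*b*c*c*c) + nn i*nn i*c*c*c*c*c*c*c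
noncomputable def ce (c : Cert) : 𝓞 K := match c with
  | (i,a,b,c) => (a : 𝓞 K) + (b : 𝓞 K) * psi i + (c : 𝓞 K) * (psi i : 𝓞 K) ^ 2
def ev (c : Cert) (t : ℤ) : ℤ := match c with
  | (i,a,b,c) => 9*a +3*b*(ss i*t^(ex i)) + c*(ss i*t^(ex i))^2
theorem nx {Q : ℕ→Prop} (aa : Q 1) (ab : Q 2) (ae : Q 3) (au : Q 4) (bh : Q 5) (cf : Q 6)
   (h : ∀ i, i≠2→i≠3→i≠4→i≠5→i≠6→(Q 1→Q i)) (i : ℕ) : Q i := by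
  by_cases bl : i =2
  · subst bl; exact ab
  by_cases dj : i =3
  · subst dj; exact ae
  by_cases gz : i =4
  · subst gz; exact au
  by_cases lq : i =5
  · subst lq; exact bh
  by_cases lo : i =6
  · subst lo; exact cf
  exact h i bl dj gz lq lo aa
theorem psid (i : ℕ) (ab : i≠2) (ae : i≠3) (au : i≠4) (bh : i≠5) (cf : i≠6) :
    (psi i : 𝓞 K) = psi 1∧nn i = nn 1∧ex i = ex 1∧ss i = ss 1 := by
  refine ⟨?_,?_,?_,?_⟩
  · unfold psi; split <;> first | contradiction | rfl
  · unfold nn; split <;> first | contradiction | rfl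
  · unfold ex; split <;> first | contradiction | rfl
  · unfold ss; split <;> first | contradiction | rfl
theorem psi7 (i : ℕ) : (algebraMap (𝓞 K) K (psi i))^7 = (((nn i : ℤ) : ℚ) : K) := by
  have aa := bv (K := K)
  have ab := nt (K := K)
  apply nx (Q := fun i => (algebraMap (𝓞 K) K (psi i))^7 = (((nn i : ℤ) : ℚ) : K))
  · simp only [psi, nn, coet]; push_cast; exact aa
  · simp only [psi, nn, coet, map_pow]; push_cast; linear_combination (th^7+18)*aa
  · simp only [psi, nn, coet, map_pow]; push_cast; linear_combination (th^14+18*th^7+324)*aa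
  · simp only [psi, nn, coee]; push_cast; exact ab
  · simp only [psi, nn, coet, coee, map_mul]; push_cast; linear_combination et^7*aa+18*ab
  · simp only [psi, nn, coet, coee, map_mul, map_pow]; push_cast; linear_combination et^7*(th^7+18)*aa+324*ab
  · intro i ab ae au bh cf h
    obtain ⟨av, bl, -, -⟩ := psid (K:=K) i ab ae au bh cf
    rw [av, bl]; exact h
theorem irrn (i : ℕ) : Irreducible (Polynomial.X ^ 7 - Polynomial.C ((nn i : ℤ):ℚ) : Polynomial ℚ) := by
  apply nx (Q := fun i => Irreducible (Polynomial.X ^ 7 - Polynomial.C ((nn i : ℤ):ℚ) : Polynomial ℚ))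
  · exact irrN 1 9 nN nN _ (by norm_num [nn])
  · exact irrN 2 81 nN nN _ (by norm_num [nn])
  · exact irrN 3 729 nN nN _ (by norm_num [nn])
  · exact irrN 4 3 nN nN _ (by norm_num [nn])
  · exact irrN 5 27 nN nN _ (by norm_num [nn])
  · exact irrN 6 243 nN nN _ (by norm_num [nn])
  · intro i ab ae au bh cf h
    have bl : nn i = nn 1 := by unfold nn; split <;> first | contradiction | rfl
    rw [bl]; exact h
theorem normc (c : Cert) : Algebra.norm ℤ (ce c : 𝓞 K) = Nc c := by
  obtain ⟨i, a, b, c⟩ := c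
  have h := mh hd (algebraMap (𝓞 K) K (psi i)) _ (psi7 i) (irrn i) a b c
  have ab := Algebra.coe_norm_int (ce (i,a,b,c) : 𝓞 K)
  have ae : ((ce (i,a,b,c) : 𝓞 K) : K) = ((a:ℚ):K) + ((b:ℚ):K)*algebraMap (𝓞 K) K (psi i) + ((c:ℚ):K)*(algebraMap (𝓞 K) K (psi i))^2 := by
    change algebraMap (𝓞 K) K (ce (i,a,b,c)) = _
    simp [ce]
  rw [ae, h] at ab
  have : ((Algebra.norm ℤ (ce (i,a,b,c) : 𝓞 K) : ℤ) : ℚ) = ((Nc (i,a,b,c) : ℤ) : ℚ) := by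
    rw [ab, Nc]; push_cast; ring
  exact_mod_cast this
theorem psi3 (i : ℕ) : 3 * (psi i : 𝓞 K) = ((ss i : ℤ) : 𝓞 K) * ah ^ (ex i) := by
  have ae : 3 * (cu : 𝓞 K) = ah^4 := by
    apply Oe; rw [map_mul, map_pow, coee, coet, et, map_ofNat]; ring
  apply nx (Q := fun i => 3 * (psi i : 𝓞 K) = ((ss i : ℤ) : 𝓞 K) * ah ^ (ex i)) <;> try (simp [psi, ss, ex]; done)
  · simp [psi, ss, ex, ae]
  · simp only [psi, ss, ex]; push_cast; linear_combination ah*ae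
  · simp only [psi, ss, ex]; push_cast; linear_combination ah^2*ae
  · intro i ab ae au bh cf h
    obtain ⟨av, -, dj, gz⟩ := psid (K:=K) i ab ae au bh cf
    rw [av, dj, gz]; exact h
theorem ce9 (c : Cert) {S : Type*} [CommRing S] (bs : 𝓞 K →+* S) (t : ℤ) (h : bs ah = t) : 9 * bs (ce c) = (ev c t : ℤ) := by
  obtain ⟨i, a, b, c⟩ := c
  have := congrArg bs (psi3 (K:=K) i)
  simp only [map_mul, map_pow, map_ofNat, map_intCast, h] at this
  simp only [ce, ev, map_add, map_mul, map_pow, map_intCast]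
  push_cast
  rw [← this]; ring
def nw (p : ℕ) (D : List ℕ) (c : Cert) : Bool :=
  let m := (Nc c).natAbs / p
  ((Nc c).natAbs == p * m) && (m !=0) && ((42^40*D.prod) % m ==0) && D.all (fun q => m % (q*q) !=0)
def chkp (p : ℕ) : Bool := decide (5 ≤ p) && (List.range p).all fun d => decide (d <2) || (p % d !=0)
def chkr (p : ℕ) (L : List Cert) : Bool := (List.range p).all fun t => (t^7 % p !=18 % p) || L.any fun c => ev c t % p ==0
def chkAll : List (ℕ×List Cert)→List ℕ→Bool
  | [],_ => true
  | (p, L) :: T, D => chkp p && chkr p L && L.all (nw p D) && chkAll T (p :: D)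
theorem chkpp (p : ℕ) (h : chkp p = true) : p.Prime∧5 ≤ p := by
  simp only [chkp, Bool.and_eq_true, decide_eq_true_eq, List.all_eq_true, Bool.or_eq_true, bne_iff_ne, List.mem_range] at h
  refine ⟨?_, h.1⟩
  rw [Nat.prime_def_lt']
  refine ⟨by omega, fun m hm hmp hd => ?_⟩
  rcases h.2 m hmp with h | h
  · omega
  · exact h (Nat.mod_eq_zero_of_dvd hd)
theorem good_of (p : ℕ) (L : List Cert) (D : List ℕ) (hp : chkp p = true) (hr : chkr p L = true)
    (aa : L.all (nw p D) = true) (dv : ∀ q∈D, q.Prime∧Good K q) : Good K p := by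
  obtain ⟨pp, p5⟩ := chkpp p hp
  intro P aj bz
  obtain ⟨bs, fc⟩ := toZMod p pp P bz
  have : Fact p.Prime := ⟨pp⟩
  have ht : ((bs ah).val : ZMod p) = bs ah := ZMod.natCast_zmod_val _
  have ao : (bs ah)^7 =18 := by rw [← map_pow, relt, map_ofNat]
  simp only [chkr, List.all_eq_true, Bool.or_eq_true, bne_iff_ne, List.mem_range, List.any_eq_true, beq_iff_eq] at hr
  rcases hr (bs ah).val (ZMod.val_lt _) with h | ⟨c, hc, hev⟩
  · exfalso; apply h
    rw [← ht] at ao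
    have : (((bs ah).val^7 : ℕ) : ZMod p) = ((18:ℕ) : ZMod p) := by push_cast; exact ao
    exact (ZMod.natCast_eq_natCast_iff' _ _ _).1 this
  · have dw := ce9 c bs (bs ah).val (by rw [← ht]; simp)
    rw [(ZMod.intCast_zmod_eq_zero_iff_dvd _ _).2 (Int.dvd_of_emod_eq_zero hev)] at dw
    have hm : ce c∈P := by
      rw [← fc]
      rcases mul_eq_zero.1 dw with h | h
      · exfalso
        have : ((9:ℕ):ZMod p) =0 := by exact_mod_cast h
        rw [ZMod.natCast_eq_zero_iff] at this
        have ae : p∣3 := pp.dvd_of_dvd_pow (show p∣3^2 from this)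
        have := Nat.le_of_dvd nN ae
        omega
      · exact h
    have hc1 := List.all_eq_true.1 aa c hc
    simp only [nw, Bool.and_eq_true, beq_iff_eq, bne_iff_ne, List.all_eq_true] at hc1
    obtain ⟨⟨⟨av, bl⟩, dj⟩, gz⟩ := hc1
    refine stepP kf D dv P (ce c) hm p _ bz pp.ne_zero (by rw [normc]; exact av) bl (Nat.dvd_of_mod_eq_zero dj) ?_
    intro q hq hd
    exact gz q hq (Nat.mod_eq_zero_of_dvd (by rwa [← pow_two]))
theorem chk_all (T : List (ℕ×List Cert)) : ∀ D : List ℕ, chkAll T D = true→(∀ q∈D, q.Prime∧Good K q) →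
    ∀ x∈T, Good K x.1 := by
  induction T with
  | nil => intro D _ _ x hx; simp at hx
  | cons a T ih =>
    obtain ⟨p, L⟩ := a
    intro D h dv x hx
    simp only [chkAll, Bool.and_eq_true] at h
    obtain ⟨⟨⟨aa, ab⟩, ae⟩, au⟩ := h
    have hg := good_of (K:=K) p L D aa ab ae dv
    rcases List.mem_cons.1 hx with rfl | hx
    · exact hg
    · refine ih (p :: D) au ?_ x hx
      intro q hq
      rcases List.mem_cons.1 hq with rfl | hq
      · exact ⟨(chkpp q aa).1, hg⟩
      · exact dv q hq
def tab : List (ℕ×List Cert) := [(5,[(4,0,-2,1)]), (11,[(1,0,-2,1)]), (13,[(4,3,0,-1)]), (17,[(1,0,-1,1)]), (19,[(1,0,-1,-1)]),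
  (23,[(5,0,-2,1)]), (29,[]), (31,[(3,0,-2,1)]), (37,[(1,2,2,1)]), (41,[(1,2,-2,1)]), (43,[]),
  (47,[(4,0,-1,1)]), (53,[(1,4,1,1)]), (59,[(5,4,2,-1)]), (61,[(4,1,-1,1)]), (67,[(5,2,1,1)]), (71,[]),
  (73,[(1,0,-2,-1)]), (79,[(5,3,0,1)]), (83,[(1,2,2,-1)]), (89,[(1,3,-1,1)]), (97,[(1,3,0,-2)]),
  (101,[(4,3,1,-1)]), (103,[(5,3,-1,1)]), (107,[(1,3,-2,1)]), (109,[(1,2,1,1)]), (113,[(1,1,-2,-1), (1,2,0,1),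
  (1,3,1,1), (1,4,-3,1), (4,2,1,1), (4,3,-2,-2), (4,4,-1,1)]), (127,[]), (131,[(1,3,-2,3)]), (137,[(1,1,3,4)]),
  (139,[(1,0,-4,-1)]), (149,[(3,0,-2,-1)]), (151,[(6,0,-1,-1)]), (157,[(4,4,1,-1)]), (163,[(1,1,1,2)]),
  (167,[(1,0,-4,1)]), (173,[(5,0,-1,-1)]), (179,[(4,4,-5,-2)]), (181,[(4,1,1,1)]), (191,[(4,2,-1,1)]),
  (193,[(4,2,4,-1)]), (197,[]), (199,[(1,1,1,-1)]), (211,[]), (223,[(3,6,3,-1)]), (227,[(1,1,-1,4)]),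
  (229,[(1,3,-2,2)]), (233,[(1,1,-1,2)]), (239,[]), (241,[(6,0,-2,1)]), (251,[(5,2,3,-1)]), (257,[(1,1,3,-1)]),
  (263,[(2,1,-1,2)]), (269,[(1,1,-4,-1)]), (271,[(1,2,1,-2)]), (277,[(1,4,-2,1)]), (281,[]), (283,[(1,1,-3,3)]),
  (293,[(1,5,1,-1)]), (307,[(3,0,-1,-1)]), (311,[(1,3,2,4)]), (313,[(3,3,3,1)]), (317,[(1,3,-5,3)]),
  (331,[(2,3,-1,1)]), (337,[]), (347,[(1,4,-3,2)]), (349,[(2,6,-2,1)]), (353,[(4,3,1,2)])]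
theorem tab_ok : chkAll tab [] = true := by decide +kernel
theorem good_tab (x) (hx : x∈tab) : Good K x.1 := chk_all tab [] tab_ok (by simp) x hx
theorem tab_complete : ∀ p : ℕ, p <354→p =0∨p =1∨p =2∨p =3∨p =7∨(∃ x∈tab, x.1 = p)∨(∃ d, d < p∧2 ≤ d∧d∣p) := by
  decide +kernel
theorem gooda (p : ℕ) (hp : p.Prime) (h : p <354) (ab : p≠2) (ae : p≠3) (ao : p≠7) : Good K p := by
  rcases tab_complete p h with h | h | h | h | h | ⟨x, hx, h⟩ | ⟨d, h, hd, h'⟩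
  · exact absurd h hp.ne_zero
  · exact absurd h hp.ne_one
  · exact absurd h ab
  · exact absurd h ae
  · exact absurd h ao
  · rw [← h]; exact good_tab x hx
  · exfalso
    rcases (Nat.dvd_prime hp).1 h' with rfl | rfl <;> omega
end
end MF
end
section
open NumberField Module Ideal
namespace MF
section
variable {K : Type*} [Field K] [NumberField K] [MF K]
theorem t_mem (P : Ideal (𝓞 K)) (aj : P.IsPrime) (p q k j : ℕ) (hp : p.Prime) (cf : ¬ p∣18) (hq : absNorm P = q) (jw : q≠0)
   (em : (p : 𝓞 K)∈P) (hk : 7 * k =1 + j * (q-1)) (ia : ℕ) (ak : 18^k % p = ia % p) : ce (1, -ia,1,0)∈P := by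
  have hPb : P ≠ ⊥ := by rintro rfl; simp at hq; exact jw hq.symm
  have hm : P.IsMaximal := aj.isMaximal hPb
  have hn : absNorm P≠0 := by rwa [Ne, absNorm_eq_zero_iff]
  have hf : Finite (𝓞 K⧸P) := (absNorm_ne_zero_iff P).1 hn
  let _ := Fintype.ofFinite (𝓞 K⧸P)
  let _ := Ideal.Quotient.field P
  have hc : Fintype.card (𝓞 K⧸P) = q := by
    rw [← hq, absNorm_apply, Submodule.cardQuot_apply, Nat.card_eq_fintype_card]
  have mz : ((p:ℕ) : 𝓞 K⧸P) =0 := by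
    have := Ideal.Quotient.eq_zero_iff_mem.2 em
    simpa using this
  have hch : CharP (𝓞 K⧸P) p := by
    have aa : ringChar (𝓞 K⧸P)∣p := ringChar.dvd mz
    rcases (Nat.dvd_prime hp).1 aa with h | h
    · exact absurd h CharP.ringChar_ne_one
    · rw [← h]; exact ringChar.charP _
  set t : 𝓞 K⧸P := Ideal.Quotient.mk P ah with ht
  have ao : t^7 = ((18:ℕ) : 𝓞 K⧸P) := by
    rw [ht, ← map_pow, relt]; exact (by norm_num : (18:𝓞 K) = ((18:ℕ):𝓞 K)) ▸ map_natCast (Ideal.Quotient.mk P) 18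
  have ht0 : t≠0 := by
    intro h
    rw [h, zero_pow nN] at ao
    exact cf ((CharP.cast_eq_zero_iff _ p 18).1 ao.symm)
  have aa := FiniteField.pow_card_sub_one_eq_one t ht0
  rw [hc] at aa
  have ab : t = ((ia:ℕ) : 𝓞 K⧸P) := by
    have : t^(7*k) = t := by rw [hk, pow_add, mul_comm j, pow_mul, aa]; simp
    rw [← this, pow_mul, ao, ← Nat.cast_pow]
    rw [CharP.natCast_eq_natCast _ p]
    exact ak
  rw [← Ideal.Quotient.eq_zero_iff_mem]
  simp only [ce, psi, map_add, map_mul, map_pow]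
  rw [← ht, ab]; simp
theorem lr (P : Ideal (𝓞 K)) (aj : P.IsPrime) (p q k j : ℕ) (hp : p.Prime) (cf : ¬ p∣18) (hq : absNorm P = q) (jw : q≠0)
   (em : (p : 𝓞 K)∈P) (hk : 7 * k =1 + j * (q-1)) (ia : ℕ) (ak : 18^k % p = ia % p) (bz : ¬ (q:ℤ)∣Nc (1, -ia,1,0)) : False := by
  apply bz
  rw [← normc (K:=K), ← hq]
  exact absNorm_dvd_norm_of_mem (t_mem P aj p q k j hp cf hq jw em hk ia ak)
theorem f13 (P : Ideal (𝓞 K)) (aj : P.IsPrime) (hq : absNorm P =169) (hp : (13 : 𝓞 K)∈P) : Submodule.IsPrincipal P := by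
  have fx := kf (K:=K)
  have bh : ∀ q∈[5], q.Prime∧Good K q := by
    intro q hq; simp at hq; subst hq; exact ⟨by norm_num, gooda 5 nN nN nN nN nN⟩
  have hprod : (ah-8 : 𝓞 K)*((ah^2+ah-1)*((ah^2+9*ah-1)*(ah^2+11*ah-1)))∈P := by
    have : (ah-8 : 𝓞 K)*((ah^2+ah-1)*((ah^2+9*ah-1)*(ah^2+11*ah-1))) =
        (2 -13*ah +73*ah^2 -44*ah^3 -67*ah^4 -4*ah^5 + ah^6) *13 := by
      linear_combination relt (K:=K)
    rw [this]; exact P.mul_mem_left _ hp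
  rcases aj.mem_or_mem hprod with h | h
  · exfalso
    have aa : ce (1,-8,1,0)∈P := by
      convert h using 1; simp [ce, psi]; ring
    have := absNorm_dvd_norm_of_mem aa
    rw [normc, hq] at this
    norm_num [Nc, nn] at this
  rcases aj.mem_or_mem h with h | h
  · have aa : ce (1,-1,1,1)∈P := by
      convert h using 1; simp [ce, psi]; ring
    exact stepP fx [5] bh P _ aa 169 5 hq nN (by rw [normc]; norm_num [Nc, nn]) nN nN (by simp)
  rcases aj.mem_or_mem h with h | h
  · have aa : ce (4,3,1,1)∈P := by
      have ae : (3 : 𝓞 K) * ce (4,3,1,1)∈P := by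
        have dj : 3 * (cu : 𝓞 K) = ah^4 := by
          apply Oe; rw [map_mul, map_pow, coee, coet, et, map_ofNat]; ring
        have bl : (cu : 𝓞 K)^2 =2*ah := by
          apply Oe; rw [map_mul, map_pow, coee, coet, et, map_ofNat]; linear_combination th/9*bv (K:=K)
        have : (3 : 𝓞 K) * ce (4,3,1,1) = (ah^2-9*ah+82)*(ah^2+9*ah-1)+(-57*ah+7)*13 := by
          simp only [ce, psi]; push_cast; linear_combination dj +3*bl
        rw [this]; exact P.add_mem (P.mul_mem_left _ h) (P.mul_mem_left _ hp)
      rcases aj.mem_or_mem ae with h | h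
      · exact (mi P aj 3 13 h hp (-4) 1 nN).elim
      · exact h
    exact stepP fx [] (by simp) P _ aa 169 3 hq nN (by rw [normc]; norm_num [Nc, nn]) nN nN (by simp)
  · have aa : ce (1,-1,-2,1)∈P := by
      have : (ce (1,-1,-2,1) : 𝓞 K) = (ah^2+11*ah-1) + (-ah)*13 := by simp [ce, psi]; ring
      rw [this]; exact P.add_mem h (P.mul_mem_left _ hp)
    exact stepP fx [] (by simp) P _ aa 169 49 hq nN (by rw [normc]; norm_num [Nc, nn]) nN nN (by simp)
theorem prin_small (P : Ideal (𝓞 K)) (aj : P.IsPrime) (ak : P ≠ ⊥) (bz : absNorm P <354) : Submodule.IsPrincipal P := by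
  obtain ⟨p, f, hp, hf, hpf, em⟩ := primea P aj ak
  by_cases ab : p =2
  · subst ab; exact kf P aj ak (Or.inl (by exact_mod_cast em))
  by_cases ae : p =3
  · subst ae; exact kf P aj ak (Or.inr (Or.inl (by exact_mod_cast em)))
  by_cases ao : p =7
  · subst ao; exact kf P aj ak (Or.inr (Or.inr (by exact_mod_cast em)))
  rw [hpf] at bz
  rcases Nat.lt_or_ge f 2 with hf2 | hf2
  · have : f =1 := by omega
    subst this
    rw [pow_one] at hpf bz
    exact gooda p hp bz ab ae ao P aj hpf
  have hp19 : p <19 := by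
    by_contra hc
    have : 19^2 ≤ p^f := (Nat.pow_le_pow_left oO 2).trans (Nat.pow_le_pow_right oO hf2)
    omega
  have hf4 : f <4 := by
    by_contra hc
    have p4 : p≠4 := by rintro rfl; norm_num at hp
    have p5 : 5 ≤ p := by have := hp.two_le; omega
    have : 5^4 ≤ p^f := (Nat.pow_le_pow_left p5 4).trans (Nat.pow_le_pow_right oO oO)
    omega
  interval_cases p <;> first | omega | (exfalso; revert hp; norm_num; done) | skip
  · interval_cases f
    · exact (lr P aj 5 25 7 2 hp nN hpf nN em nN 2 nN (by norm_num [Nc, nn])).elim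
    · exact (lr P aj 5 125 71 4 hp nN hpf nN em nN 2 nN (by norm_num [Nc, nn])).elim
  · interval_cases f
    · exact (lr P aj 11 121 103 6 hp nN hpf nN em nN 2 nN (by norm_num [Nc, nn])).elim
    · norm_num at bz
  · interval_cases f
    · exact f13 P aj hpf (by exact_mod_cast em)
    · norm_num at bz
  · interval_cases f
    · exact (lr P aj 17 289 247 6 hp nN hpf nN em nN 1 nN (by norm_num [Nc, nn])).elim
    · norm_num at bz
instance pid : IsPrincipalIdealRing (𝓞 K) := by
  apply RingOfIntegers.isPrincipalIdealRing_of_isPrincipal_of_norm_le_of_isPrime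
  intro I jz
  intro h
  have aa := h.trans_lt mink
  have ak : (I : Ideal (𝓞 K)) ≠ ⊥ := nonZeroDivisors.coe_ne_zero I
  exact prin_small _ jz ak (by exact_mod_cast aa)
end
end MF
end
section
open NumberField Module Ideal IsDedekindDomain
namespace MF
section
variable {K : Type*} [Field K] [NumberField K] [MF K]
theorem neo {e : 𝓞 K} (h : (Algebra.norm ℤ e).natAbs.Prime) : e≠0 := by
  rintro rfl; simp at h; exact Nat.not_prime_zero h
theorem isPrimeo {e : 𝓞 K} (h : (Algebra.norm ℤ e).natAbs.Prime) : (span {e}).IsPrime := by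
  apply isPrime_of_irreducible_absNorm
  rw [absNorm_span_singleton]; exact h
theorem df : Prime (cc : 𝓞 K) := by
  have h : (Algebra.norm ℤ (cc : 𝓞 K)).natAbs.Prime := by rw [es.1]; norm_num
  rw [← span_singleton_prime (neo h)]
  exact isPrimeo h
variable (K) in
noncomputable def fq : HeightOneSpectrum (𝓞 K) :=
  ⟨span {cc}, (span_singleton_prime df.ne_zero).2 df, by simpa using df.ne_zero⟩
noncomputable def fs : Valuation K (WithZero (Multiplicative ℤ)) := (fq K).valuation K
def F (n : ℤ) (x : K) : Prop := fs x ≤ WithZero.exp (-n)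
def E (n : ℤ) (x : K) : Prop := fs x = WithZero.exp (-n)
theorem Fa {n : ℤ} {x y : K} (hx : F n x) (hy : F n y) : F n (x+y) := (fs.map_add x y).trans (max_le hx hy)
theorem Fn {n : ℤ} {x : K} (hx : F n x) : F n (-x) := by rw [F, Valuation.map_neg]; exact hx
theorem Fs {n : ℤ} {x y : K} (hx : F n x) (hy : F n y) : F n (x-y) := by
  rw [sub_eq_add_neg]; exact Fa hx (Fn hy)
theorem Fmu {n m : ℤ} {x y : K} (hx : F n x) (hy : F m y) : F (n+m) (x*y) := by
  rw [F, map_mul, neg_add, WithZero.exp_add]; exact mul_le_mul' hx hy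
theorem Fm {n m : ℤ} {x : K} (hx : F n x) (h : m ≤ n) : F m x :=
  hx.trans (by rw [WithZero.exp_le_exp]; omega)
theorem Fze (n : ℤ) : F n (0:K) := by rw [F, map_zero]; exact zero_le
theorem E.F {n : ℤ} {x : K} (h : E n x) : F n x := le_of_eq h
theorem Em {n m : ℤ} {x y : K} (hx : E n x) (hy : E m y) : E (n+m) (x*y) := by
  rw [E] at *; rw [map_mul, hx, hy, neg_add, WithZero.exp_add]
theorem Ei {n : ℤ} {x : K} (hx : E n x) : E (-n) x⁻¹ := by
  rw [E] at *; rw [map_inv₀, hx, ← WithZero.exp_neg]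
theorem Ed {n m : ℤ} {x y : K} (hx : E n x) (hy : E m y) : E (n-m) (x/y) := by
  rw [div_eq_mul_inv, sub_eq_add_neg]; exact Em hx (Ei hy)
theorem Ene {n : ℤ} {x : K} (hx : E n x) : E n (-x) := by rw [E, Valuation.map_neg]; exact hx
theorem Eo : E 0 (1:K) := by rw [E, map_one]; simp
theorem Ep {n : ℤ} {x : K} (hx : E n x) (k : ℕ) : E (k*n) (x^k) := by
  induction k with
  | zero => simpa using Eo
  | succ k ih => rw [pow_succ]; convert Em ih hx using 1; push_cast; ring
theorem En {n : ℤ} {x : K} (hx : E n x) : x≠0 := by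
  rintro rfl; rw [E, map_zero] at hx; exact WithZero.exp_ne_zero hx.symm
theorem Ee {x : K} (hx : x≠0) : ∃ n, E n x := by
  refine ⟨-WithZero.log (fs x),?_⟩
  rw [E, neg_neg, WithZero.exp_log]; exact (Valuation.ne_zero_iff _).2 hx
theorem Eu {n m : ℤ} {x : K} (h : E n x) (h' : E m x) : n = m := by
  rw [E] at *; rw [h, WithZero.exp_inj] at h'; omega
theorem EF {n m : ℤ} {x : K} (h : E n x) (h' : F m x) : m ≤ n := by
  rw [E] at h; rw [F, h, WithZero.exp_le_exp] at h'; omega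
theorem F_E {n : ℤ} {x : K} (h : F n x) : F (n+1) x∨E n x := by
  rcases eq_or_ne x 0 with rfl | hx
  · exact Or.inl (Fze _)
  obtain ⟨m, hm⟩ := Ee hx
  have := EF hm h
  rcases this.eq_or_lt with rfl | aa
  · exact Or.inr hm
  · exact Or.inl (Fm hm.F oO)
theorem Ea {n : ℤ} {x y : K} (hx : E n x) (hy : F (n+1) y) : E n (x+y) := by
  rcases F_E (Fa hx.F (Fm hy oO)) with h | h
  · exfalso
    have := Fs h hy
    rw [add_sub_cancel_right] at this
    have := EF hx this; omega
  · exact h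
theorem Fd {n m : ℤ} {x y : K} (hx : F n x) (hy : E m y) : F (n-m) (x/y) := by
  rw [div_eq_mul_inv, sub_eq_add_neg]; exact Fmu hx (Ei hy).F
theorem Fo {n m : ℤ} {x y : K} (h : F n (x*y)) (hy : E m y) : F (n-m) x := by
  have := Fd h hy
  rwa [mul_div_cancel_right₀ _ (En hy)] at this
theorem FOO (x : 𝓞 K) : F 0 (algebraMap (𝓞 K) K x) := by
  rw [F, neg_zero, WithZero.exp_zero]; exact (fq K).valuation_le_one x
theorem FO (x : 𝓞 K) (h : cc∣x) : F 1 (algebraMap (𝓞 K) K x) := by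
  obtain ⟨y, rfl⟩ := h
  rw [map_mul]
  refine Fmu (m :=0) (n :=1) ?_ (FOO y)
  rw [F, fs, (fq K).valuation_of_algebraMap, (fq K).intValuation_singleton df.ne_zero rfl]
theorem EO (x : 𝓞 K) (h : ¬ cc∣x) : E 0 (algebraMap (𝓞 K) K x) := by
  rw [E, fs]
  have := (fq K).valuation_eq_one_iff_notMem (K := K) (r := x)
  rw [this.2]
  · simp
  · change ¬ x∈span {cc}
    rwa [mem_span_singleton]
theorem p2_two : (cc : 𝓞 K)∣2 := by
  rw [← mem_span_singleton]
  have h := isPrimeo (K:=K) (e := cc) (by rw [es.1]; norm_num)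
  have hz : ((absNorm (span {(cc:𝓞 K)}) : ℕ) : 𝓞 K)∈span {cc} := absNorm_mem _
  rw [absNorm_span_singleton, es.1] at hz
  exact_mod_cast hz
theorem p2_odd (n : ℤ) (hn : ¬ 2∣n) : ¬ (cc : 𝓞 K)∣(n : 𝓞 K) := by
  intro h
  obtain ⟨k, hk⟩ : ∃ k, n =2*k+1 := ⟨n/2, by omega⟩
  have aa : (cc : 𝓞 K)∣1 := by
    have : (1 : 𝓞 K) = n -2*k := by rw [hk]; push_cast; ring
    rw [this]; exact dvd_sub h (p2_two.mul_right _)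
  exact df.not_isUnit (isUnit_of_dvd_one aa)
theorem Eod (n : ℤ) (hn : ¬ 2∣n) : E 0 (n : K) := by
  have := EO (n : 𝓞 K) (p2_odd n hn)
  rwa [map_intCast] at this
theorem Fi (n : ℤ) : F 0 (n : K) := by
  have := FOO (n : 𝓞 K)
  rwa [map_intCast] at this
theorem Ett : E 1 (th : K) := by
  have ae : E 0 (algebraMap (𝓞 K) K ea) := by
    apply EO
    intro h
    have bz := map_dvd (Algebra.norm ℤ) h
    have := Int.natAbs_dvd_natAbs.2 bz
    rw [es.1, es.2] at this; norm_num at this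
  have hp : E 1 (algebraMap (𝓞 K) K cc) := by
    rw [E, fs, (fq K).valuation_of_algebraMap, (fq K).intValuation_singleton df.ne_zero rfl]
  have hu : E 0 (algebraMap (𝓞 K) K (OE (-3) 1757 440 109 27 21 5 1)) := by
    apply EO
    intro h
    have bz := congrArg Int.natAbs (congrArg (Algebra.norm ℤ) (fi (K:=K)))
    rw [normtO, map_mul, map_mul, map_mul, Int.natAbs_mul, Int.natAbs_mul, Int.natAbs_mul, es.1, es.2] at bz
    have aa : (Algebra.norm ℤ (OE (-3) 1757 440 109 27 21 5 1 : 𝓞 K)).natAbs =1 := by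
      norm_num at bz; omega
    have ab := Int.natAbs_dvd_natAbs.2 (map_dvd (Algebra.norm ℤ) h)
    rw [aa, es.1] at ab; norm_num at ab
  have := Em (Em hp (Em ae ae)) hu
  rw [← map_mul, ← map_mul, ← map_mul, fi, coet] at this
  simpa using this
theorem E_thn (n : ℤ) : E n (th ^ n : K) := by
  cases n with
  | ofNat n => have := Ep (Ett (K:=K)) n; simpa using this
  | negSucc n => have := Ei (Ep (Ett (K:=K)) (n+1)); rw [zpow_negSucc]; convert this using 1; simp; omega
theorem Eth (n : ℕ) : E n (th ^ n : K) := by have := E_thn (K:=K) n; simpa using this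
theorem Et : E 7 (2:K) := by
  have dw : E 0 (9:K) := by have := Eod (K:=K) 9 nN; exact_mod_cast this
  have := Ed (Eth (K:=K) 7) dw
  rw [bv] at this; norm_num at this; exact this
theorem res0 {x : K} (h : F 0 x) : F 1 x∨F 1 (x-1) := by
  obtain ⟨a, b, hb⟩ := (fq K).exists_primeCompl_mul_eq_of_integer x (by simpa [F, fs] using h)
  have hbp : ¬ cc∣(b : 𝓞 K) := by
    intro h; exact b.2 (mem_span_singleton.2 h)
  obtain ⟨bs, fc⟩ := toZMod 2 Nat.prime_two (span {(cc : 𝓞 K)}) (by rw [absNorm_span_singleton, es.1])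
  have nk := EO _ hbp
  have hz : ∀ z : ZMod 2, z =0∨z =1 := by decide
  have av : bs b =1 := by
    rcases hz (bs b) with h | h
    · rw [fc, mem_span_singleton] at h; exact absurd h hbp
    · exact h
  rcases hz (bs a) with h | h
  · left
    rw [fc, mem_span_singleton] at h
    have aa := FO _ h
    rw [← hb] at aa
    exact Fo (m :=0) aa nk
  · right
    have ab : bs (a - b) =0 := by rw [map_sub, h, av, sub_self]
    rw [fc, mem_span_singleton] at ab
    have aa := FO _ ab
    rw [map_sub, ← hb] at aa
    have ae : F 1 ((x-1) * algebraMap (𝓞 K) K b) := by convert aa using 1; ring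
    exact Fo (m :=0) ae nk
theorem Es {n : ℤ} {x y : K} (h : E n x) (hy : E n y) : F (n+1) (x - y) := by
  have aa := Ed h hy
  rw [sub_self] at aa
  rcases res0 aa.F with ab | ab
  · have := EF aa ab; omega
  · have := Fmu ab hy.F
    rw [sub_mul, div_mul_cancel₀ _ (En hy), one_mul, add_comm] at this; exact this
end
end MF
end
section
open NumberField Module Ideal
namespace MF
section
variable {K : Type*} [Field K] [NumberField K] [MF K]
theorem FP (n : ℤ) (x : K) (c cw br bn da dy cz ds : ℤ) (mt ey fu ms mr mq mo : ℕ) (hc : ¬ 2∣c)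
    (hk : n ≤7*mt∧n ≤7*ey+1∧n ≤7*fu+2∧n ≤7*ms+3∧n ≤7*mr+4∧n ≤7*mq+5∧n ≤7*mo+6)
    (h : (c:K)*x =2^mt*cw +2^ey*br*th +2^fu*bn*th^2 +2^ms*da*th^3 +2^mr*dy*th^4 +2^mq*cz*th^5 +2^mo*ds*th^6) :
    F n x := by
  have key : ∀ (k i : ℕ) (b : ℤ), n ≤7*k+i→F n ((2:K)^k*b*th^i) := fun k i b h =>
    Fm (Fmu (Fmu (Ep Et k).F (Fi b)) (Eth i).F) (by linarith)
  have aa : F n ((c:K)*x) := by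
    rw [h]
    have kj := key mt 0 cw (by push_cast; linarith [hk.1])
    have av := key ey 1 br (by push_cast; linarith [hk.2.1])
    have bl := key fu 2 bn (by push_cast; linarith [hk.2.2.1])
    have dj := key ms 3 da (by push_cast; linarith [hk.2.2.2.1])
    have gz := key mr 4 dy (by push_cast; linarith [hk.2.2.2.2.1])
    have lq := key mq 5 cz (by push_cast; linarith [hk.2.2.2.2.2.1])
    have lo := key mo 6 ds (by push_cast; linarith [hk.2.2.2.2.2.2])
    rw [pow_zero, mul_one] at kj
    rw [pow_one] at av
    exact Fa (Fa (Fa (Fa (Fa (Fa kj av) bl) dj) gz) lq) lo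
  have := Fd aa (Eod c hc)
  rwa [mul_div_cancel_left₀ _ (En (Eod c hc)), sub_zero] at this
/-- units near one -/
def U (k : ℤ) (x : K) : Prop := F k (x -1)
def Lk (k : ℕ) (x : K) : Prop := F (k+1) (x - (1 + th^k))
theorem Uo (k : ℤ) : U k (1:K) := by rw [U, sub_self]; exact Fze _
theorem Um {k l : ℤ} {x : K} (h : U k x) (hl : l ≤ k) : U l x := Fm h hl
theorem U.E {k : ℤ} {x : K} (h : U k x) (hk : 1 ≤ k) : E 0 x := by
  have := Ea (Eo (K:=K)) (y := x -1) (Fm h oO)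
  rwa [add_sub_cancel] at this
theorem Umu {k : ℤ} {x y : K} (hk : 1 ≤ k) (hx : U k x) (hy : U k y) : U k (x*y) := by
  have : x*y -1 = (x-1)*y + (y-1) := by ring
  rw [U, this]
  refine Fa ?_ hy
  simpa using Fmu hx (hy.E hk).F
theorem U_inv {k : ℤ} {x : K} (hk : 1 ≤ k) (hx : U k x) : U k x⁻¹ := by
  have ak := hx.E hk
  have : x⁻¹ -1 = -(x-1) * x⁻¹ := by field_simp [En ak]; ring
  rw [U, this]
  simpa using Fmu (Fn hx) (Ei ak).F
theorem Up {k : ℤ} {x : K} (hk : 1 ≤ k) (hx : U k x) (n : ℕ) : U k (x^n) := by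
  induction n with
  | zero => rw [pow_zero]; exact Uo _
  | succ n ih => rw [pow_succ]; exact Umu hk ih hx
theorem U_of_E {x : K} (h : E 0 x) : U 1 x := by
  have := Es h Eo; rw [zero_add] at this; exact this
theorem Lk.U {k : ℕ} {x : K} (h : Lk k x) : U k x := by
  have : x -1 = (x - (1+th^k)) + th^k := by ring
  rw [MF.U, this]
  exact Fa (Fm h oO) (Eth k).F
theorem Lkm {k : ℕ} {x y : K} (hx : Lk k x) (hy : U (k+1) y) : Lk k (x*y) := by
  have : x*y - (1+th^k) = (x-(1+th^k)) + (y-1)*x := by ring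
  rw [Lk, this]
  refine Fa hx ?_
  rcases Nat.eq_zero_or_pos k with rfl | hk
  · have aa : F 0 x := by
      have e : x = (x - (1 + th^0)) +2 := by ring
      rw [e]; exact Fa (Fm hx nN) (Fm Et.F nN)
    simpa using Fmu hy aa
  · simpa using Fmu hy (hx.U.E oO).F
theorem Lk.Ek {k : ℕ} {x : K} (h : Lk k x) : E k (x -1) := by
  have : x -1 = th^k + (x - (1+th^k)) := by ring
  rw [this]; exact Ea (Eth k) h
theorem not_sq {k : ℕ} {s : K} (hk : ¬ 2∣k) (ln : k ≤13) (hs : E 0 s) (h : E k (s^2-1)) : False := by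
  have ak : s -1≠0 := by
    intro ak
    have e : s^2-1 = (s-1)*(s+1) := by ring
    rw [e, ak, zero_mul] at h
    exact En h rfl
  have e : s^2-1 = (s-1)*((s-1)+2) := by ring
  obtain ⟨a, ha⟩ := Ee ak
  rw [e] at h
  rcases lt_or_ge a 7 with ao | ao
  · have aa : E a ((s-1)+2) := Ea ha (Fm Et.F oO)
    have := Eu h (Em ha aa)
    omega
  · have aa := Fa (Fm ha.F ao) (Et (K:=K)).F
    have := EF h (Fmu (Fm ha.F ao) aa)
    omega
theorem lead {k : ℕ} {x z s : K} (hk : ¬ 2∣k) (ln : k ≤13) (hx : Lk k x) (hz : U (k+1) z) (h : x*s^2 = z) : False := by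
  have nf : 1 ≤ (k:ℤ) := by rcases Nat.eq_zero_or_pos k with rfl | h <;> [(exact absurd (dvd_zero 2) hk); exact_mod_cast h]
  have ie := hx.U.E nf
  have lh := hz.E oO
  have mw : s≠0 := by
    rintro rfl; rw [zero_pow nN, mul_zero] at h; exact En lh h.symm
  obtain ⟨a, ha⟩ := Ee mw
  have aa := Em ie (Ep ha 2)
  rw [h] at aa
  have : a =0 := by have := Eu lh aa; push_cast at this; omega
  subst this
  apply not_sq hk ln (Ei ha)
  have ab : (s⁻¹)^2 = x * z⁻¹ := by
    rw [← h]; field_simp [En ie]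
  rw [ab]
  exact (Lkm hx (U_inv oO hz)).Ek
noncomputable def fb : 𝓞 K := OE 3 (-1757) (-440) (-109) (-27) (-21) (-5) (-1)
noncomputable def iv : 𝓞 K := OE (-2) 1173 292 73 19 12 5 0
noncomputable def fa : 𝓞 K := OE 3 (-1763) (-440) (-106) (-28) (-25) (-3) 0
noncomputable def iq : 𝓞 K := OE (-2) 1173 294 74 18 13 3 1
noncomputable def ei : 𝓞 K := OE (-1) 587 149 36 8 7 2 0
noncomputable def io : 𝓞 K := OE (-3) 1777 451 119 33 32 13 6
theorem ir : (fb * iv : 𝓞 K) =1 := by rw [ob, fb, iv]; apply OEm <;> norm_num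
theorem ip : (fa * iq : 𝓞 K) =1 := by rw [ob, fa, iq]; apply OEm <;> norm_num
theorem im : (ei * io : 𝓞 K) =1 := by rw [ob, ei, io]; apply OEm <;> norm_num
noncomputable def ct : K := algebraMap (𝓞 K) K bw
noncomputable def bf : K := algebraMap (𝓞 K) K fb
noncomputable def bi : K := algebraMap (𝓞 K) K fa
noncomputable def ca : K := algebraMap (𝓞 K) K ei
theorem cN1 : F 2 (ct*((1))^2 - (1 + th^1) : K) := by
  refine FP 2 _ 21 (-9) (-18) (-9) (3) (6) (5) (3) 1 1 0 0 0 0 0 nN nN ?_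
  simp only [ct, bw, OEc, V]
  push_cast
  linear_combination (0)*bv (K:=K)
theorem cN3 : F 12 (bf*((1) + (1)*th + (1)*th^3 + (1)*th^5 + (1)*th^6)^2 - (1 + th^3 + th^11) : K) := by
  refine FP 12 _ 21 (2277) (522) (-111) (198) (-129) (-418) (53) 2 2 2 2 2 1 1 nN nN ?_
  simp only [bf, fb, OEc, V]
  push_cast
  linear_combination ((509) + (121)*th + (-21)*th^2 + (48)*th^3 + (-24)*th^4 + (-42)*th^5 + (15)*th^6 + (36)*th^7 + (8)*th^8 + (1)*th^9 + (5)*th^10 + (2)*th^11)*bv (K:=K)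
theorem cN5 : F 6 (bi*((1) + (1)*th^2)^2 - (1 + th^5) : K) := by
  refine FP 6 _ 21 (72) (-129) (15) (51) (-17) (-27) (25) 1 1 1 1 1 1 0 nN nN ?_
  simp only [bi, fa, OEc, V]
  push_cast
  linear_combination ((18) + (-13)*th + (15)*th^2 + (9)*th^3)*bv (K:=K)
theorem cN9 : F 14 ((ca*ct*7)*((1) + (1)*th^5)^2 - (1 + th^9 + th^11 + th^13) : K) := by
  refine FP 14 _ 3 (1728) (1914) (1074) (243) (-455) (-505) (-152) 2 2 2 2 2 2 2 nN nN ?_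
  simp only [ct, bw, ca, ei, OEc, V]
  push_cast
  linear_combination ((2687/7) + (2985/7)*th + (5081/21)*th^2 + (1150/21)*th^3 + (-724/7)*th^4 + (-803/7)*th^5 + (-225/7)*th^6 + (586/21)*th^7 + (536/21)*th^8 + (64/7)*th^9 + (-1)*th^10 + (-39/7)*th^11 + (-64/21)*th^12 + (-5/21)*th^13 + (-3/7)*th^14 + (-3/7)*th^15)*bv (K:=K)
theorem w3n : (bf : K)≠0 := by
  intro h
  have := congrArg (algebraMap (𝓞 K) K) (ir (K:=K))
  rw [map_mul, map_one, ← bf, h, zero_mul] at this; exact zero_ne_one this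
theorem w5n : (bi : K)≠0 := by
  intro h
  have := congrArg (algebraMap (𝓞 K) K) (ip (K:=K))
  rw [map_mul, map_one, ← bi, h, zero_mul] at this; exact zero_ne_one this
theorem w9n : (ca : K)≠0 := by
  intro h
  have := congrArg (algebraMap (𝓞 K) K) (im (K:=K))
  rw [map_mul, map_one, ← ca, h, zero_mul] at this; exact zero_ne_one this
theorem gn : (ct : K)≠0 := by
  intro h
  have := congrArg (algebraMap (𝓞 K) K) (kd (K:=K))
  rw [map_mul, map_pow, ← ct, h, zero_pow nN, zero_mul, map_ofNat] at this; norm_num at this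
noncomputable def cv : K := ca*ct*7
theorem e9ne : (cv : K)≠0 := mul_ne_zero (mul_ne_zero w9n gn) nN
def Sp (d : K) : Prop := ∃ (cd en eh ez dk dr : ℕ) (m : K), m≠0 ∧
  d = ct^cd*bf^en*bi^eh*7^ez*cv^dk*(-7)^dr*m^2
theorem Spm {x y : K} (hx : Sp x) (hy : Sp y) : Sp (x*y) := by
  obtain ⟨ar, cj, cs, a7, ny, dp, m, hm, rfl⟩ := hx
  obtain ⟨br, da, cz, b7, b9, cw, n, hn, rfl⟩ := hy
  exact ⟨ar+br, cj+da, cs+cz, a7+b7, ny+b9, dp+cw, m*n, mul_ne_zero hm hn, by ring⟩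
theorem Sps {m : K} (hm : m≠0) : Sp (m^2) := ⟨0,0,0,0,0,0, m, hm, by ring⟩
theorem Sp_one : Sp (1:K) := ⟨0,0,0,0,0,0,1, one_ne_zero, by ring⟩
theorem Spp {x : K} (hx : Sp x) (n : ℕ) : Sp (x^n) := by
  induction n with
  | zero => rw [pow_zero]; exact Sp_one
  | succ n ih => rw [pow_succ]; exact Spm ih hx
theorem Spg : Sp (ct:K) := ⟨1,0,0,0,0,0,1, one_ne_zero, by ring⟩
theorem Spw : Sp (bf:K) := ⟨0,1,0,0,0,0,1, one_ne_zero, by ring⟩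
theorem Sp_w5 : Sp (bi:K) := ⟨0,0,1,0,0,0,1, one_ne_zero, by ring⟩
theorem Sp7 : Sp (7:K) := ⟨0,0,0,1,0,0,1, one_ne_zero, by ring⟩
theorem Sp_e9 : Sp (cv:K) := ⟨0,0,0,0,1,0,1, one_ne_zero, by ring⟩
theorem Sp_w9 : Sp (ca:K) := by
  have := Spm (Spm (Sp_e9 (K:=K)) (Spm Spg Sp7)) (Sps (m := (ct*7)⁻¹) (inv_ne_zero (mul_ne_zero gn nN)))
  convert this using 1
  rw [cv]; field_simp [gn]
theorem Spm1 : Sp (-1:K) := ⟨0,0,0,1,0,1,7⁻¹, by norm_num, by norm_num⟩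
theorem par (x : K) (n : ℕ) : x^n = x^(n%2)*(x^(n/2))^2 := by
  rw [← pow_mul, ← pow_add]; congr 1; omega
theorem iz : U 21 (-7 : K) := by
  rw [U, show (-7:K)-1 = -2^3 by norm_num]
  simpa using Fn (Ep (Et (K:=K)) 3).F
theorem sevL : Lk 7 (7:K) := by
  rw [Lk, bv, show (7:K)-(1+18) = -(3*2^2) by norm_num]
  have ae : F 0 (3:K) := by have := Fi (K:=K) 3; exact_mod_cast this
  exact Fm (Fn (Fmu ae (Ep (Et (K:=K)) 2).F)) nN
theorem ths (n : ℕ) (hn : 1 ≤ n) : E 0 (1 + th^n : K) :=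
  Ea Eo (Fm (Eth n).F oO)
theorem gL : Lk 1 (ct : K) := by
  have := cN1 (K:=K); rw [one_pow, mul_one] at this; exact this
theorem Ft {n : ℤ} (k : ℕ) (h : n ≤ k) : F n (th^k : K) := Fm (Eth k).F h
theorem iu : Lk 3 (bf*(1 + th + th^3 + th^5 + th^6)^2 : K) := by
  have := Fa (Fm (cN3 (K:=K)) (show (4:ℤ) ≤12 by norm_num)) (Ft 11 (show (4:ℤ) ≤11 by norm_num))
  rw [Lk]; push_cast; convert this using 1; ring
theorem w5L : Lk 5 (bi*(1 + th^2)^2 : K) := by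
  have := cN5 (K:=K)
  rw [Lk]; push_cast; convert this using 1; ring
theorem jf : F 14 (cv*(1 + th^5)^2 - (1+th^9+th^11+th^13) : K) := by
  have := cN9 (K:=K)
  rw [cv]; convert this using 1; ring
theorem bits (P : ℕ→Prop) (c : ℕ) (ak : P 0) (aa : P 1) : P (c%2) := by
  rcases Nat.mod_two_eq_zero_or_one c with h | h <;> rw [h] <;> assumption
theorem Sp9 {d z s : K} (hd : Sp d) (hz : U 9 z) (h : d*s^2 = z) :
    ∃ (m : K), m≠0∧(d = m^2∨d = -7*m^2∨d = cv*m^2∨d = -7*cv*m^2) := by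
  obtain ⟨cd, en, eh, ez, dk, dr, m, hm, rfl⟩ := hd
  set n : K := ct^(cd/2)*bf^(en/2)*bi^(eh/2)*7^(ez/2)*cv^(dk/2)*(-7)^(dr/2)*m with hn
  have lj : n≠0 := by
    have := gn (K:=K); have := w3n (K:=K); have := w5n (K:=K); have := e9ne (K:=K)
    rw [hn]
    have ao : (7:K)≠0 := by norm_num
    have h07 : (-7:K)≠0 := by norm_num
    simp only [ne_eq, mul_eq_zero, pow_eq_zero_iff', not_or, not_and_or]
    tauto
  have hnn : (ct^cd*bf^en*bi^eh*7^ez*cv^dk*(-7)^dr*m^2 : K) =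
      ct^(cd%2)*bf^(en%2)*bi^(eh%2)*7^(ez%2)*cv^(dk%2)*(-7)^(dr%2)*n^2 := by
    rw [par ct cd, par bf en, par bi eh, par 7 ez, par cv dk, par (-7) dr, hn]; ring
  rw [hnn] at h ⊢
  have kz : E 0 (1 + th + th^3 + th^5 + th^6 : K) := by
    have e : (1 + th + th^3 + th^5 + th^6 : K) =1 + (th^1+th^3+th^5+th^6) := by ring
    rw [e]
    exact Ea Eo (Fa (Fa (Fa (Ft 1 nN) (Ft 3 nN)) (Ft 5 nN)) (Ft 6 nN))
  have ly := ths (K:=K) 2 nN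
  have s9 := ths (K:=K) 5 nN
  set N1 : K := ct with hN1
  set N3 : K := bf*(1 + th + th^3 + th^5 + th^6)^2 with hN3
  set oc : K := bi*(1 + th^2)^2 with hN5
  set cm : K := cv*(1 + th^5)^2 with hN9
  have od := gL (K:=K)
  have kp := iu (K:=K)
  have ko := w5L (K:=K)
  have kn := sevL (K:=K)
  have U9 : U 9 cm := by
    rw [U]
    have := Fa (Fm (jf (K:=K)) (show (9:ℤ) ≤14 by norm_num)) (Fa (Fa (Ft 9 (show (9:ℤ) ≤9 by norm_num)) (Ft 11 (show (9:ℤ) ≤11 by norm_num))) (Ft 13 (show (9:ℤ) ≤13 by norm_num)))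
    convert this using 1; ring
  have U0 := iz (K:=K)
  obtain ⟨r, hr⟩ : ∃ r, (N1^(cd%2)*(N3^(en%2)*(oc^(eh%2)*(7^(ez%2)*(cm^(dk%2)*(-7)^(dr%2))))))*r^2 = z := by
    refine ⟨n*s/((1 + th + th^3 + th^5 + th^6)^(en%2)*(1 + th^2)^(eh%2)*(1 + th^5)^(dk%2)),?_⟩
    rw [← h, hN3, hN5, hN9, mul_pow bf, mul_pow bi, mul_pow cv]
    have cj := En kz
    have cs := En ly
    have ny := En s9
    have pc : ∀ (a:K) (k:ℕ), (a^2)^k = (a^k)^2 := by intro a k; rw [← pow_mul, ← pow_mul, mul_comm]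
    rw [pc, pc, pc]
    have da := pow_ne_zero (en%2) cj
    have cz := pow_ne_zero (eh%2) cs
    have b9 := pow_ne_zero (dk%2) ny
    generalize (1 + th + th^3 + th^5 + th^6 : K)^(en%2) = fn at *
    generalize (1 + th^2 : K)^(eh%2) = fm at *
    generalize (1 + th^5 : K)^(dk%2) = x9 at *
    field_simp
  have V9 : U 9 (cm^(dk%2)*(-7)^(dr%2)) := Umu nN (Up nN U9 _) (Up nN (Um U0 nN) _)
  have kk : U 7 (7^(ez%2)*(cm^(dk%2)*(-7)^(dr%2))) :=
    Umu nN (Up nN (by exact_mod_cast kn.U) _) (Um V9 nN)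
  have km : U 5 (oc^(eh%2)*(7^(ez%2)*(cm^(dk%2)*(-7)^(dr%2)))) :=
    Umu nN (Up nN (by exact_mod_cast ko.U) _) (Um kk nN)
  have oa : U 3 (N3^(en%2)*(oc^(eh%2)*(7^(ez%2)*(cm^(dk%2)*(-7)^(dr%2))))) :=
    Umu nN (Up nN (by exact_mod_cast kp.U) _) (Um km nN)
  rcases Nat.mod_two_eq_zero_or_one cd with aa | aa
  swap
  · rw [aa, pow_one] at hr
    exact (lead nN nN (Lkm od (Um oa nN)) (Um hz nN) hr).elim
  rcases Nat.mod_two_eq_zero_or_one en with ae | ae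
  swap
  · rw [aa, ae, pow_zero, pow_one, one_mul] at hr
    exact (lead nN nN (Lkm kp (Um km nN)) (Um hz nN) hr).elim
  rcases Nat.mod_two_eq_zero_or_one eh with bh | bh
  swap
  · rw [aa, ae, bh, pow_zero, pow_zero, pow_one, one_mul, one_mul] at hr
    exact (lead nN nN (Lkm ko (Um kk nN)) (Um hz nN) hr).elim
  rcases Nat.mod_two_eq_zero_or_one ez with ao | ao
  swap
  · rw [aa, ae, bh, ao, pow_zero, pow_zero, pow_zero, pow_one, one_mul, one_mul, one_mul] at hr
    exact (lead nN nN (Lkm kn (Um V9 nN)) (Um hz nN) hr).elim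
  refine ⟨n, lj,?_⟩
  rw [aa, ae, bh, ao]
  rcases Nat.mod_two_eq_zero_or_one dk with dw | dw <;> rcases Nat.mod_two_eq_zero_or_one dr with ak | ak <;> rw [dw, ak]
  · left; ring
  · right; left; ring
  · right; right; left; ring
  · right; right; right; ring
end
end MF
end
section
open NumberField Module Ideal
section
variable {K : Type*} [Field K] [NumberField K]
theorem unitsm (n : ℕ) [NeZero n] {ι : Type*} [Fintype ι] (f : ι→(𝓞 K)ˣ)
    (hc : Fintype.card ι = n^(Units.rank K +1)) (hf : ∀ i j w, f i = f j * w^n→i = j) (u : (𝓞 K)ˣ) :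
    ∃ i v, u = f i * v^n := by
  obtain ⟨g, hg⟩ := IsCyclic.exists_generator (α := Units.torsion K)
  have aa : ∀ x : (𝓞 K)ˣ, ∃ a : ℤ×(Fin (Units.rank K)→ℤ), x = (g:(𝓞 K)ˣ)^a.1 * ∏ i, (Units.fundSystem K i)^(a.2 i) := by
    intro x
    obtain ⟨⟨z, e⟩, h, -⟩ := Units.exist_unique_eq_mul_prod K x
    obtain ⟨k, hk⟩ := hg z
    exact ⟨⟨k, e⟩, by rw [h, ← hk]; simp⟩
  choose c hc' using aa
  let cl : (𝓞 K)ˣ→ZMod n×(Fin (Units.rank K)→ZMod n) := fun x => ((c x).1, fun i => ((c x).2 i : ZMod n))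
  have key : ∀ x y, cl x = cl y → ∃ w, x = y * w^n := by
    intro x y h
    have ha : ((n:ℤ))∣(c x).1 - (c y).1 := by
      rw [← ZMod.intCast_zmod_eq_zero_iff_dvd]; push_cast; rw [sub_eq_zero]; exact congrArg Prod.fst h
    have hb : ∀ i, ((n:ℤ))∣(c x).2 i - (c y).2 i := by
      intro i
      rw [← ZMod.intCast_zmod_eq_zero_iff_dvd]; push_cast; rw [sub_eq_zero]; exact congrFun (congrArg Prod.snd h) i
    obtain ⟨a, ha⟩ := ha
    choose b hb using hb
    refine ⟨(g:(𝓞 K)ˣ)^a * ∏ i, (Units.fundSystem K i)^(b i),?_⟩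
    rw [hc' x, hc' y, mul_pow, ← Finset.prod_pow, mul_mul_mul_comm, ← Finset.prod_mul_distrib]
    congr 1
    · rw [← zpow_natCast, ← zpow_mul, ← zpow_add]; congr 1; linarith
    · apply Finset.prod_congr rfl; intro i _
      rw [← zpow_natCast, ← zpow_mul, ← zpow_add]; congr 1; linarith [hb i]
  have hinj : Function.Injective (cl ∘ f) := by
    intro i j h
    obtain ⟨w, hw⟩ := key _ _ h
    exact hf i j w hw
  have hbij := (Fintype.bijective_iff_injective_and_card (cl ∘ f)).2 ⟨hinj, by
    rw [hc]; simp [ZMod.card, pow_succ, mul_comm]⟩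
  obtain ⟨i, hi⟩ := hbij.2 (cl u)
  obtain ⟨w, hw⟩ := key _ _ hi.symm
  exact ⟨i, w, hw⟩
end
namespace MF
section
variable {K : Type*} [Field K] [NumberField K] [MF K]
theorem real_uniq (f g : K →+* ℝ) : f = g := by
  have hth : f th = g th := by
    have aa : (f th)^7 =18 := by rw [← map_pow, bv]; exact map_ofNat f 18
    have ab : (g th)^7 =18 := by rw [← map_pow, bv]; exact map_ofNat g 18
    exact (Odd.strictMono_pow (by decide : Odd 7)).injective (aa.trans ab.symm)
  have : f.toRatAlgHom.toLinearMap = g.toRatAlgHom.toLinearMap := by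
    apply bas.ext
    intro i
    rw [basa]
    change f (th^(i:ℕ)) = g (th^(i:ℕ))
    rw [map_pow, map_pow, hth]
  ext x
  exact LinearMap.congr_fun this x
theorem oddrank : Odd (finrank ℚ K) := by rw [hd]; decide
open Classical in
theorem real_ex : Nonempty (K →+* ℝ) := by
  have h := InfinitePlace.nrRealPlaces_pos_of_odd_finrank (K:=K) oddrank
  rw [InfinitePlace.nrRealPlaces, Fintype.card_pos_iff] at h
  obtain ⟨w, hw⟩ := h
  exact ⟨InfinitePlace.embedding_of_isReal hw⟩
open Classical in
theorem rank3 : Units.rank K =3 := by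
  have aa : InfinitePlace.nrRealPlaces K ≤1 := by
    rw [InfinitePlace.nrRealPlaces, Fintype.card_le_one_iff]
    rintro ⟨v, hv⟩ ⟨w, hw⟩
    have h := real_uniq (InfinitePlace.embedding_of_isReal hv) (InfinitePlace.embedding_of_isReal hw)
    have : v.embedding = w.embedding := by
      ext x
      rw [← InfinitePlace.embedding_of_isReal_apply hv, ← InfinitePlace.embedding_of_isReal_apply hw, h]
    rw [Subtype.mk.injEq, ← InfinitePlace.mk_embedding v, this, InfinitePlace.mk_embedding]
  have ab := InfinitePlace.nrRealPlaces_pos_of_odd_finrank (K:=K) oddrank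
  have ae := InfinitePlace.card_add_two_mul_card_eq_rank K
  rw [hd] at ae
  rw [Units.rank, InfinitePlace.card_eq_nrRealPlaces_add_nrComplexPlaces]
  omega
theorem Lk_of_E {k : ℕ} {x : K} (h : E k (x-1)) : Lk k x := by
  rw [Lk, show x - (1+th^k) = (x-1) - th^k by ring]; exact Es h (Eth k)
theorem m1L : Lk 7 (-1:K) := by
  rw [Lk, bv, show (-1:K)-(1+18) = -(5*2^2) by norm_num]
  have ae : F 0 (5:K) := by have := Fi (K:=K) 5; exact_mod_cast this
  exact Fm (Fn (Fmu ae (Ep (Et (K:=K)) 2).F)) nN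
theorem w9L0 : F 2 (ca*((1))^2 - (1 + th^1) : K) := by
  refine FP 2 _ 21 (9) (18) (-12) (-24) (1) (2) (-3) 1 1 0 0 0 0 0 nN nN ?_
  simp only [ca, ei, OEc, V]
  push_cast
  linear_combination (0)*bv (K:=K)
theorem w9L : Lk 1 (ca : K) := by
  have := w9L0 (K:=K); rw [one_pow, mul_one] at this; exact this
theorem s3E : E 0 (1 + th + th^3 + th^5 + th^6 : K) := by
  have e : (1 + th + th^3 + th^5 + th^6 : K) =1 + (th^1+th^3+th^5+th^6) := by ring
  rw [e]
  exact Ea Eo (Fa (Fa (Fa (Ft 1 nN) (Ft 3 nN)) (Ft 5 nN)) (Ft 6 nN))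
theorem indep (a b c d : ℕ) (s : K) (h : ca^a*bf^b*bi^c*(-1)^d = s^2) :
    a%2 =0∧b%2 =0∧c%2 =0∧d%2 =0 := by
  have kz := s3E (K:=K)
  have ly := ths (K:=K) 2 nN
  have od := w9L (K:=K)
  have kp := iu (K:=K)
  have ko := w5L (K:=K)
  have kn := m1L (K:=K)
  have jr := w3n (K:=K)
  have jq := w5n (K:=K)
  have n9 := w9n (K:=K)
  obtain ⟨r, hr⟩ : ∃ r, (ca^(a%2)*((bf*(1 + th + th^3 + th^5 + th^6)^2)^(b%2)*((bi*(1 + th^2)^2)^(c%2)*(-1)^(d%2))))*r^2 = (1:K) := by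
    rw [par ca a, par bf b, par bi c, par (-1) d] at h
    have hs : s≠0 := by
      rintro rfl
      have ao : (-1:K)≠0 := by norm_num
      simp only [ne_eq, OfNat.ofNat_ne_zero, not_false_eq_true, zero_pow, mul_eq_zero, pow_eq_zero_iff'] at h
      tauto
    refine ⟨ca^(a/2)*bf^(b/2)*bi^(c/2)*(-1)^(d/2)/(s*(1 + th + th^3 + th^5 + th^6)^(b%2)*(1 + th^2)^(c%2)),?_⟩
    rw [mul_pow bf, mul_pow bi]
    have cj := En kz
    have cs := En ly
    have pc : ∀ (a:K) (k:ℕ), (a^2)^k = (a^k)^2 := by intro a k; rw [← pow_mul, ← pow_mul, mul_comm]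
    rw [pc, pc]
    have da := pow_ne_zero (b%2) cj
    have cz := pow_ne_zero (c%2) cs
    generalize (1 + th + th^3 + th^5 + th^6 : K)^(b%2) = fn at *
    generalize (1 + th^2 : K)^(c%2) = fm at *
    field_simp
    rw [← h]; ring
  have kk : U 7 ((-1:K)^(d%2)) := Up nN (by exact_mod_cast kn.U) _
  have km : U 5 ((bi*(1 + th^2)^2)^(c%2)*(-1:K)^(d%2)) :=
    Umu nN (Up nN (by exact_mod_cast ko.U) _) (Um kk nN)
  have oa : U 3 ((bf*(1 + th + th^3 + th^5 + th^6)^2)^(b%2)*((bi*(1 + th^2)^2)^(c%2)*(-1:K)^(d%2))) :=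
    Umu nN (Up nN (by exact_mod_cast kp.U) _) (Um km nN)
  rcases Nat.mod_two_eq_zero_or_one a with aa | aa
  swap
  · rw [aa, pow_one] at hr
    exact (lead nN nN (Lkm od (Um oa nN)) (Uo _) hr).elim
  rcases Nat.mod_two_eq_zero_or_one b with ae | ae
  swap
  · rw [aa, ae, pow_zero, pow_one, one_mul] at hr
    exact (lead nN nN (Lkm kp (Um km nN)) (Uo _) hr).elim
  rcases Nat.mod_two_eq_zero_or_one c with bh | bh
  swap
  · rw [aa, ae, bh, pow_zero, pow_zero, pow_one, one_mul, one_mul] at hr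
    exact (lead nN nN (Lkm ko (Um kk nN)) (Uo _) hr).elim
  rcases Nat.mod_two_eq_zero_or_one d with ao | ao
  swap
  · rw [aa, ae, bh, ao, pow_zero, pow_zero, pow_zero, pow_one, one_mul, one_mul, one_mul] at hr
    exact (lead nN nN kn (Uo _) hr).elim
  exact ⟨aa, ae, bh, ao⟩
noncomputable def w3u : (𝓞 K)ˣ := ⟨fb, iv, ir, by rw [mul_comm]; exact ir⟩
noncomputable def w5u : (𝓞 K)ˣ := ⟨fa, iq, ip, by rw [mul_comm]; exact ip⟩
noncomputable def w9u : (𝓞 K)ˣ := ⟨ei, io, im, by rw [mul_comm]; exact im⟩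
theorem Sp_unit (u : (𝓞 K)ˣ) : Sp (algebraMap (𝓞 K) K u) := by
  let f : Fin 2×Fin 2×Fin 2×Fin 2→(𝓞 K)ˣ := fun i =>
    w9u^(i.1:ℕ)*w3u^(i.2.1:ℕ)*w5u^(i.2.2.1:ℕ)*(-1)^(i.2.2.2:ℕ)
  have nh : ∀ i, algebraMap (𝓞 K) K (f i) = ca^(i.1:ℕ)*bf^(i.2.1:ℕ)*bi^(i.2.2.1:ℕ)*(-1)^(i.2.2.2:ℕ) := by
    intro i
    simp only [f, Units.val_mul, Units.val_pow_eq_pow_val, map_mul, map_pow, Units.val_neg, Units.val_one, map_neg, map_one]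
    rfl
  obtain ⟨i, v, hv⟩ := unitsm 2 f (by rw [rank3]; rfl) (by
    intro i j w h
    have aa := congrArg (fun x : (𝓞 K)ˣ => algebraMap (𝓞 K) K x) h
    simp only [Units.val_mul, Units.val_pow_eq_pow_val, map_mul, map_pow] at aa
    rw [nh, nh] at aa
    have ab := indep (K:=K) (i.1+j.1) (i.2.1+j.2.1) (i.2.2.1+j.2.2.1) (i.2.2.2+j.2.2.2)
      (ca^(j.1:ℕ)*bf^(j.2.1:ℕ)*bi^(j.2.2.1:ℕ)*(-1)^(j.2.2.2:ℕ)*algebraMap (𝓞 K) K w) (by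
        rw [mul_pow, pow_add, pow_add, pow_add, pow_add]
        linear_combination (ca^(j.1:ℕ)*bf^(j.2.1:ℕ)*bi^(j.2.2.1:ℕ)*(-1)^(j.2.2.2:ℕ)) * aa)
    obtain ⟨a, b, c, d⟩ := i
    obtain ⟨a', b', c', d'⟩ := j
    simp only at ab
    simp only [Prod.mk.injEq, Fin.ext_iff]
    omega) u
  rw [hv, Units.val_mul, Units.val_pow_eq_pow_val, map_mul, map_pow, nh]
  refine Spm (Spm (Spm (Spm (Spp Sp_w9 _) (Spp Spw _)) (Spp Sp_w5 _)) (Spp Spm1 _)) (Sps ?_)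
  intro ak
  have := (NumberField.RingOfIntegers.coe_eq_zero_iff).1 ak
  exact v.ne_zero this
end
end MF
end
section
open NumberField Module Ideal
namespace MF
section
variable {K : Type*} [Field K] [NumberField K] [MF K]
theorem gO_prime : Prime (bw : 𝓞 K) := by
  have h : (Algebra.norm ℤ (bw : 𝓞 K)).natAbs.Prime := by rw [normg.1]; norm_num
  rw [← span_singleton_prime (neo h)]
  exact isPrimeo h
theorem hO_prime : Prime (di : 𝓞 K) := by
  have h : (Algebra.norm ℤ (di : 𝓞 K)).natAbs.Prime := by rw [normg.2]; norm_num
  rw [← span_singleton_prime (neo h)]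
  exact isPrimeo h
theorem dvd14 (p : 𝓞 K) (hp : Prime p) (h : p∣14) : Associated p cc∨Associated p bw∨Associated p di := by
  have : (14 : 𝓞 K) =2 * (bw^6*di) := by rw [kd]; norm_num
  rw [this] at h
  rcases hp.dvd_or_dvd h with h | h
  · left
    have aj : (span {p}).IsPrime := (span_singleton_prime hp.ne_zero).2 hp
    have := iy (span {p}) aj (by rw [mem_span_singleton]; exact_mod_cast h)
    rw [mem_span_singleton] at this
    exact hp.associated_of_dvd df this
  · right
    rcases hp.dvd_or_dvd h with h | h
    · left; exact hp.associated_of_dvd gO_prime (hp.dvd_of_dvd_pow h)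
    · right; exact hp.associated_of_dvd hO_prime h
theorem UF (a : 𝓞 K) : ∀ (c s : 𝓞 K), a≠0→a*c = s^2→(∀ p, Prime p→p∣a→p∣c→p∣14) →
    ∃ (u : (𝓞 K)ˣ) (i j k : ℕ) (m : 𝓞 K), a = (u:𝓞 K)*cc^i*bw^j*di^k*m^2 := by
  induction a using (wellFounded_dvdNotUnit (α := 𝓞 K)).induction with
  | _ a ih =>
  intro c s ha h hp
  by_cases hco : ∃ p, Prime p∧p∣a∧p∣c
  · obtain ⟨p, hpp,⟨a', ha'⟩,⟨c', hc'⟩⟩ := hco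
    have hs : p∣s := hpp.dvd_of_dvd_pow (n:=2) ⟨a'*c, by rw [← h, ha']; ring⟩
    obtain ⟨s', rfl⟩ := hs
    have h' : a'*c' = s'^2 := by
      have := hpp.ne_zero
      apply mul_left_cancel₀ (pow_ne_zero 2 this)
      rw [ha', hc'] at h; linear_combination h
    have ha0 : a' ≠0 := by rintro rfl; apply ha; rw [ha', mul_zero]
    obtain ⟨u, i, j, k, m, hm⟩ := ih a' ⟨ha0, p, hpp.not_isUnit, by rw [ha']; ring⟩ c' s' ha0 h'
      (fun q hq aa ab => hp q hq (by rw [ha']; exact aa.mul_left _) (by rw [hc']; exact ab.mul_left _))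
    rcases dvd14 p hpp (hp p hpp ⟨_, ha'⟩ ⟨_, hc'⟩) with ⟨w, hw⟩ | ⟨w, hw⟩ | ⟨w, hw⟩
    · refine ⟨u*w⁻¹, i+1, j, k, m,?_⟩
      rw [ha', hm, ← hw, pow_succ, Units.val_mul]
      have : (w:𝓞 K)*((w⁻¹:(𝓞 K)ˣ):𝓞 K) =1 := by simp
      linear_combination (-(p*(↑u*(p*w)^i*bw^j*di^k*m^2)))*this
    · refine ⟨u*w⁻¹, i, j+1, k, m,?_⟩
      rw [ha', hm, ← hw, pow_succ, Units.val_mul]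
      have : (w:𝓞 K)*((w⁻¹:(𝓞 K)ˣ):𝓞 K) =1 := by simp
      linear_combination (-(p*(↑u*cc^i*(p*w)^j*di^k*m^2)))*this
    · refine ⟨u*w⁻¹, i, j, k+1, m,?_⟩
      rw [ha', hm, ← hw, pow_succ, Units.val_mul]
      have : (w:𝓞 K)*((w⁻¹:(𝓞 K)ˣ):𝓞 K) =1 := by simp
      linear_combination (-(p*(↑u*cc^i*bw^j*(p*w)^k*m^2)))*this
  · push Not at hco
    have hc := isCoprime_of_prime_dvd (x := a) (y := c) (fun h => ha h.1) (fun z hz aa ab => hco z hz aa ab)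
    obtain ⟨d, w, hw⟩ := exists_associated_pow_of_mul_eq_pow' hc h
    exact ⟨w,0,0,0, d, by rw [← hw]; ring⟩
theorem Eg : E 0 (ct:K) := (gL.U).E nN
theorem eo : E 0 (7:K) := by have := Eod (K:=K) 7 nN; exact_mod_cast this
theorem E_unit (u : (𝓞 K)ˣ) : E 0 (algebraMap (𝓞 K) K u) :=
  EO _ (fun h => df.not_isUnit (isUnit_of_dvd_unit h u.isUnit))
theorem Ep2 : E 1 (algebraMap (𝓞 K) K cc) := by
    rw [E, fs, (fq K).valuation_of_algebraMap, (fq K).intValuation_singleton df.ne_zero rfl]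
theorem gx : algebraMap (𝓞 K) K di =7 / ct^6 := by
  have := congrArg (algebraMap (𝓞 K) K) (kd (K:=K))
  rw [map_mul, map_pow, ← ct, map_ofNat] at this
  rw [eq_div_iff (pow_ne_zero _ gn), mul_comm]; exact this
theorem Sp_h : Sp (algebraMap (𝓞 K) K di) := by
  rw [gx]
  have := Spm (Sp7 (K:=K)) (Sps (m := (ct^3)⁻¹) (inv_ne_zero (pow_ne_zero _ gn)))
  convert this using 1; field_simp [gn]
theorem E_h : E 0 (algebraMap (𝓞 K) K di) := by
  rw [gx]; simpa using Ed eo (Ep (Eg (K:=K)) 6)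
theorem SpUF {a c s : 𝓞 K} {n : ℤ} (h : a*c = s^2) (hp : ∀ p, Prime p→p∣a→p∣c→p∣14)
    (cg : E (2*n) (algebraMap (𝓞 K) K a)) : Sp (algebraMap (𝓞 K) K a) := by
  have ha : a≠0 := by rintro rfl; rw [map_zero] at cg; exact En cg rfl
  obtain ⟨u, i, j, k, m, hm⟩ := UF a c s ha h hp
  have jm : algebraMap (𝓞 K) K m≠0 := by
    intro ak
    have := (NumberField.RingOfIntegers.coe_eq_zero_iff).1 ak
    apply ha; rw [hm, this]; ring
  have e : algebraMap (𝓞 K) K a = algebraMap (𝓞 K) K u * (algebraMap (𝓞 K) K cc)^i*ct^j*(algebraMap (𝓞 K) K di)^k*(algebraMap (𝓞 K) K m)^2 := by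
    rw [hm, ct]; simp only [map_mul, map_pow]
  obtain ⟨l, hl⟩ := Ee jm
  have ab := Em (Em (Em (Em (E_unit u) (Ep (Ep2 (K:=K)) i)) (Ep Eg j)) (Ep E_h k)) (Ep hl 2)
  rw [e] at cg ⊢
  have := Eu cg ab
  have hi : i =2*(i/2) := by push_cast at this; omega
  refine Spm (Spm (Spm (Spm (Sp_unit u) ?_) (Spp Spg j)) (Spp Sp_h k)) (Sps jm)
  rw [hi, mul_comm 2, pow_mul]
  exact Sps (pow_ne_zero _ (En Ep2))
theorem exO_of_sq (x : K) (a : 𝓞 K) (h : x^2 = algebraMap (𝓞 K) K a) : ∃ y : 𝓞 K, algebraMap (𝓞 K) K y = x := by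
  have : IsIntegral ℤ x := by
    apply IsIntegral.of_pow (n:=2) nN
    rw [h]; exact a.2
  exact ⟨⟨x, this⟩, rfl⟩
theorem E1 {x ch : K} {n : ℤ} (al be : ℤ) (hbe : ∀ p : 𝓞 K, Prime p→p∣be→p∣14) (hx : E (2*n) x)
    (h : ch^2 = x + al + be/x) : Sp x := by
  have ie := En hx
  obtain ⟨a, b, hb, hco, hab⟩ : ∃ a b : 𝓞 K, b≠0∧IsCoprime a b∧algebraMap (𝓞 K) K a / algebraMap (𝓞 K) K b = x := by
    obtain ⟨a, b, hab, e⟩ := IsFractionRing.exists_reduced_fraction (A := 𝓞 K) x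
    refine ⟨a, b, nonZeroDivisors.ne_zero b.2, hab.isCoprime,?_⟩
    rw [← e, IsFractionRing.mk'_eq_div]
  have hbK : algebraMap (𝓞 K) K b≠0 := fun ak => hb ((NumberField.RingOfIntegers.coe_eq_zero_iff).1 ak)
  have haK : algebraMap (𝓞 K) K a≠0 := by intro ak; rw [ak, zero_div] at hab; exact ie hab.symm
  have hsq : (ch*(algebraMap (𝓞 K) K a * algebraMap (𝓞 K) K b))^2 = algebraMap (𝓞 K) K ((a*b)*(a^2+al*(a*b)+be*b^2)) := by
    rw [mul_pow, h, ← hab]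
    simp only [map_mul, map_add, map_pow, map_intCast]
    field_simp
  obtain ⟨s, hs⟩ := exO_of_sq _ _ hsq
  have ab : (a*b)*(a^2+al*(a*b)+be*b^2) = s^2 := by
    apply NumberField.RingOfIntegers.coe_injective
    rw [← hsq, ← hs, map_pow]
  obtain ⟨k, hk⟩ := Ee hbK
  have cg : E (2*(n+k)) (algebraMap (𝓞 K) K (a*b)) := by
    have e : algebraMap (𝓞 K) K (a*b) = x*(algebraMap (𝓞 K) K b)^2 := by rw [map_mul, ← hab]; field_simp
    rw [e]; convert Em hx (Ep hk 2) using 1; push_cast; ring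
  have hnd : ∀ p : 𝓞 K, Prime p→p∣a→p∣b→False := by
    intro p hp aa ab
    exact hp.not_isUnit (hco.isUnit_of_dvd' aa ab)
  have := SpUF ab (by
    intro p hp aa ae
    rcases hp.dvd_or_dvd aa with au | au
    · have bh : p∣be*b^2 := by
        have : (be*b^2 : 𝓞 K) = (a^2+al*(a*b)+be*b^2) - a*(a+al*b) := by ring
        rw [this]; exact dvd_sub ae (au.mul_right _)
      rcases hp.dvd_or_dvd bh with cf | cf
      · exact hbe p hp cf
      · exact (hnd p hp au (hp.dvd_of_dvd_pow cf)).elim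
    · exfalso
      have bh : p∣a^2 := by
        have : (a^2 : 𝓞 K) = (a^2+al*(a*b)+be*b^2) - b*(al*a+be*b) := by ring
        rw [this]; exact dvd_sub ae (au.mul_right _)
      exact hnd p hp (hp.dvd_of_dvd_pow bh) au) cg
  have cf := Spm this (Sps (inv_ne_zero hbK))
  convert cf using 1
  rw [map_mul, ← hab]; field_simp
theorem gf {x ch : K} {n : ℤ} (hx : E (2*n) x) (h : ch^2 = x +21 +112/x) : Sp x := by
  apply E1 (ch := ch) 21 112 _ hx (by push_cast; exact h)
  intro p hp h
  have : ((112:ℤ):𝓞 K) =2^3*14 := by norm_num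
  rw [this] at h
  rcases hp.dvd_or_dvd h with h | h
  · exact (hp.dvd_of_dvd_pow h).trans ⟨7, by norm_num⟩
  · exact h
theorem E1b {x ch : K} {n : ℤ} (hx : E (2*n) x) (h : ch^2 = x -42 -7/x) : Sp x := by
  apply E1 (ch := ch) (-42) (-7) _ hx (by push_cast; rw [h]; ring)
  intro p hp h
  have : p∣7 := by rw [← dvd_neg]; exact_mod_cast h
  exact this.trans ⟨2, by norm_num⟩
theorem pos1 {x ch : K} (bs : K →+* ℝ) (hx : x≠0) (h : ch^2 = x +21 +112/x) : 0 < bs x := by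
  have ak : bs x≠0 := (map_ne_zero bs).2 hx
  have aa : (bs ch)^2 * bs x = (bs x)^2 +21*bs x +112 := by
    have ab := congrArg bs h
    have e : bs (21:K) =21 := map_ofNat bs 21
    have e' : bs (112:K) =112 := map_ofNat bs 112
    rw [map_pow, map_add, map_add, map_div₀, e, e'] at ab
    rw [ab]; field_simp
  by_contra hn
  have : bs x ≤0 := not_lt.1 hn
  nlinarith [sq_nonneg (2*bs x +21), mul_nonneg (sq_nonneg (bs ch)) (neg_nonneg.2 this)]
end
end MF
end
section
open NumberField Module Ideal
namespace MF
section
variable {K : Type*} [Field K] [NumberField K] [MF K]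
noncomputable def cm : K := cv*(1+th^5)^2
theorem gd : F 14 (cm - (1+th^9+th^11+th^13) : K) := jf
theorem gc : U 9 (cm : K) := by
  rw [U]
  have := Fa (Fm (jf (K:=K)) (show (9:ℤ) ≤14 by norm_num)) (Fa (Fa (Ft 9 (show (9:ℤ) ≤9 by norm_num)) (Ft 11 (show (9:ℤ) ≤11 by norm_num))) (Ft 13 (show (9:ℤ) ≤13 by norm_num)))
  rw [cm]; convert this using 1; ring
theorem SpZ {d z s : K} (hd : Sp d) (hz : U 9 z) (h : d*s^2 = z) :
    ∃ y r : K, U 21 y∧((∃ m : K, m≠0∧(d = m^2∨d = -7*m^2))∧(z*y)*r^2 =1∨(z*cm*y)*r^2 =1) := by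
  have lh := En (hz.E nN)
  have hs : s≠0 := by rintro rfl; apply lh; rw [← h]; ring
  have n9 : (cm:K)≠0 := En (gc.E nN)
  have t5 := En (ths (K:=K) 5 nN)
  have e9n := e9ne (K:=K)
  obtain ⟨m, hm, hh⟩ := Sp9 hd hz h
  rcases hh with hh | hh | hh | hh
  · exact ⟨1,1/(m*s), Uo _, Or.inl ⟨⟨m, hm, Or.inl hh⟩, by rw [← h, hh]; field_simp⟩⟩
  · exact ⟨-7,1/(7*m*s), iz, Or.inl ⟨⟨m, hm, Or.inr hh⟩, by rw [← h, hh]; field_simp⟩⟩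
  · exact ⟨1,1/(m*s*cv*(1+th^5)), Uo _, Or.inr (by rw [← h, hh, cm]; field_simp)⟩
  · exact ⟨-7,1/(7*m*s*cv*(1+th^5)), iz, Or.inr (by rw [← h, hh, cm]; field_simp)⟩
theorem FmulU {n k : ℤ} {x y : K} (hx : F n x) (hk : 1 ≤ k) (hy : U k y) : F n (x*y) := by
  simpa using Fmu hx (hy.E hk).F
theorem bm {n : ℤ} {x y : K} (hx : F n x) (hy : F 0 y) : F n (x*y) := by
  simpa using Fmu hx hy
theorem Fint {n : ℤ} {x : K} (hx : F n x) (k : ℤ) : F n (k*x) := by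
  simpa using Fmu (Fi k) hx
theorem ib {k : ℕ} {x y r : K} (hk : ¬ 2∣k) (ln : k ≤13) (hx : Lk k x) (hy : U 21 y) (h : (x*y)*r^2 =1) : False :=
  lead hk ln (Lkm hx (Um hy oO)) (Uo _) h
theorem lw {z : K} {n : ℤ} (dk c11 : ℤ) (hn : 9 ≤ n) (h : F n (z - (1 + dk*th^9 + c11*th^11))) : U 9 z := by
  have := Fa (Fm h hn) (Fa (Fint (Ft 9 (show (9:ℤ) ≤9 by norm_num)) dk) (Fint (Ft 11 (show (9:ℤ) ≤11 by norm_num)) c11))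
  rw [U]; convert this using 1; ring
theorem ns {d z s : K} (hd : Sp d) (hz : U 12 z) (h : d*s^2 = z) : ∃ m : K, m≠0∧(d = m^2∨d = -7*m^2) := by
  obtain ⟨y, r, hy,⟨hh,_⟩ | hh⟩ := SpZ hd (Um hz nN) h
  · exact hh
  · exfalso
    have : Lk 9 (cm : K) := by
      have := Fa (Fm (gd (K:=K)) (show (10:ℤ) ≤14 by norm_num)) (Fa (Ft 11 (show (10:ℤ) ≤11 by norm_num)) (Ft 13 (show (10:ℤ) ≤13 by norm_num)))
      rw [Lk]; push_cast; convert this using 1; ring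
    refine ib (k :=9) nN nN (Lkm this (Um hz nN)) hy (r := r) ?_
    rw [← hh]; ring
theorem bad9 {d z s : K} (hd : Sp d) (hz : F 12 (z - (1+th^9))) (h : d*s^2 = z) : False := by
  obtain ⟨y, r, hy,⟨_, hh⟩ | hh⟩ := SpZ hd (lw (n :=12) 1 0 nN (by push_cast; convert hz using 1; ring)) h
  · exact ib (k :=9) nN nN (Fm hz nN) hy hh
  · refine ib (k :=11) nN nN ?_ hy hh
    have e : z*cm - (1+th^11) = (z-(1+th^9))*cm + (1+th^9)*(cm - (1+th^9+th^11+th^13)) + (th^13 +2*th^9+th^18+th^20+th^22) := by ring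
    rw [Lk, e]; push_cast
    refine Fa (Fa ?_ ?_) ?_
    · exact Fm (FmulU hz nN gc) nN
    · rw [mul_comm]; exact Fm (bm gd (ths 9 nN).F) nN
    · exact Fa (Fa (Fa (Fa (Ft 13 nN) (Fm (Fmu Et.F (Eth 9).F) nN)) (Ft 18 nN)) (Ft 20 nN)) (Ft 22 nN)
theorem bad11 {d z s : K} (hd : Sp d) (hz : F 12 (z - (1+th^11))) (h : d*s^2 = z) : False := by
  obtain ⟨y, r, hy,⟨_, hh⟩ | hh⟩ := SpZ hd (lw (n :=12) 0 1 nN (by push_cast; convert hz using 1; ring)) h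
  · exact ib (k :=11) nN nN hz hy hh
  · refine ib (k :=9) nN nN ?_ hy hh
    have e : z*cm - (1+th^9) = (z-(1+th^11))*cm + (1+th^11)*(cm - (1+th^9+th^11+th^13)) + (th^13 +2*th^11+th^20+th^22+th^24) := by ring
    rw [Lk, e]; push_cast
    refine Fa (Fa ?_ ?_) ?_
    · exact Fm (FmulU hz nN gc) nN
    · rw [mul_comm]; exact Fm (bm gd (ths 11 nN).F) nN
    · exact Fa (Fa (Fa (Fa (Ft 13 nN) (Fm (Fmu Et.F (Eth 11).F) nN)) (Ft 20 nN)) (Ft 22 nN)) (Ft 24 nN)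
theorem bad911 {d z s : K} (hd : Sp d) (hz : F 14 (z - (1+th^9+th^11))) (h : d*s^2 = z) : False := by
  obtain ⟨y, r, hy,⟨_, hh⟩ | hh⟩ := SpZ hd (lw (n :=14) 1 1 nN (by push_cast; convert hz using 1; ring)) h
  · refine ib (k :=9) nN nN ?_ hy hh
    have := Fa (Fm hz (show (10:ℤ) ≤14 by norm_num)) (Ft 11 (show (10:ℤ) ≤11 by norm_num))
    rw [Lk]; push_cast; convert this using 1; ring
  · refine ib (k :=13) nN nN ?_ hy hh
    have e : z*cm - (1+th^13) = (z-(1+th^9+th^11))*cm + (cm - (1+th^9+th^11+th^13))*(1+th^9+th^11) + (2*th^9+2*th^11+th^18+2*th^20+2*th^22+th^24) := by ring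
    have aa : F 0 (1+th^9+th^11 : K) := Fa (ths 9 nN).F (Ft 11 nN)
    rw [Lk, e]; push_cast
    have ab : ∀ n : ℕ,7 ≤ n→F 14 (2*th^n : K) := fun n hn => Fm (Fmu Et.F (Eth n).F) oO
    refine Fa (Fa ?_ ?_) ?_
    · exact Fm (FmulU hz nN gc) nN
    · exact Fm (bm gd aa) nN
    · exact Fa (Fa (Fa (Fa (Fa (ab 9 nN) (ab 11 nN)) (Ft 18 nN)) (ab 20 nN)) (ab 22 nN)) (Ft 24 nN)
/-- class of `z` up to the square `S^2` -/
theorem bad9S {d z s S : K} (hd : Sp d) (ck : E 0 S) (hz : F 12 (z - S^2*(1+th^9))) (h : d*s^2 = z) : False := by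
  refine bad9 (z := z/S^2) (s := s/S) hd ?_ (by rw [div_pow, ← h]; ring)
  have := Fd hz (Ep ck 2)
  have e : z/S^2 - (1+th^9) = (z - S^2*(1+th^9))/S^2 := by field_simp [En ck]
  rw [e]; simpa using this
theorem bad11S {d z s S : K} (hd : Sp d) (ck : E 0 S) (hz : F 12 (z - S^2*(1+th^11))) (h : d*s^2 = z) : False := by
  refine bad11 (z := z/S^2) (s := s/S) hd ?_ (by rw [div_pow, ← h]; ring)
  have := Fd hz (Ep ck 2)
  have e : z/S^2 - (1+th^11) = (z - S^2*(1+th^11))/S^2 := by field_simp [En ck]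
  rw [e]; simpa using this
theorem bad911S {d z s S : K} (hd : Sp d) (ck : E 0 S) (hz : F 14 (z - S^2*(1+th^9+th^11))) (h : d*s^2 = z) : False := by
  refine bad911 (z := z/S^2) (s := s/S) hd ?_ (by rw [div_pow, ← h]; ring)
  have := Fd hz (Ep ck 2)
  have e : z/S^2 - (1+th^9+th^11) = (z - S^2*(1+th^9+th^11))/S^2 := by field_simp [En ck]
  rw [e]; simpa using this
theorem ls {d z s : K} (hd : Sp d) (hz : F 12 (z - (1+th^3))) (h : d*s^2 = z) : False := by
  have hc := cN3 (K:=K)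
  have kz := s3E (K:=K)
  refine bad11S (d := d*bf) (z := z*(bf*(1 + th + th^3 + th^5 + th^6)^2)) (s := s*(1 + th + th^3 + th^5 + th^6)) (Spm hd Spw) (ths 3 nN) ?_ (by rw [← h]; ring)
  have hc' : F 12 (bf*(1 + th + th^3 + th^5 + th^6)^2 - (1+th^3+th^11) : K) := by convert hc using 1; ring
  set N : K := bf*(1 + th + th^3 + th^5 + th^6)^2
  have e : z*N - (1+th^3)^2*(1+th^11) = (z-(1+th^3))*N + (N-(1+th^3+th^11))*(1+th^3) - (th^14+th^17) := by ring
  rw [e]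
  refine Fs (Fa ?_ ?_) (Fa (Ft 14 nN) (Ft 17 nN))
  · have : Lk 3 N := iu
    exact FmulU hz nN this.U
  · exact bm hc' (ths 3 nN).F
def Q (ai : K) : Prop := ∃ d s : K, Sp d∧F 14 (d*s^2 - (1-ai^2))
noncomputable def ef : K := (1-(th+th^3)^2) - ((1+th+th^3)*(1+th^4))^2*(1+th^9)
theorem cB1 : F 12 (ef : K) := by
  refine FP 12 _ 1 (-3339) (-266) (-1796) (-428) (-177) (-524) (-362) 2 2 2 2 2 1 1 nN nN ?_
  rw [ef]
  push_cast
  linear_combination ((-742) + (-59)*th + (-399)*th^2 + (-95)*th^3 + (-39)*th^4 + (-58)*th^5 + (-40)*th^6 + (-41)*th^7 + (-3)*th^8 + (-22)*th^9 + (-5)*th^10 + (-2)*th^11 + (-3)*th^12 + (-2)*th^13 + (-2)*th^14 + (-1)*th^16)*bv (K:=K)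
noncomputable def ee : K := (1-(th^2+th^4)^2) - (1+th^2+th^4)^2*(1+th^9)
theorem cB2 : F 12 (ee : K) := by
  refine FP 12 _ 1 (0) (-171) (-5) (-81) (-10) (0) (-29) 2 2 2 2 2 1 1 nN nN ?_
  rw [ee]
  push_cast
  linear_combination ((-38)*th + (-1)*th^2 + (-18)*th^3 + (-2)*th^4 + (-3)*th^6 + (-2)*th^8 + (-1)*th^10)*bv (K:=K)
theorem base1 {ai : K} (cp : Q ai) (h : F 5 (ai - (th+th^3))) : False := by
  obtain ⟨d, s, hd, hds⟩ := cp
  obtain ⟨t, rfl⟩ : ∃ t, ai = th+th^3+t := ⟨ai-(th+th^3), by ring⟩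
  rw [add_sub_cancel_left] at h
  have ar : F 0 ((1+th+th^3)*(1+th^4) : K) := by
    refine Fmu (n:=0) (m:=0) ?_ (ths 4 nN).F
    have := Fa (Fa (Eo (K:=K)).F (Ft 1 (show (0:ℤ) ≤1 by norm_num))) (Ft 3 (show (0:ℤ) ≤3 by norm_num))
    rwa [pow_one] at this
  have az : E 0 ((1+th+th^3)*(1+th^4)+t : K) := by
    refine Ea (n:=0) ?_ (Fm h nN)
    refine Em (n:=0) (m:=0) ?_ (ths 4 nN)
    have := Ea (Eo (K:=K)) (Fa (Ft (n :=0+1) 1 nN) (Ft 3 nN))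
    convert this using 1; ring
  have dh : F 12 (2*t) := Fm (Fmu Et.F h) nN
  refine bad9S (S := (1+th+th^3)*(1+th^4)+t) (s := s) hd az ?_ rfl
  have e : d*s^2 - ((1+th+th^3)*(1+th^4)+t)^2*(1+th^9) = (d*s^2 - (1-(th+th^3+t)^2)) + ef
     - (2*t)*(th^1+th^3) - (2*t)*(((1+th+th^3)*(1+th^4))*(1+th^9)) - (2*t)*t - t*t*th^9 := by rw [ef]; ring
  rw [e]
  refine Fs (Fs (Fs (Fs (Fa (Fm hds nN) cB1) ?_) ?_) ?_) ?_
  · exact bm dh (Fa (Ft 1 nN) (Ft 3 nN))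
  · exact bm dh (Fmu (n:=0) (m:=0) ar (ths 9 nN).F)
  · exact bm dh (Fm h nN)
  · exact Fm (Fmu (Fmu h h) (Eth 9).F) nN
theorem base2 {ai : K} (cp : Q ai) (h : F 5 (ai - (th^2+th^4))) : False := by
  obtain ⟨d, s, hd, hds⟩ := cp
  obtain ⟨t, rfl⟩ : ∃ t, ai = th^2+th^4+t := ⟨ai-(th^2+th^4), by ring⟩
  rw [add_sub_cancel_left] at h
  have ar : E 0 (1+th^2+th^4 : K) := Ea (ths 2 nN) (Ft 4 nN)
  have az : E 0 (1+th^2+th^4+t : K) := Ea ar (Fm h nN)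
  have dh : F 12 (2*t) := Fm (Fmu Et.F h) nN
  refine bad9S (S :=1+th^2+th^4+t) (s := s) hd az ?_ rfl
  have e : d*s^2 - (1+th^2+th^4+t)^2*(1+th^9) = (d*s^2 - (1-(th^2+th^4+t)^2)) + ee
     - (2*t)*(th^2+th^4) - (2*t)*((1+th^2+th^4)*(1+th^9)) - (2*t)*t - t*t*th^9 := by rw [ee]; ring
  rw [e]
  refine Fs (Fs (Fs (Fs (Fa (Fm hds nN) cB2) ?_) ?_) ?_) ?_
  · exact bm dh (Fa (Ft 2 nN) (Ft 4 nN))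
  · exact bm dh (Fmu (n:=0) (m:=0) ar.F (ths 9 nN).F)
  · exact bm dh (Fm h nN)
  · exact Fm (Fmu (Fmu h h) (Eth 9).F) nN
noncomputable def ec : K := (1-(th^2-th^6)^2) - (1+th^2+th^6)^2*(1+th^9+th^11)
theorem cB3 : F 14 (ec : K) := by
  refine FP 14 _ 1 (-1458) (-243) (-1463) (-324) (-14) (-171) (-14) 2 2 2 2 2 2 2 nN nN ?_
  rw [ec]
  push_cast
  linear_combination ((-324) + (-54)*th + (-325)*th^2 + (-72)*th^3 + (-3)*th^4 + (-38)*th^5 + (-3)*th^6 + (-18)*th^7 + (-3)*th^8 + (-18)*th^9 + (-4)*th^10 + (-2)*th^12 + (-1)*th^14 + (-1)*th^16)*bv (K:=K)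
theorem base3 {ai : K} (cp : Q ai) (h : F 7 (ai - (th^2-th^6))) : False := by
  obtain ⟨d, s, hd, hds⟩ := cp
  obtain ⟨t, rfl⟩ : ∃ t, ai = th^2-th^6+t := ⟨ai-(th^2-th^6), by ring⟩
  rw [add_sub_cancel_left] at h
  have ar : E 0 (1+th^2+th^6 : K) := Ea (ths 2 nN) (Ft 6 nN)
  have dh : F 14 (2*t) := Fm (Fmu Et.F h) nN
  refine bad911S (S :=1+th^2+th^6) (s := s) hd ar ?_ rfl
  have e : d*s^2 - (1+th^2+th^6)^2*(1+th^9+th^11) = (d*s^2 - (1-(th^2-th^6+t)^2)) + ec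
     - (2*t)*(th^2-th^6) - t*t := by rw [ec]; ring
  rw [e]
  refine Fs (Fs (Fa hds cB3) ?_) (Fmu h h)
  exact bm dh (Fs (Ft 2 nN) (Ft 6 nN))
end
end MF
end
section
open NumberField Module Ideal
namespace MF
section
variable {K : Type*} [Field K] [NumberField K] [MF K]
theorem pick {p q S P : K} {a b : ℤ} (ck : E a S) (aj : E b P) (h : 2*a < b) (aa : p+q = S) (ab : p*q = P) :
    E a p∨E a q := by
  have hp : p≠0 := by rintro rfl; rw [zero_mul] at ab; exact En aj ab.symm
  have hq : q≠0 := by rintro rfl; rw [mul_zero] at ab; exact En aj ab.symm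
  obtain ⟨i, hi⟩ := Ee hp
  obtain ⟨j, hj⟩ := Ee hq
  have ae := Em hi hj
  rw [ab] at ae
  have au := Eu aj ae
  rcases lt_trichotomy i j with hij | hij | hij
  · left
    have := Ea hi (Fm hj.F oO)
    rw [aa] at this; rwa [Eu ck this]
  · exfalso
    have := Fa hi.F (Fm hj.F oO)
    rw [aa] at this
    have := EF ck this; omega
  · right
    have := Ea hj (Fm hi.F oO)
    rw [add_comm, aa] at this; rwa [Eu ck this]
theorem sqrt16 {y w : K} (hw : E 0 w) (h : F 16 (y^2-w^2)) : F 9 (y-w)∨F 9 (y+w) := by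
  by_contra hc
  push Not at hc
  have hp : y - w≠0 := by intro ak; apply hc.1; rw [ak]; exact Fze _
  have hq : y + w≠0 := by intro ak; apply hc.2; rw [ak]; exact Fze _
  obtain ⟨i, hi⟩ := Ee hp
  obtain ⟨j, hj⟩ := Ee hq
  have hi9 : i <9 := by by_contra dw; exact hc.1 (Fm hi.F oO)
  have hj9 : j <9 := by by_contra dw; exact hc.2 (Fm hj.F oO)
  have aa := Em hj hi
  rw [show (y+w)*(y-w) = y^2-w^2 by ring] at aa
  have ab := EF aa h
  have ae := Fs (Fm hj.F (show (8:ℤ) ≤ j by omega)) (Fm hi.F (show (8:ℤ) ≤ i by omega))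
  rw [show (y+w)-(y-w) =2*w by ring] at ae
  have := EF (Em Et hw) ae
  omega
theorem sq14 {m : K} (h : E 14 (m^2-1)) : False := by
  have hp : m -1≠0 := by
    intro ak; apply En h; rw [show m^2-1 = (m-1)*(m+1) by ring, ak, zero_mul]
  have hq : m +1≠0 := by
    intro ak; apply En h; rw [show m^2-1 = (m-1)*(m+1) by ring, ak, mul_zero]
  obtain ⟨i, hi⟩ := Ee hp
  obtain ⟨j, hj⟩ := Ee hq
  have aa := Em hi hj
  rw [show (m-1)*(m+1) = m^2-1 by ring] at aa
  have ab := Eu h aa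
  have bl := Et (K:=K)
  rcases lt_trichotomy i 7 with ao | ao | ao
  · have := Ea hi (Fm bl.F (show i+1 ≤7 by omega))
    rw [show m-1+2 = m+1 by ring] at this
    have := Eu hj this; omega
  · subst ao
    have := Es hi bl
    have au := Ene bl
    have hj7 : j =7 := by omega
    subst hj7
    have bh := Es hj hi
    rw [show m+1-(m-1) =2 by ring] at bh
    have := EF bl bh; omega
  · have := Ea bl (Fm hi.F (show (7:ℤ)+1 ≤ i by omega))
    rw [show 2+(m-1) = m+1 by ring] at this
    have := Eu hj this; omega
theorem kt : E 28 (112:K) := by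
  have := Em (Ep (Et (K:=K)) 4) eo
  norm_num at this; exact this
theorem oh : E 0 (21:K) := by have := Eod (K:=K) 21 nN; exact_mod_cast this
theorem FF (n : ℤ) : F 0 (n:K) := Fi n
theorem Ftw (k : ℕ) (c : ℤ) (x : K) (n m : ℤ) (hx : F m x) (h : n ≤7*k+m) : F n (2^k*c*x) :=
  Fm (Fmu (Fmu (Ep Et k).F (Fi c)) hx) (by linarith)
theorem Qp {x ai : K} {f : ℤ} (hf : 1 ≤ f) (ap : E f ai) (hx : E (-2*f) x) (h : (1/ai)^2 = x+21+112/x) : Q ai := by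
  have ak := En ap
  have ie := En hx
  refine ⟨x, ai, gf (n := -f) (by convert hx using 1; ring) h,?_⟩
  have e : x*ai^2 - (1-ai^2) = -(2^2*(5:ℤ)*ai^2) -112/x*ai^2 := by
    have aa : (1/ai)^2*ai^2 =1 := by field_simp
    rw [h] at aa
    push_cast; linear_combination aa
  rw [e]
  have ab := (Ep ap 2).F
  refine Fs (Fn (Ftw 2 5 _ _ _ ab (by push_cast; linarith))) ?_
  exact Fm (Fmu (Ed kt hx).F ab) (by push_cast; linarith)
theorem nn_aux {n T X : K} {f : ℤ} (hf : 1 ≤ f) (hn : E f n) (hX : E (-2*f) X) (jx : T = X*n^2)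
    (h : X*n^2 -42*n^2 -7/X*n^2 =1) : F 12 (T - (1+n^2+n^4)^2)∧E 0 T := by
  have gb : E 0 T := by
    rw [jx]; convert Em hX (Ep hn 2) using 1; push_cast; ring
  have hTn := En gb
  have hX0 := En hX
  have ew : F 1 n := Fm hn.F hf
  have js : F 0 n := Fm ew nN
  have hTe : T =1 +42*n^2+7*n^4/T := by
    have : 7/X*n^2 =7*n^4/T := by rw [jx]; field_simp [En hn]
    rw [← this, jx]; linear_combination h
  have eb : F 2 (n^2) := by rw [pow_two]; exact Fmu ew ew
  have dt : F 4 (n^4) := by rw [show n^4 = n^2*n^2 by ring]; exact Fmu eb eb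
  have n8 : F 8 (n^8) := by rw [show n^8 = n^4*n^4 by ring]; exact Fmu dt dt
  have ja : F 4 (T -1) := by
    have e : T -1 =2^1*(21:ℤ)*n^2 + (7*n^4)/T := by push_cast; linear_combination hTe
    rw [e]
    refine Fa (Ftw 1 21 _ _ _ eb nN) ?_
    simpa using Fd (Fmu eo.F dt) gb
  have ti := Ei gb
  rw [neg_zero] at ti
  refine ⟨?_, gb⟩
  have hi : T⁻¹ =1 - (T-1) + (T-1)*(T-1)*T⁻¹ := by field_simp; ring
  have e : T - (1+n^2+n^4)^2 =2^3*(5:ℤ)*n^2 +2^2*(1:ℤ)*n^4 -2^1*(1:ℤ)*(n^2*n^4) -2^1*(25:ℤ)*(n^4*n^4)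
     - 2^1*(147:ℤ)*(n^4*n^2) + (49:ℤ)*(n^4*n^4*((T-1)*T⁻¹)) + (7:ℤ)*(n^4*((T-1)*(T-1)*T⁻¹)) := by
    have aa : T =1+42*n^2+7*n^4*T⁻¹ := by rw [← div_eq_mul_inv]; exact hTe
    have ab : T*T⁻¹ =1 := mul_inv_cancel₀ hTn
    push_cast
    linear_combination aa +7*n^4*hi + (-7*n^4) * aa + (-49*n^8)*ab
  rw [e]
  refine Fa (Fa (Fs (Fs (Fs (Fa ?_ ?_) ?_) ?_) ?_) ?_) ?_
  · exact Ftw 3 5 _ _ _ eb nN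
  · exact Ftw 2 1 _ _ _ dt nN
  · exact Ftw 1 1 _ _ _ (Fmu eb dt) nN
  · exact Ftw 1 25 _ _ _ (Fmu dt dt) nN
  · exact Ftw 1 147 _ _ _ (Fmu dt eb) nN
  · exact Fm (Fint (Fmu (Fmu dt dt) (Fmu ja ti.F)) _) nN
  · exact Fm (Fint (Fmu dt (Fmu (Fmu ja ja) ti.F)) _) nN
theorem step {x r : K} {e : ℤ} (he : 8 ≤ e) (hr : E e r) (hx : E (-2*e) x) (h : (1/r)^2 = x+21+112/x) :
    ∃ ai w, E (e-7) ai∧(F 4 (w - (1+ai^2))∧(9 ≤ e→F 7 (w - (1+ai^2))))∧r =2*ai*w∧Q ai ∧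
      (15 ≤ e → ∃ x', E (-2*(e-7)) x' ∧ (1/ai)^2 = x'+21+112/x') := by
  obtain ⟨bs⟩ := real_ex (K:=K)
  have mx := En hr
  have ie := En hx
  have hSx : Sp x := gf (n := -e) (by convert hx using 1; ring) h
  -- x is a square
  have ll : U 12 (x*r^2) := by
    have av : x*r^2 -1 = -((21:ℤ)*r^2) -112/x*r^2 := by
      have aa : (1/r)^2*r^2 =1 := by field_simp
      rw [h] at aa
      push_cast; linear_combination aa
    rw [U, av]
    have ab := (Ep hr 2).F
    refine Fs (Fn (Fint (Fm ab ?_) _)) ?_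
    · push_cast; linarith
    · exact Fm (Fmu (Ed kt hx).F ab) (by push_cast; linarith)
  obtain ⟨de, hξ0, hxi⟩ : ∃ bd : K, bd≠0∧x = bd^2 := by
    obtain ⟨m, hm, aa | aa⟩ := ns hSx ll rfl
    · exact ⟨m, hm, aa⟩
    · exfalso
      have hp := pos1 bs ie h
      rw [aa, map_mul, map_neg, map_pow, show bs 7 =7 from map_ofNat bs 7] at hp
      nlinarith [sq_nonneg (bs m)]
  have kq : E 14 (4:K) := by have := Ep (Et (K:=K)) 2; norm_num at this; exact this
  -- X
  obtain ⟨bd, X, hξ, hxi, hXd, hXE⟩ : ∃ bd X : K, bd≠0∧x = bd^2∧X =21+2*bd^2+2*bd*(1/r)∧E (14-2*e) X := by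
    have ck : E (14-2*e) (42+4*x) := by
      rw [add_comm]
      refine Ea ?_ (y := (42:K)) ?_
      · convert Em kq hx using 1; ring
      · have := Fint (Et (K:=K)).F 21
        norm_num at this
        exact Fm this oO
    have hh := pick (p :=21+2*de^2+2*de*(1/r)) (q :=21+2*de^2+2*(-de)*(1/r)) (b :=0) (P := -7) ck (Ene eo) oO
      (by rw [hxi]; ring) (by
        have : (1/r)^2*de^2 = de^4+21*de^2+112 := by rw [h, hxi]; field_simp
        linear_combination -4*this)
    rcases hh with hh | hh
    · exact ⟨de,_, hξ0, hxi, rfl, hh⟩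
    · exact ⟨-de,_, neg_ne_zero.2 hξ0, by rw [hxi]; ring, by rw [neg_pow_two], hh⟩
  have hX0 := En hXE
  have hq : (1/r)^2*bd^2 = bd^4+21*bd^2+112 := by rw [h, hxi]; field_simp
  have hXq : X^2 - (42+4*bd^2)*X -7 =0 := by
    rw [hXd]; linear_combination 4*hq
  have ej : (2*bd)^2 = X -42 -7/X := by
    field_simp; linear_combination -hXq
  have hX2 : 4*bd*(1/r) = X +7/X := by
    have : 7/X = X - (42+4*bd^2) := by field_simp; linear_combination -hXq
    rw [this, hXd]; ring
  have li : r*(X+7/X) =4*bd := by rw [← hX2]; field_simp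
  obtain ⟨f, hf⟩ : ∃ f, f = e-7 := ⟨_, rfl⟩
  have hf1 : 1 ≤ f := by omega
  have hXE' : E (-2*f) X := by convert hXE using 1; rw [hf]; ring
  rw [← hf]
  have hSX : Sp X := E1b (n := -f) (by convert hXE' using 1; ring) ej
  -- valuation of 2ξ
  obtain ⟨a, ha⟩ := Ee hξ
  have ha' : a = -e := by
    have := Ep ha 2
    rw [← hxi] at this
    have := Eu hx this; push_cast at this; omega
  subst ha'
  have na : E f (1/(2*bd)) := by
    have := Ei (Em Et ha)
    rw [one_div]; convert this using 1; omega
  have jx := nn_aux (n :=1/(2*bd)) (X := X) hf1 na hXE' rfl (by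
    have : (1/(2*bd))^2*(2*bd)^2 =1 := by field_simp
    linear_combination this - (1/(2*bd))^2*ej)
  have hw : E 0 (1+(1/(2*bd))^2+(1/(2*bd))^4) := by
    have ab := Ep na 2
    have au := Ep na 4
    push_cast at ab au
    exact Ea (Ea Eo (Fm ab.F oO)) (Fm au.F oO)
  obtain ⟨m, hm, gw⟩ : ∃ m : K, m≠0∧(X = m^2∨X = -7*m^2) := by
    refine ns (s := (1/(2*bd))/(1+(1/(2*bd))^2+(1/(2*bd))^4)) hSX ?_ rfl
    set n :=1/(2*bd)
    set W :=1+n^2+n^4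
    have := Fd jx.1 (Ep hw 2)
    rw [U]
    have av : X*(n/W)^2 -1 = (X*n^2-W^2)/W^2 := by field_simp [En hw]
    rw [av]; simpa using this
  -- signs
  have hmE : E (-f) m := by
    obtain ⟨b, hb⟩ := Ee hm
    have : b = -f := by
      rcases gw with aa | aa
      · rw [aa] at hXE'; have := Eu hXE' (Ep hb 2); push_cast at this; omega
      · rw [aa] at hXE'; have := Eu hXE' (Em (Ene eo) (Ep hb 2)); push_cast at this; omega
    rwa [this] at hb
  have db : ∀ m' : K, m' = m∨m' = -m→E f (1/m') := by
    rintro m' (rfl | rfl)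
    · rw [one_div]; simpa using Ei hmE
    · rw [one_div]; simpa using Ei (Ene hmE)
  have hpow : ∀ ai : K, E f ai→F 2 (ai^2)∧F 4 (ai^4)∧F f ai := by
    intro ai ap
    have ab := (Ep ap 2).F
    have au := (Ep ap 4).F
    push_cast at ab au
    exact ⟨Fm ab oO, Fm au oO, ap.F⟩
  have fh : ∀ ai : K, E f ai→E 0 (1+ai^2) := fun ai ap => Ea Eo (Fm (hpow ai ap).1 nN)
  rcases gw with gw | gw
  · -- case A
    have hy : (2*bd*(1/m))^2 =1 -42*(1/m)^2 -7*(1/m)^4 := by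
      rw [mul_pow, ej, gw]; field_simp
    have hs := sqrt16 (y :=2*bd*(1/m)) (fh _ (db m (Or.inl rfl))) (by
      obtain ⟨ab, au, -⟩ := hpow _ (db m (Or.inl rfl))
      rw [hy]
      have av : 1 -42*(1/m)^2 -7*(1/m)^4 - (1+(1/m)^2)^2 = -(2^2*(11:ℤ)*(1/m)^2) -2^3*(1:ℤ)*(1/m)^4 := by push_cast; ring
      rw [av]
      exact Fs (Fn (Ftw 2 11 _ _ _ ab nN)) (Ftw 3 1 _ _ _ au nN))
    obtain ⟨M, fw, np, hs'⟩ : ∃ M : K, (M = m∨M = -m)∧M^2 = m^2∧F 9 (2*bd*(1/M) - (1+(1/M)^2)) := by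
      rcases hs with hs | hs
      · exact ⟨m, Or.inl rfl, rfl, hs⟩
      · refine ⟨-m, Or.inr rfl, by ring,?_⟩
        have := Fn hs
        convert this using 1; field_simp; ring
    have ap := db M fw
    have fg : M≠0 := by rcases fw with rfl | rfl <;> simpa using hm
    have jo : X = M^2 := by rw [gw, np]
    obtain ⟨ab, au, -⟩ := hpow _ ap
    have hd : E 0 (1+7*(1/M)^4) := Ea Eo (Fm (Fmu eo.F au) nN)
    have hpt : ∃ x', E (-2*f) x' ∧ (1/(1/M))^2 = x'+21+112/x' := by
      have ck : E (-2*f) (M^2-21) := by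
        rw [← jo, sub_eq_add_neg]; exact Ea hXE' (Fm (Ene oh).F oO)
      have aj : (M^2-21+2*bd*M)/2*((M^2-21-2*bd*M)/2) =112 := by
        have : (2*bd)^2*M^2 = M^4-42*M^2-7 := by rw [ej, jo]; field_simp
        linear_combination (-1/4)*this
      have n112 : (112:K)≠0 := by norm_num
      rw [one_div_one_div]
      rcases pick (p := (M^2-21+2*bd*M)/2) (q := (M^2-21-2*bd*M)/2) ck kt oO (by ring) aj with hh | hh
      · refine ⟨_, hh,?_⟩
        rw [← aj, mul_div_cancel_left₀ _ (En hh)]; ring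
      · refine ⟨_, hh,?_⟩
        rw [← aj, mul_div_cancel_right₀ _ (En hh)]; ring
    refine ⟨1/M,2*bd*(1/M)/(1+7*(1/M)^4), ap,?_,?_,?_, fun _ => hpt⟩
    · have av : 2*bd*(1/M)/(1+7*(1/M)^4) - (1+(1/M)^2) = ((2*bd*(1/M) - (1+(1/M)^2)) - (7:ℤ)*((1/M)^4*(1+(1/M)^2)))/(1+7*(1/M)^4) := by
        rw [eq_div_iff (En hd), sub_mul, div_mul_cancel₀ _ (En hd)]; push_cast; ring
      have key : ∀ k : ℤ, k ≤9→F k ((1/M)^4)→F k (2*bd*(1/M)/(1+7*(1/M)^4) - (1+(1/M)^2)) := by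
        intro k hk nc
        rw [av]
        have := Fd (Fs (Fm hs' hk) (Fint (bm nc (fh _ ap).F) 7)) hd
        simpa using this
      refine ⟨key 4 nN au, fun dw => key 7 nN ?_⟩
      have := (Ep ap 4).F
      push_cast at this
      exact Fm this oO
    · have hdn := En hd
      have nl : X +7/X = M^2*(1+7*(1/M)^4) := by rw [jo]; field_simp
      rw [nl] at li
      have : r =4*bd/(M^2*(1+7*(1/M)^4)) := by
        rw [eq_div_iff (mul_ne_zero (pow_ne_zero 2 fg) hdn)]; exact li
      rw [this, div_eq_iff (mul_ne_zero (pow_ne_zero 2 fg) hdn)]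
      have av : 2*(1/M)*(2*bd*(1/M)/(1+7*(1/M)^4))*(M^2*(1+7*(1/M)^4)) =
        4*bd*((1/M)^2*M^2)*((1+7*(1/M)^4)/(1+7*(1/M)^4)) := by ring
      rw [av, div_self hdn]; field_simp
    · obtain ⟨x', hx', hh⟩ := hpt
      exact Qp hf1 ap hx' hh
  · -- case B
    have hy : (2*bd*(1/m))^2 = (1/m)^4 -42*(1/m)^2 -7 := by
      rw [mul_pow, ej, gw]; field_simp; ring
    have hs := sqrt16 (y :=2*bd*(1/m)) (fh _ (db m (Or.inl rfl))) (by
      obtain ⟨ab, au, -⟩ := hpow _ (db m (Or.inl rfl))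
      rw [hy]
      have av : (1/m)^4 -42*(1/m)^2 -7 - (1+(1/m)^2)^2 = -(2^2*(11:ℤ)*(1/m)^2) -2^3*(1:ℤ)*1 := by push_cast; ring
      rw [av]
      exact Fs (Fn (Ftw 2 11 _ _ _ ab nN)) (Ftw 3 1 _ _ _ Eo.F nN))
    obtain ⟨M, fw, np, hs'⟩ : ∃ M : K, (M = m∨M = -m)∧M^2 = m^2∧F 9 (-(2*bd*(1/M)) - (1+(1/M)^2)) := by
      rcases hs with hs | hs
      · refine ⟨-m, Or.inr rfl, by ring,?_⟩
        convert hs using 1; field_simp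
      · refine ⟨m, Or.inl rfl, rfl,?_⟩
        have := Fn hs
        convert this using 1; ring
    have ap := db M fw
    have fg : M≠0 := by rcases fw with rfl | rfl <;> simpa using hm
    have jo : X = -7*M^2 := by rw [gw, np]
    obtain ⟨ab, au, -⟩ := hpow _ ap
    have h2f := (Ep ap 2).F
    push_cast at h2f
    have hd : E 0 (7+(1/M)^4) := Ea eo (Fm au nN)
    obtain ⟨x', hx', hh⟩ : ∃ x', E 0 x' ∧ (1/M)^2 = x'+21+112/x' := by
      have ck : E 0 ((1/M)^2-21) := by
        rw [← neg_sub]; apply Ene; rw [sub_eq_add_neg]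
        exact Ea oh (Fm (Fn ab) nN)
      have aj : ((1/M)^2-21+2*bd*(1/M))/2*(((1/M)^2-21-2*bd*(1/M))/2) =112 := by
        have : (2*bd)^2*(1/M)^2 = (1/M)^4-42*(1/M)^2-7 := by rw [ej, jo]; field_simp; ring
        linear_combination (-1/4)*this
      rcases pick ck kt oO (by ring) aj with hh | hh
      · refine ⟨_, hh,?_⟩
        rw [← aj, mul_div_cancel_left₀ _ (En hh)]; ring
      · refine ⟨_, hh,?_⟩
        rw [← aj, mul_div_cancel_right₀ _ (En hh)]; ring
    have hSx' : Sp (-x') := by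
      have := Spm Spm1 (gf (n :=0) (by simpa using hx') hh)
      rwa [neg_one_mul] at this
    have hcl : ∀ c : K, F 28 ((-x')-(21-(1/M)^2)) := by
      intro _
      have av : (-x')-(21-(1/M)^2) =112/x' := by rw [hh]; ring
      rw [av]; exact (Ed kt hx').F
    refine ⟨1/M, -(2*bd*(1/M))/(7+(1/M)^4), ap,?_,?_,?_,?_⟩
    · have av : -(2*bd*(1/M))/(7+(1/M)^4) - (1+(1/M)^2) = ((-(2*bd*(1/M)) - (1+(1/M)^2)) -2^1*(3:ℤ)*(1+(1/M)^2) - ((1/M)^4*(1+(1/M)^2)))/(7+(1/M)^4) := by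
        rw [eq_div_iff (En hd), sub_mul, div_mul_cancel₀ _ (En hd)]; push_cast; ring
      have key : ∀ k : ℤ, k ≤7→F k ((1/M)^4)→F k (-(2*bd*(1/M))/(7+(1/M)^4) - (1+(1/M)^2)) := by
        intro k hk nc
        rw [av]
        have := Fd (Fs (Fs (Fm hs' (show k ≤9 by omega)) (Ftw 1 3 _ k _ (fh _ ap).F (by push_cast; linarith))) (bm nc (fh _ ap).F)) hd
        simpa using this
      refine ⟨key 4 nN au, fun dw => key 7 nN ?_⟩
      have := (Ep ap 4).F
      push_cast at this
      exact Fm this oO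
    · have hdn := En hd
      have nl : X +7/X = -(M^2*(7+(1/M)^4)) := by rw [jo]; field_simp; ring
      rw [nl] at li
      have : r = -(4*bd)/(M^2*(7+(1/M)^4)) := by
        rw [eq_div_iff (mul_ne_zero (pow_ne_zero 2 fg) hdn)]; linear_combination -li
      rw [this, div_eq_iff (mul_ne_zero (pow_ne_zero 2 fg) hdn)]
      have av : 2*(1/M)*(-(2*bd*(1/M))/(7+(1/M)^4))*(M^2*(7+(1/M)^4)) =
        -(4*bd)*((1/M)^2*M^2)*((7+(1/M)^4)/(7+(1/M)^4)) := by ring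
      rw [av, div_self hdn]; field_simp
    · refine ⟨-x',1, hSx',?_⟩
      have av : -x'*1^2 - (1-(1/M)^2) = ((-x')-(21-(1/M)^2)) +2^2*(5:ℤ)*1 := by push_cast; ring
      rw [av]
      exact Fa (Fm (hcl 0) nN) (Ftw 2 5 _ _ _ Eo.F nN)
    · intro h15
      exfalso
      have fj : F 16 ((1/M)^2) := Fm h2f oO
      obtain ⟨kv, -, fd⟩ := ns (z := -x') (s :=1) hSx' (by
        have av : -x' - 1 = ((-x')-(21-(1/M)^2)) +2^2*(5:ℤ)*1 - (1/M)^2 := by push_cast; ring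
        rw [U, av]
        exact Fs (Fa (Fm (hcl 0) nN) (Ftw 2 5 _ _ _ Eo.F nN)) (Fm fj nN)) (by ring)
      have fz : E 0 (5:K) := by have := Eod (K:=K) 5 nN; exact_mod_cast this
      rcases fd with fd | fd
      · apply sq14 (m := kv)
        have av : kv^2-1 =4*5 + (((-x')-(21-(1/M)^2)) - (1/M)^2) := by rw [← fd]; ring
        rw [av]
        refine Ea (by simpa using Em kq fz) (Fs (Fm (hcl 0) nN) (Fm fj nN))
      · apply sq14 (m := kv)
        have av : kv^2-1 = (4*7 + (((-x')-(21-(1/M)^2)) - (1/M)^2))/(-7) := by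
          rw [eq_div_iff nN]; linear_combination -fd
        rw [av]
        have := Ed (Ea (Em kq eo) (y := ((-x')-(21-(1/M)^2)) - (1/M)^2) (Fs (Fm (hcl 0) nN) (Fm fj nN))) (Ene eo)
        simpa using this
end
end MF
end
section
open NumberField Module Ideal
namespace MF
section
variable {K : Type*} [Field K] [NumberField K] [MF K]
theorem Fe {n m : ℤ} {x y : K} (h : F n x) (hn : m ≤ n) (hx : y = x) : F m y := by
  rw [hx]; exact Fm h hn
theorem E_eq {n m : ℤ} {x y : K} (h : E n x) (hn : m = n) (hx : y = x) : E m y := by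
  rw [hx, hn]; exact h
/-- from r =2ρw with w a unit close to 1 -/
theorem Fh {n : ℤ} {y : K} (h : F (n+7) (2*y)) : F n y := by
  have := Fd h Et
  rwa [mul_div_cancel_left₀ _ two_ne_zero, add_sub_cancel_right] at this
theorem fr (i : ℕ) : ∀ {x r : K}, E (7*(i+1)+1) r→E (-2*(7*(i+1)+1)) x→(1/r)^2 = x+21+112/x →
    F (7*(i+1)+5) (r -2^(i+1)*th)→False := by
  induction i with
  | zero =>
    intro x r hr hx h dc
    push_cast at *
    obtain ⟨ai, w, ap,⟨hw, hw7⟩, hrw, cp, -⟩ := step nN hr hx h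
    norm_num at ap dc
    have aa : F 5 (ai*w - th) := Fh (Fe dc nN (by rw [hrw]; ring))
    apply base1 cp
    have er := ap.F
    have ab : F 5 (ai*(w-(1+ai^2))) := Fmu er hw
    have ae : F 5 (ai + ai^3 - th) := by
      convert Fs aa ab using 1; ring
    have eg : F 1 (th : K) := by simpa using Ft (K:=K) (n:=1) 1 nN
    have mb : F 3 (ai - th) := by
      have ma : F 3 (ai^3) := by simpa using (Ep ap 3).F
      convert Fs (Fm ae (show (3:ℤ) ≤5 by norm_num)) ma using 1; ring
    have lz : F 5 (ai^3 - th^3) := by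
      have : F 2 (ai^2+ai*th+th^2) := by
        rw [pow_two, pow_two]
        exact Fa (Fa (Fmu er er) (Fmu er eg)) (Fmu eg eg)
      exact Fe (Fmu mb this) nN (by ring)
    have bh : F 5 (2*th^3 : K) := Fm (Fmu Et.F (Ft 3 le_rfl)) nN
    convert Fs (Fs ae lz) bh using 1; ring
  | succ i ih =>
    intro x r hr hx h dc
    push_cast at *
    obtain ⟨ai, w, ap,⟨hw, hw7⟩, hrw, cp, hpt⟩ := step oO hr hx h
    obtain ⟨x', hx', h'⟩ := hpt oO
    have bx : E (7*(i+1)+1) ai := by convert ap using 1; ring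
    refine ih bx (by convert hx' using 1; ring) h' ?_
    have aa : F (7*(i+1)+5) (ai*w -2^(i+1)*th) := Fh (by
      rw [hrw] at dc
      have : 2*(ai*w-2^(i+1)*th) =2*ai*w -2^(i+1+1)*th := by ring
      rw [this]; exact Fm dc oO)
    have ab : F 4 (w -1) := by
      have ae := (Ep bx 2).F
      push_cast at ae
      convert Fa hw (Fm ae oO) using 1; ring
    have ae := Fm (Fmu bx.F ab) (show (7*(i+1)+5:ℤ) ≤ _ by omega)
    convert Fs aa ae using 1; ring
theorem fy (i : ℕ) : ∀ {x r : K}, E (7*i+2) r→E (-2*(7*i+2)) x→(1/r)^2 = x+21+112/x →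
    F (7*i+5) (r -2^i*(th^2+th^4))→False := by
  induction i with
  | zero =>
    intro x r hr hx h dc
    norm_num at *
    exact base2 (Qp (f :=2) nN hr (by simpa using hx) (by simpa using h)) dc
  | succ i ih =>
    intro x r hr hx h dc
    push_cast at *
    obtain ⟨ai, w, ap,⟨hw, hw7⟩, hrw, cp, hpt⟩ := step oO hr hx h
    have bx : E (7*i+2) ai := by convert ap using 1; ring
    have aa : F (7*i+5) (ai*w -2^i*(th^2+th^4)) := Fh (by
      rw [hrw] at dc
      have : 2*(ai*w-2^i*(th^2+th^4)) =2*ai*w -2^(i+1)*(th^2+th^4) := by ring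
      rw [this]; exact Fm dc oO)
    have ab : F 4 (w -1) := by
      have ae := (Ep bx 2).F
      push_cast at ae
      convert Fa hw (Fm ae oO) using 1; ring
    have ae := Fm (Fmu bx.F ab) (show (7*i+5:ℤ) ≤ _ by omega)
    have au : F (7*i+5) (ai -2^i*(th^2+th^4)) := by convert Fs aa ae using 1; ring
    by_cases h15 : (15:ℤ) ≤7*(i+1)+2
    · obtain ⟨x', hx', h'⟩ := hpt h15
      exact ih bx (by convert hx' using 1; ring) h' au
    · have : i =0 := by omega
      subst this
      norm_num at au
      exact base2 cp au
theorem H3 (i : ℕ) : ∀ {x r : K}, E (7*(i+1)+2) r→E (-2*(7*(i+1)+2)) x→(1/r)^2 = x+21+112/x →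
    F (7*(i+1)+7) (r -2^(i+1)*th^2)→False := by
  induction i with
  | zero =>
    intro x r hr hx h dc
    push_cast at *
    obtain ⟨ai, w, ap,⟨-, hw⟩, hrw, cp, -⟩ := step nN hr hx h
    specialize hw nN
    norm_num at ap dc
    have aa : F 7 (ai*w - th^2) := Fh (Fe dc nN (by rw [hrw]; ring))
    apply base3 cp
    have er := ap.F
    have ab : F 7 (ai*(w-(1+ai^2))) := Fm (Fmu er hw) nN
    have ae : F 7 (ai + ai^3 - th^2) := by
      convert Fs aa ab using 1; ring
    have eg : F 2 (th^2 : K) := Ft 2 le_rfl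
    have mb : F 6 (ai - th^2) := by
      have ma : F 6 (ai^3) := by simpa using (Ep ap 3).F
      convert Fs (Fm ae (show (6:ℤ) ≤7 by norm_num)) ma using 1; ring
    have lz : F 7 (ai^3 - th^6) := by
      have : F 4 (ai^2+ai*th^2+th^2*th^2) := by
        rw [pow_two]
        exact Fa (Fa (Fmu er er) (Fmu er eg)) (Fmu eg eg)
      exact Fe (Fmu mb this) nN (by ring)
    convert Fs ae lz using 1; ring
  | succ i ih =>
    intro x r hr hx h dc
    push_cast at *
    obtain ⟨ai, w, ap,⟨-, hw⟩, hrw, cp, hpt⟩ := step oO hr hx h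
    specialize hw oO
    obtain ⟨x', hx', h'⟩ := hpt oO
    have bx : E (7*(i+1)+2) ai := by convert ap using 1; ring
    refine ih bx (by convert hx' using 1; ring) h' ?_
    have aa : F (7*(i+1)+7) (ai*w -2^(i+1)*th^2) := Fh (by
      rw [hrw] at dc
      have : 2*(ai*w-2^(i+1)*th^2) =2*ai*w -2^(i+1+1)*th^2 := by ring
      rw [this]; exact Fm dc oO)
    have ab : F 7 (w -1) := by
      have ae := (Ep bx 2).F
      push_cast at ae
      convert Fa hw (Fm ae oO) using 1; ring
    have ae := Fm (Fmu bx.F ab) (show (7*(i+1)+7:ℤ) ≤ _ by omega)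
    convert Fs aa ae using 1; ring
end
end MF
end
section
open NumberField Module Ideal
namespace MF
section
variable {K : Type*} [Field K] [NumberField K] [MF K]
theorem Fz (k : ℕ) (n : ℤ) (h : (2:ℤ)^k∣n) : F (7*k) (n:K) := by
  obtain ⟨m, rfl⟩ := h
  have := Ftw k m (1:K) (7*k) 0 Eo.F (by simp)
  push_cast; simpa using this
theorem ratio (k : ℕ) (p q : ℤ) (hq : ¬ 2∣q) (h : (2:ℤ)^k∣p - q) : F (7*k) ((p:K)/q -1) := by
  have := Fd (Fz (K:=K) k _ h) (Eod q hq)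
  have e : (p:K)/q -1 = ((p-q:ℤ):K)/q := by
    have := En (Eod (K:=K) q hq)
    push_cast; field_simp
  rw [e]; simpa using this
theorem Fdiv2 {n : ℤ} {x y : K} (hx : F n x) (hy : E 0 y) : F n (x/y^2) := by
  simpa using Fd hx (Ep hy 2)
theorem jt {s t : K} {n : ℤ} (hn : 1 ≤ n) (hs : E n s) (ht : F 0 t) (h : s^3+t+t^3*s =0) :
    ∃ y, F (7*n) (y-1)∧E 0 y∧y + s^7*y^3 =1∧t = -s^3*y := by
  have ak : E 0 (1+s*t^2) := by
    refine Ea Eo (Fm (Fmu hs.F (m :=0) ?_) oO)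
    rw [pow_two]; exact bm ht ht
  have aa := En ak
  have cg : E 0 (1+s*t^2)⁻¹ := by simpa using Ei ak
  have htt : t = -s^3*(1+s*t^2)⁻¹ := by
    rw [eq_comm, mul_inv_eq_iff_eq_mul₀ aa]; linear_combination -h
  have dc : F (3*n) t := by
    rw [htt, neg_mul]
    have ae := (Ep hs 3).F
    push_cast at ae
    exact Fn (bm ae cg.F)
  generalize hY : (1+s*t^2)⁻¹ = y at *
  have hy : y*(1+s*t^2) =1 := by rw [← hY]; field_simp
  refine ⟨y,?_, cg,?_, htt⟩
  · have e : y -1 = -(s*(t*t)*y) := by linear_combination hy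
    rw [e]
    exact Fm (Fn (bm (Fmu hs.F (Fmu dc dc)) cg.F)) oO
  · have : t^2 = s^6*y^2 := by rw [htt]; ring
    rw [this] at hy; linear_combination hy
def ke (s y : K) : K :=1+s-s^3*y
def kg (s y : K) : K :=1-s^2*y-s^3*y
noncomputable def kh (s y : K) : K := ke s y*y/kg s y^2
noncomputable def cn (s y : K) : K := kg s y*(7*s^4*kh s y^2-s^2*kh s y+1)/ke s y^2
noncomputable def kr (s y : K) : K := s*kh s y/(2*cn s y+5*s*kh s y)
noncomputable def kx (s y : K) : K :=4/(s^2*kh s y)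
theorem kl_poly {s y : K} (hy : y + s^7*y^3 =1) :
    (2*(7*s^4*ke s y^2*y^2 - s^2*ke s y*y*kg s y^2+kg s y^4)+5*s*ke s y^3*y*kg s y)^2 =
    ke s y^4*(4*ke s y*y*kg s y^4+21*s^2*ke s y^2*y^2*kg s y^2+28*s^4*ke s y^3*y^3) := by
  simp only [ke, kg]
  linear_combination ((-4)*s^0*y^0 + (20)*s^2*y^1 + (20)*s^3*y^1 + (-60)*s^4*y^2 + (4)*s^5*y^1 + (-124)*s^5*y^2 + (-60)*s^6*y^2 + (20)*s^6*y^3 + (-20)*s^7*y^2 + (124)*s^7*y^3 + (-20)*s^8*y^2 + (128)*s^8*y^3 + (-4)*s^8*y^4 + (80)*s^9*y^3 + (-20)*s^9*y^4 + (124)*s^10*y^3 + (-80)*s^10*y^4 + (60)*s^11*y^3 + (-60)*s^11*y^4 + (-128)*s^12*y^4 + (60)*s^12*y^5 + (-124)*s^13*y^4 + (128)*s^13*y^5 + (-20)*s^14*y^4 + (80)*s^14*y^5 + (-20)*s^14*y^6 + (60)*s^15*y^5 + (-124)*s^15*y^6 + (20)*s^16*y^5 + (-124)*s^16*y^6 +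 (4)*s^16*y^7 + (4)*s^17*y^5 + (-20)*s^17*y^6 + (20)*s^17*y^7 + (60)*s^18*y^7 + (20)*s^19*y^7 + (4)*s^20*y^7)*hy
theorem ft {s y : K} {n : ℤ} (hn : 1 ≤ n) (hs : E n s) (ay : E 0 y) : E 0 (ke s y) := by
  have ae := (Ep hs 3).F
  push_cast at ae
  rw [ke, sub_eq_add_neg]
  exact Ea (Ea Eo (Fm hs.F oO)) (Fm (Fn (bm ae ay.F)) oO)
theorem jj {s y : K} {n : ℤ} (hn : 1 ≤ n) (hs : E n s) (ay : E 0 y) : F (2*n) (kg s y -1) := by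
  have ae := (Ep hs 3).F
  have ab := (Ep hs 2).F
  push_cast at ae ab
  have e : kg s y -1 = -(s^2*y) - s^3*y := by rw [kg]; ring
  rw [e]
  exact Fs (Fn (bm ab ay.F)) (Fm (bm ae ay.F) oO)
theorem fo {s y : K} {n : ℤ} (hn : 1 ≤ n) (hs : E n s) (ay : E 0 y) : E 0 (kg s y) := by
  have := Ea Eo (Fm (jj hn hs ay) (show 0+1 ≤2*n by omega))
  rwa [add_sub_cancel] at this
theorem gv {s y : K} {n : ℤ} (hn : 1 ≤ n) (hs : E n s) (ay : E 0 y) : E 0 (kh s y) := by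
  rw [kh]; simpa using Ed (Em (ft hn hs ay) ay) (Ep (fo hn hs ay) 2)
theorem lb {s y : K} {n : ℤ} (hn : 1 ≤ n) (hs : E n s) (bt : F (7*n) (y-1)) (ay : E 0 y) : F (2*n) (kh s y - (1+s)) := by
  have hg := fo hn hs ay
  have ng := jj hn hs ay
  have ae := (Ep hs 3).F
  push_cast at ae
  have e : kh s y - (1+s) = ((1+s)*(y-1) - s^3*y*y - (kg s y -1)*((kg s y+1)*(1+s)))/kg s y^2 := by
    rw [kh, ke]; field_simp [En hg]; ring
  have aa : F 0 (1+s) := Fa Eo.F (Fm hs.F oO)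
  rw [e]
  refine Fdiv2 (Fs (Fs (Fm (Fmu aa bt) oO) ?_) ?_) hg
  · exact Fm (bm (bm ae ay.F) ay.F) oO
  · exact bm ng (Fmu (n:=0) (m:=0) (Fa hg.F Eo.F) aa)
theorem khF1 {s y : K} {n : ℤ} (hn : 1 ≤ n) (hs : E n s) (bt : F (7*n) (y-1)) (ay : E 0 y) : F n (kh s y -1) := by
  have := Fa (Fm (lb hn hs bt ay) (show n ≤2*n by omega)) hs.F
  convert this using 1; ring
theorem mn {s y : K} {n : ℤ} (hn : 1 ≤ n) (hs : E n s) (bt : F (7*n) (y-1)) (ay : E 0 y) : F n (cn s y -1) := by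
  have he := ft hn hs ay
  have hh := gv hn hs ay
  have ng := jj hn hs ay
  have hg := fo hn hs ay
  have ab := (Ep hs 2).F
  have ae := (Ep hs 3).F
  push_cast at ab ae
  have mw : F 0 s := Fm hs.F oO
  have he1 : F n (ke s y -1) := by
    have e : ke s y -1 = s - s^3*y := by rw [ke]; ring
    rw [e]; exact Fs hs.F (Fm (bm ae ay.F) oO)
  have e : cn s y -1 = (s^2*(kg s y*(7*(s^2*kh s y*kh s y) - kh s y)) + (kg s y -1) - (ke s y -1)*(ke s y+1))/ke s y^2 := by
    rw [cn]; field_simp [En he]; ring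
  rw [e]
  refine Fdiv2 (Fs (Fa ?_ ?_) ?_) he
  · refine Fm (bm ab (Fmu (n:=0) (m:=0) hg.F (Fs (Fmu (n:=0) (m:=0) eo.F ?_) hh.F))) oO
    exact bm (bm (Fm ab oO) hh.F) hh.F
  · exact Fm ng oO
  · exact bm he1 (Fa he.F Eo.F)
theorem kl {s y : K} {n : ℤ} (hn : 1 ≤ n) (hs : E n s) (ay : E 0 y) (hy : y + s^7*y^3 =1) : (1/kr s y)^2 = kx s y +21 +112/kx s y := by
  have he := En (ft hn hs ay)
  have hg := En (fo hn hs ay)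
  have hh := En (gv hn hs ay)
  have mw := En hs
  have hp := kl_poly hy
  have key : (2*cn s y +5*s*kh s y)^2 =4*kh s y +21*s^2*kh s y^2+28*s^4*kh s y^3 := by
    have av : 2*cn s y +5*s*kh s y = (2*(7*s^4*ke s y^2*y^2 - s^2*ke s y*y*kg s y^2+kg s y^4)+5*s*ke s y^3*y*kg s y)/(ke s y^2*kg s y^3) := by
      rw [cn, kh]; field_simp
    have bl : 4*kh s y +21*s^2*kh s y^2+28*s^4*kh s y^3 = (ke s y^4*(4*ke s y*y*kg s y^4+21*s^2*ke s y^2*y^2*kg s y^2+28*s^4*ke s y^3*y^3))/(ke s y^2*kg s y^3)^2 := by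
      rw [kh]; field_simp
    rw [av, bl, div_pow, hp]
  have dj : (1/kr s y)^2 = (2*cn s y +5*s*kh s y)^2/(s*kh s y)^2 := by rw [kr, one_div_div, div_pow]
  rw [dj, key, kx]
  field_simp
  ring
theorem mm {s y : K} {n : ℤ} (hn : 1 ≤ n) (hs : E n s) (ay : E 0 y) : E (14-2*n) (kx s y) := by
  have kq : E 14 (4:K) := by have := Ep (Et (K:=K)) 2; norm_num at this; exact this
  have := Ed kq (Em (Ep hs 2) (gv hn hs ay))
  rw [kx]; simpa using this
theorem ml {s y : K} {n : ℤ} (hn : 1 ≤ n) (hs : E n s) (ay : E 0 y) (hy : y + s^7*y^3 =1) : Sp (kx s y) :=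
  gf (n :=7-n) (by convert mm hn hs ay using 1; ring) (kl hn hs ay hy)
theorem kbig {s y : K} {n : ℤ} (hn : 8 ≤ n) (hs : E n s) (bt : F (7*n) (y-1)) (ay : E 0 y) :
    F (2*n-14) (kr s y - s/2)∧E (n-7) (kr s y) := by
  have dq : 1 ≤ n := by omega
  have hh := gv dq hs ay
  have fx := mn dq hs bt ay
  have hh1 := khF1 dq hs bt ay
  have hG0 : E 0 (cn s y) := by
    have := Ea Eo (Fm fx (show 0+1 ≤ n by omega))
    rwa [add_sub_cancel] at this
  have bh : F n (5*s*kh s y) := by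
    have := Fint (bm hs.F hh.F) 5
    convert this using 1; push_cast; ring
  have hd : E 7 (2*cn s y +5*s*kh s y) := Ea (Em Et hG0) (Fm bh oO)
  have nj := En hd
  constructor
  · have e : kr s y - s/2 = s*(2*((kh s y -1) - (cn s y -1)) -5*s*kh s y)/(2*cn s y +5*s*kh s y)/2 := by
      rw [kr]
      generalize dv : 2*cn s y +5*s*kh s y = D at *
      field_simp; rw [← dv]; ring
    rw [e]
    have aa : F n (2*((kh s y -1) - (cn s y -1)) -5*s*kh s y) := by
      refine Fs (Fm (Fmu Et.F (Fs hh1 fx)) oO) bh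
    exact Fm (Fd (Fd (Fmu hs.F aa) hd) Et) oO
  · have := Ed (Em hs hh) hd
    rw [kr]; simpa using this
end
end MF
end
section
open NumberField Module Ideal
namespace MF
section
variable {K : Type*} [Field K] [NumberField K] [MF K]
theorem intcop {p : 𝓞 K} (hp : Prime p) {m n : ℤ} (h : IsCoprime m n) (hm : p∣(m:𝓞 K)) (hn : p∣(n:𝓞 K)) : False := by
  obtain ⟨a, b, hab⟩ := h
  have : (1:𝓞 K) = a*m+b*n := by exact_mod_cast hab.symm
  exact hp.not_isUnit (isUnit_of_dvd_one (this ▸ dvd_add (hm.mul_left _) (hn.mul_left _)))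
theorem ix : (ah : 𝓞 K)^7 =18 := by
  apply Oe; rw [map_pow, coet, bv, map_ofNat]
theorem cop3 {n : ℤ} (h : ¬ 3∣n) : IsCoprime (3:ℤ) n :=
  (Prime.coprime_iff_not_dvd Int.prime_three).2 h
theorem eq281_odd (A B C : ℤ) (h : 2*A^7+81*B^7+C^7 =0) (bk : ¬ 2∣A) (bq : ¬ 2∣B) (cq : ¬ 2∣C)
    (je : ¬ 3∣A) (jd : ¬ 3∣C) (ii : IsCoprime A B) (gy : IsCoprime B C) (K : Type*) [Field K] [NumberField K] [MF K] : False := by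
  have ku := Eod (K:=K) B bq
  have Bn := En ku
  have tn := th_ne (K:=K)
  have dw : (2:K) = th^7/9 := by rw [bv]; norm_num
  let a : 𝓞 K := (ah:𝓞 K)^4*(B:𝓞 K)^2 -2*(A:𝓞 K)*(C:𝓞 K)
  have ha : algebraMap (𝓞 K) K a = th^4*(B:K)^2 -2*(A:K)*(C:K) := by
    simp [a, coet]; left; left; exact map_ofNat _ 2
  have hz : algebraMap (𝓞 K) K a = th^4*((B:K)^2 - th^3*((A:K)*(C:K))/9) := by
    rw [ha, dw]; ring
  have cg : E (2*2) (algebraMap (𝓞 K) K a) := by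
    rw [hz]
    refine Em (n :=4) (m :=0) (Eth 4) ?_
    have jc : E 0 (9:K) := by have := Eod (K:=K) 9 nN; exact_mod_cast this
    have kb : F 0 ((A:K)*C) := by have := Fi (K:=K) (A*C); push_cast at this; exact this
    rw [sub_eq_add_neg]
    refine Ea (by simpa using Ep ku 2) (Fn ?_)
    exact Fm (Fd (Fmu (Ft (n:=3) 3 le_rfl) kb) jc) nN
  have hSp : Sp (algebraMap (𝓞 K) K a) := by
    have hab : ∀ u v : 𝓞 K, (u-v)*(u^6+u^5*v+u^4*v^2+u^3*v^3+u^2*v^4+u*v^5+v^6) = u^7-v^7 := by intro u v; ring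
    have hc : ∀ u v : 𝓞 K,7*v^6 = (u^6+u^5*v+u^4*v^2+u^3*v^3+u^2*v^4+u*v^5+v^6) - (u-v)*(u^5+2*u^4*v+3*u^3*v^2+4*u^2*v^3+5*u*v^4+6*v^5) := by intro u v; ring
    refine SpUF (s :=4*(2*(A:𝓞 K)^7-(C:𝓞 K)^7)) ((hab _ _).trans ?_) ?_ cg
    · have h' : 81*(B:𝓞 K)^7 = -(2*(A:𝓞 K)^7+(C:𝓞 K)^7) := by
        have : 2*(A:𝓞 K)^7+81*(B:𝓞 K)^7+(C:𝓞 K)^7 =0 := by exact_mod_cast congrArg (Int.cast : ℤ→𝓞 K) h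
        linear_combination this
      have : ((ah:𝓞 K)^4*(B:𝓞 K)^2)^7 =16*(81*(B:𝓞 K)^7)^2 := by
        have : ((ah:𝓞 K)^4*(B:𝓞 K)^2)^7 = (ah^7)^4*(B:𝓞 K)^14 := by ring
        rw [this, ix]; ring
      rw [this, h']; ring
    · intro p hp hpa hpc
      have ao := hc (ah^4*(B:𝓞 K)^2) (2*(A:𝓞 K)*(C:𝓞 K)) ▸ dvd_sub hpc (hpa.mul_right _)
      rcases hp.dvd_or_dvd ao with ao | ao
      · exact ao.trans ⟨2, by norm_num⟩
      have hv := hp.dvd_of_dvd_pow ao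
      have hu : p∣ah^4*(B:𝓞 K)^2 := by
        have := dvd_add hpa hv; simpa [a] using this
      rcases hp.dvd_or_dvd hv with hv | hv
      · rcases hp.dvd_or_dvd hv with hv | hv
        · exact hv.trans ⟨7, by norm_num⟩
        · rcases hp.dvd_or_dvd hu with hu | hu
          · have kc : p∣18 := by rw [← ix]; exact (hp.dvd_of_dvd_pow hu).trans (dvd_pow_self _ nN)
            have : (18:𝓞 K) =2*3^2 := by norm_num
            rw [this] at kc
            rcases hp.dvd_or_dvd kc with ab | ae
            · exact ab.trans ⟨7, by norm_num⟩
            · exact (intcop hp (cop3 je) (by exact_mod_cast hp.dvd_of_dvd_pow ae) hv).elim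
          · exact (intcop hp ii hv (hp.dvd_of_dvd_pow hu)).elim
      · rcases hp.dvd_or_dvd hu with hu | hu
        · have kc : p∣18 := by rw [← ix]; exact (hp.dvd_of_dvd_pow hu).trans (dvd_pow_self _ nN)
          have : (18:𝓞 K) =2*3^2 := by norm_num
          rw [this] at kc
          rcases hp.dvd_or_dvd kc with ab | ae
          · exact ab.trans ⟨7, by norm_num⟩
          · exact (intcop hp (cop3 jd) (by exact_mod_cast hp.dvd_of_dvd_pow ae) hv).elim
        · exact (intcop hp gy (hp.dvd_of_dvd_pow hu) hv).elim
  -- class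
  have E9B : E 0 (9*(B:K)^2) := by
    have := Eod (K:=K) (9*B^2) (by
      intro h; rcases Int.prime_two.dvd_or_dvd h with h | h
      · omega
      · exact bq (Int.prime_two.dvd_of_dvd_pow h))
    push_cast at this; exact this
  have E9n := En E9B
  have key : ∀ z : K, F 12 (9*(B:K)^2*z -9*(B:K)^2*(1+th^3))→F 12 (z - (1+th^3)) := by
    intro z hz
    have := Fd hz E9B
    rw [← mul_sub, mul_div_cancel_left₀ _ E9n] at this
    simpa using this
  have hodd : ∃ k, A*C+9*B^2 =2*k := by
    obtain ⟨i, hi⟩ : ∃ i, A =2*i+1 := ⟨A/2, by omega⟩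
    obtain ⟨j, hj⟩ : ∃ j, B =2*j+1 := ⟨B/2, by omega⟩
    obtain ⟨l, hl⟩ : ∃ j, C =2*j+1 := ⟨C/2, by omega⟩
    exact ⟨2*i*l+i+l+18*j^2+18*j+5, by rw [hi, hj, hl]; ring⟩
  obtain ⟨k, hk⟩ := hodd
  have hkK : (A:K)*(C:K) =2*(k:K) -9*(B:K)^2 := by
    have : (A:K)*(C:K)+9*(B:K)^2 =2*(k:K) := by exact_mod_cast congrArg (Int.cast : ℤ→K) hk
    linear_combination this
  by_cases jn : 2∣k
  · obtain ⟨l, rfl⟩ := jn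
    refine ls (s :=1/(th^2*(B:K))) hSp ?_ rfl
    apply key
    have e : 9*(B:K)^2*(algebraMap (𝓞 K) K a*(1/(th^2*(B:K)))^2) -9*(B:K)^2*(1+th^3) = -(2^2*((l:ℤ):K)*th^3) := by
      rw [hz, hkK]; push_cast; field_simp; ring
    rw [e]
    exact Fn (Ftw 2 l _ _ _ (Ft (n:=3) 3 le_rfl) nN)
  · refine ls (s := (1+th^5)/(th^2*(B:K))) hSp ?_ rfl
    apply key
    obtain ⟨l, hl⟩ : ∃ l,81*B^2-k =2*l := by
      have : (81*B^2) % 2 =1 := by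
        obtain ⟨j, hj⟩ : ∃ j, B =2*j+1 := ⟨B/2, by omega⟩
        rw [hj]; ring_nf; omega
      exact ⟨(81*B^2-k)/2, by omega⟩
    have hlK : (k:K) =81*(B:K)^2 -2*(l:K) := by
      have : 81*(B:K)^2 - (k:K) =2*(l:K) := by exact_mod_cast congrArg (Int.cast : ℤ→K) hl
      linear_combination -this
    have e : 9*(B:K)^2*(algebraMap (𝓞 K) K a*((1+th^5)/(th^2*(B:K)))^2) -9*(B:K)^2*(1+th^3) =
        2^1*(l:K)*(th^10/9) +2^1*((9:ℤ):K)*(th^5*(B:K)^2) - th^8*(2*((A*C:ℤ):K)) - th^13*((A*C:ℤ):K) := by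
      have av : 9*(B:K)^2*(algebraMap (𝓞 K) K a*((1+th^5)/(th^2*(B:K)))^2) = (1+th^5)^2*(9*(B:K)^2-th^3*((A:K)*(C:K))) := by
        rw [hz]; field_simp
      rw [av]
      push_cast
      linear_combination (-th^3)*hkK  - 2*th^3*hlK - (l:K)*2*th^3*(bv (K:=K))/9 +9*th^3*(B:K)^2*(bv (K:=K))
    have jc : E 0 (9:K) := by have := Eod (K:=K) 9 nN; exact_mod_cast this
    rw [e]
    have cr : F 12 (2^1*(l:K)*(th^10/9)) := Ftw 1 l _ _ 10 (by simpa using Fd (Eth (K:=K) 10).F jc) nN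
    have dd : F 12 (2^1*((9:ℤ):K)*(th^5*(B:K)^2)) := Ftw 1 9 _ _ 5 (bm (Ft 5 le_rfl) (by simpa using (Ep ku 2).F)) nN
    have ij : F 12 (th^8*(2*((A*C:ℤ):K))) := Fm (Fmu (Ft (n:=8) 8 le_rfl) (Fmu Et.F (Fi _))) nN
    have ki : F 12 (th^13*((A*C:ℤ):K)) := Fm (Fmu (Ft (n:=13) 13 le_rfl) (Fi _)) nN
    exact Fs (Fs (Fa cr dd) ij) ki
end
end MF
end
section
open NumberField Module Ideal
namespace MF
section
variable {K : Type*} [Field K] [NumberField K] [MF K]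
noncomputable def fk : K := (1+th^8) - (1+th^4)^2*(1+th^11)
theorem cK8 : F 12 (fk : K) := by
  refine FP 12 _ 1 (0) (-162) (0) (0) (-5) (-162) (0) 2 2 2 2 2 1 1 nN nN ?_
  rw [fk]
  push_cast
  linear_combination ((-36)*th + (-1)*th^4 + (-18)*th^5 + (-2)*th^8 + (-1)*th^12)*bv (K:=K)
theorem E9 : E 0 (9:K) := by have := Eod (K:=K) 9 nN; exact_mod_cast this
theorem ky {m e : ℕ} {p q : ℤ} (hp : ¬ 2∣p) (hq : ¬ 2∣q) : E (7*m+e) (2^m*th^e*((p:K)/q)) := by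
  have := Em (Em (Ep (Et (K:=K)) m) (Eth e)) (Ed (Eod p hp) (Eod q hq))
  convert this using 1; ring
theorem bj {e : ℕ} {p q : ℤ} (hp : ¬ 2∣p) (hq : ¬ 2∣q) : F (14+e) ((2^1*th^e*((p:K)/q)) - th^(7+e)) := by
  have hr := ratio (K:=K) 1 p (9*q) oO oO
  have cv : (2^1*th^e*((p:K)/q)) - th^(7+e) = th^(7+e)*((p:K)/((9*q:ℤ):K)-1) := by
    have := En (Eod (K:=K) q hq)
    have ab : (2:K) = th^7/9 := by rw [bv]; norm_num
    rw [pow_add, ab]; push_cast; field_simp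
  rw [cv]
  exact Fm (Fmu (Eth _).F hr) (by push_cast; omega)
theorem cb {m e : ℕ} {p q : ℤ} (hp : ¬ 2∣p) (hq : ¬ 2∣q) : F (7*(m+1)+e+7) ((2^(m+2)*th^e*((p:K)/q))/2 -2^(m+1)*th^e) := by
  have hr := ratio (K:=K) 1 p q hq oO
  have cv : (2^(m+2)*th^e*((p:K)/q))/2 -2^(m+1)*th^e =2^(m+1)*th^e*((p:K)/q-1) := by ring
  rw [cv]
  have := Fmu (Fmu (Ep (Et (K:=K)) (m+1)).F (Eth e).F) hr
  exact Fm this (by push_cast; omega)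
theorem kxsq {s y : K} {n : ℤ} (hn : 1 ≤ n) (hs : E n s) (ay : E 0 y) : kx s y * (s*kh s y/2)^2 = kh s y := by
  have hh := En (gv hn hs ay)
  have ak := En hs
  rw [kx]; field_simp; norm_num
theorem even1 (m : ℕ) (hm : 1 ≤ m) {p q : ℤ} (hp : ¬ 2∣p) (hq : ¬ 2∣q) {s t : K} (hs : s =2^m*th^1*((p:K)/q)) (ht : F 0 t)
    (h : s^3+t+t^3*s =0) : False := by
  have cg : E (7*m+1) s := by rw [hs]; have := ky (K:=K) (m:=m) (e:=1) hp hq; rwa [Nat.cast_one] at this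
  have dq : (1:ℤ) ≤7*m+1 := by omega
  obtain ⟨y, bt, ay, hy, -⟩ := jt dq cg ht h
  obtain rfl | ⟨i, rfl⟩ : m =1 ∨ ∃ i, m = i+2 := by
    rcases Nat.lt_or_ge m 2 with h | h
    · left; omega
    · right; exact ⟨m-2, by omega⟩
  · refine bad11S (ml dq cg ay hy) (ths 4 nN) ?_ (kxsq dq cg ay)
    have cr := lb dq cg bt ay
    have dd := bj (K:=K) (e :=1) hp hq
    rw [← hs] at dd
    have := Fa (Fa (Fm cr (m :=12) nN) (Fm dd (m :=12) nN)) cK8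
    rw [fk] at this
    convert this using 1; ring
  · have hb := kbig (by push_cast; omega) cg bt ay
    have dd := cb (K:=K) (e :=1) (m := i) hp hq
    rw [← hs] at dd
    refine fr i (x := kx s y) (r := kr s y) ?_ ?_ (kl dq cg ay hy) ?_
    · convert hb.2 using 1; push_cast; ring
    · convert mm dq cg ay using 1; push_cast; ring
    · have := Fa (Fm hb.1 (m :=7*(i+1)+5) (by push_cast; omega)) (Fm dd (m :=7*(i+1)+5) (by push_cast; omega))
      convert this using 1; ring
theorem even2 (m : ℕ) (hm : 1 ≤ m) {p q : ℤ} (hp : ¬ 2∣p) (hq : ¬ 2∣q) {s t : K} (hs : s =2^m*th^2*((p:K)/q)) (ht : F 0 t)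
    (h : s^3+t+t^3*s =0) : False := by
  have cg : E (7*m+2) s := by rw [hs]; have := ky (K:=K) (m:=m) (e:=2) hp hq; rwa [Nat.cast_ofNat] at this
  have dq : (1:ℤ) ≤7*m+2 := by omega
  obtain ⟨y, bt, ay, hy, -⟩ := jt dq cg ht h
  obtain rfl | ⟨i, rfl⟩ : m =1 ∨ ∃ i, m = i+2 := by
    rcases Nat.lt_or_ge m 2 with h | h
    · left; omega
    · right; exact ⟨m-2, by omega⟩
  · refine bad9 (ml dq cg ay hy) ?_ (kxsq dq cg ay)
    have cr := lb dq cg bt ay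
    have dd := bj (K:=K) (e :=2) hp hq
    rw [← hs] at dd
    have := Fa (Fm cr (m :=12) nN) (Fm dd (m :=12) nN)
    convert this using 1; ring
  · have hb := kbig (by push_cast; omega) cg bt ay
    have dd := cb (K:=K) (e :=2) (m := i) hp hq
    rw [← hs] at dd
    refine H3 i (x := kx s y) (r := kr s y) ?_ ?_ (kl dq cg ay hy) ?_
    · convert hb.2 using 1; push_cast; ring
    · convert mm dq cg ay using 1; push_cast; ring
    · have := Fa (Fm hb.1 (m :=7*(i+1)+7) (by push_cast; omega)) (Fm dd (m :=7*(i+1)+7) (by push_cast; omega))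
      convert this using 1; ring
theorem oddm {a b : ℤ} (ha : ¬ 2∣a) (hb : ¬ 2∣b) : ¬ 2∣a*b := fun h =>
  (Int.prime_two.dvd_or_dvd h).elim ha hb
theorem oddp {a : ℤ} (ha : ¬ 2∣a) (n : ℕ) : ¬ 2∣a^n := fun h => ha (Int.prime_two.dvd_of_dvd_pow h)
theorem lx {A : ℤ} (ak : A≠0) (ab : 2∣A) : ∃ (m : ℕ) (a : ℤ),1 ≤ m∧¬ 2∣a∧A =2^m*a := by
  obtain ⟨m, a, ha, bk⟩ := (Int.finiteMultiplicity_iff.2 ⟨by norm_num, ak⟩ : FiniteMultiplicity (2:ℤ) A).exists_eq_pow_mul_and_not_dvd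
    |> fun h => (⟨_, h.choose, h.choose_spec.2, h.choose_spec.1⟩ : ∃ (m : ℕ) (a : ℤ), ¬ 2∣a∧A =2^m*a)
  refine ⟨m, a,?_, ha, bk⟩
  rcases Nat.eq_zero_or_pos m with rfl | h
  · simp at bk; exact absurd (bk ▸ ab) ha
  · exact h
theorem Fq {p q : ℤ} (hq : ¬ 2∣q) : F 0 ((p:K)/q) := by simpa using Fd (Fi p) (Eod (K:=K) q hq)
theorem id281 (x A B C : K) (hx : x^7 =18) (bq : B≠0) (cq : C≠0) (h : 2*A^7+81*B^7+C^7 =0) :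
    (x*A*C^2/(9*B^3))^3 + x^3*A^3/(9*B^2*C) + (x^3*A^3/(9*B^2*C))^3*(x*A*C^2/(9*B^3)) =0 := by
  have e : (x*A*C^2/(9*B^3))^3 + x^3*A^3/(9*B^2*C) + (x^3*A^3/(9*B^2*C))^3*(x*A*C^2/(9*B^3)) = x^3*A^3/(729*B^9*C)*(x^7/9*A^7+81*B^7+C^7) := by
    field_simp; ring
  rw [e, hx, show (18:K)/9 =2 by norm_num, h, mul_zero]
theorem eq281_even (A B C : ℤ) (h : 2*A^7+81*B^7+C^7 =0) (ak : A≠0) (bk : 2∣A) (bq : ¬ 2∣B) (cq : ¬ 2∣C)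
    (K : Type*) [Field K] [NumberField K] [MF K] : False := by
  obtain ⟨m, a, hm, ha, rfl⟩ := lx ak bk
  have hC' := En (Eod (K:=K) C cq)
  have hB' := En (Eod (K:=K) B bq)
  refine even1 (K:=K) m hm (p := a*C^2) (q :=9*B^3) (oddm ha (oddp cq _)) (oddm nN (oddp bq _)) rfl
    (t := th^3*(((2^m*a)^3:ℤ)/((9*B^2*C:ℤ):K))) ?_ ?_
  · exact Fm (Fmu (Eth 3).F (Fq (oddm (oddm nN (oddp bq _)) cq))) nN
  · have gx : 2*((2:K)^m*(a:K))^7+81*(B:K)^7+(C:K)^7 =0 := by exact_mod_cast congrArg (Int.cast : ℤ→K) h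
    have := id281 (K:=K) th (2^m*a) B C bv hB' hC' gx
    push_cast
    convert this using 2 <;> ring
theorem id314 (x A B C : K) (hx : x^7 =18) (bk : A≠0) (bq : B≠0) (h : 3*A^7+B^7+4*C^7 =0) :
    (x^2*B^2*C/(3*A^3))^3 + x^6*C^3/(9*A^2*B) + (x^6*C^3/(9*A^2*B))^3*(x^2*B^2*C/(3*A^3)) =0 := by
  have e : (x^2*B^2*C/(3*A^3))^3 + x^6*C^3/(9*A^2*B) + (x^6*C^3/(9*A^2*B))^3*(x^2*B^2*C/(3*A^3)) = x^6*C^3/(27*A^9*B)*(3*A^7+B^7+(x^7)^2/81*C^7) := by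
    field_simp; ring
  rw [e, hx, show (18:K)^2/81 =4 by norm_num, h, mul_zero]
theorem eq314_even (A B C : ℤ) (h : 3*A^7+B^7+4*C^7 =0) (ak : C≠0) (cq : 2∣C) (bk : ¬ 2∣A) (bq : ¬ 2∣B)
    (K : Type*) [Field K] [NumberField K] [MF K] : False := by
  obtain ⟨m, c, hm, hc, rfl⟩ := lx ak cq
  have hA' := En (Eod (K:=K) A bk)
  have hB' := En (Eod (K:=K) B bq)
  refine even2 (K:=K) m hm (p := B^2*c) (q :=3*A^3) (oddm (oddp bq _) hc) (oddm nN (oddp bk _)) rfl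
    (t := th^6*(((2^m*c)^3:ℤ)/((9*A^2*B:ℤ):K))) ?_ ?_
  · exact Fm (Fmu (Eth 6).F (Fq (oddm (oddm nN (oddp bk _)) bq))) nN
  · have gx : 3*(A:K)^7+(B:K)^7+4*((2:K)^m*(c:K))^7 =0 := by exact_mod_cast congrArg (Int.cast : ℤ→K) h
    have := id314 (K:=K) th A B (2^m*c) bv hA' hB' gx
    push_cast
    convert this using 2 <;> ring
end
end MF
end
section
open NumberField Module Ideal
namespace MF
section
variable {K : Type*} [Field K] [NumberField K] [MF K]
theorem dz {x y : K} (hx : F 0 x) (hy : F 0 y) : F 0 (x+y) := Fa hx hy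
theorem F0sub {x y : K} (hx : F 0 x) (hy : F 0 y) : F 0 (x-y) := Fs hx hy
theorem bu {x y : K} (hx : F 0 x) (hy : F 0 y) : F 0 (x*y) := by simpa using Fmu hx hy
theorem bc {x : K} (hx : F 0 x) (n : ℕ) : F 0 (x^n) := by
  induction n with
  | zero => simpa using Eo.F
  | succ n ih => rw [pow_succ]; exact bu ih hx
theorem F0two : F 0 (2:K) := Fm Et.F nN
theorem F0nat (n : ℕ) : F 0 (n:K) := by have := Fi (K:=K) n; simpa using this
theorem Cm {m : ℤ} {a b c d : K} (aa : F m (a-b)) (ab : F m (c-d)) (ha : F 0 a) (hd : F 0 d) : F m (a*c-b*d) := by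
  have e : a*c-b*d = a*(c-d)+(a-b)*d := by ring
  rw [e]
  have cr := Fmu ha ab
  rw [zero_add] at cr
  exact Fa cr (bm aa hd)
theorem Cp {m : ℤ} {a b : K} (h : F m (a-b)) (ha : F 0 a) (hb : F 0 b) (n : ℕ) : F m (a^n-b^n) := by
  induction n with
  | zero => simpa using Fze m
  | succ n ih => rw [pow_succ, pow_succ]; exact Cm ih h (bc ha n) hb
theorem Cd {m : ℤ} {a b c d : K} (aa : F m (a-b)) (ab : F m (c-d)) (hc : E 0 c) (hd : E 0 d) (ha : F 0 a) : F m (a/c-b/d) := by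
  have e : a/c-b/d = ((a-b)*c-a*(c-d))/(c*d) := by field_simp [En hc, En hd]; ring
  rw [e]
  have cr := Fmu ha ab
  rw [zero_add] at cr
  simpa using Fd (Fs (bm aa hc.F) cr) (Em hc hd)
theorem Ca {m : ℤ} {a b c d : K} (aa : F m (a-b)) (ab : F m (c-d)) : F m ((a+c)-(b+d)) := by
  convert Fa aa ab using 1; ring
theorem Cs {m : ℤ} {a b c d : K} (aa : F m (a-b)) (ab : F m (c-d)) : F m ((a-c)-(b-d)) := by
  convert Fs aa ab using 1; ring
theorem du {m : ℤ} {a : K} : F m (a-a) := by rw [sub_self]; exact Fze m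
theorem dY {ad ac aw ag : K} {v : ℤ} (aa : E 2 ad) (ab : E 2 ac) (bt : E 0 aw) (co : E 0 ag)
    (av : aw+ad^7*aw^3 =1) (bl : ag+ac^7*ag^3=1) (hd : F v (ad-ac)) : F (v+8) (aw-ag) := by
  have cp : F 0 (aw^2+aw*ag+ag^2) := dz (dz (bc bt.F 2) (bu bt.F co.F)) (bc co.F 2)
  have ll : E 0 (1+ad^7*(aw^2+aw*ag+ag^2)) := Ea Eo (Fm (bm (Ep aa 7).F cp) nN)
  have e : aw - ag = (ad-ac)*(-(ad^6+ad^5*ac+ad^4*ac^2+ad^3*ac^3+ad^2*ac^4+ad*ac^5+ac^6)*ag^3)/(1+ad^7*(aw^2+aw*ag+ag^2)) := by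
    rw [eq_div_iff (En ll)]; linear_combination av - bl
  rw [e]
  have p : ∀ (i j : ℕ),4 ≤ i+j→F 8 (ad^i*ac^j) := fun i j hij =>
    Fm (Fmu (Ep aa i).F (Ep ab j).F) (by zify at hij; omega)
  have mg : F 8 (ad^6) := by simpa using p 6 0 nN
  have mf : F 8 (ad^5*ac) := by simpa using p 5 1 nN
  have md : F 8 (ad*ac^5) := by simpa using p 1 5 nN
  have mc : F 8 (ac^6) := by simpa using p 0 6 nN
  have := Fmu hd (bm (Fn (Fa (Fa (Fa (Fa (Fa (Fa mg mf) (p 4 2 nN)) (p 3 3 nN)) (p 2 4 nN)) md) mc)) (bc co.F 3))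
  simpa using Fd this ll
theorem Bid (a b y : K) : a^2*(1+a-a^3*y)*(1-b^2*y-b^3*y)^2 - b^2*(1+b-b^3*y)*(1-a^2*y-a^3*y)^2 =
   (a-b)*((a+b) + (a^2+a*b+b^2) + (-y*(a^4+a^3*b+a^2*b^2+a*b^3+b^4) + a^2*b^2*(2*y^2*(a^2+a*b+b^2+a*b*(a+b))-y^2*(1+a)*(1+b)*(a+b+(a^2+a*b+b^2))-y^3*a^2*b^2*(1-a*b)))) := by ring
theorem dN {ad ac aw ag : K} {v : ℤ} (hv : 16 ≤ v) (aa : E 2 ad) (ab : E 2 ac) (bt : E 0 aw) (co : E 0 ag) (jv : F 14 (ag-1))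
    (av : aw+ad^7*aw^3 =1) (bl : ag+ac^7*ag^3=1) (hd : F v (ad-ac)) :
    F (v+8) (ad^2*kh ad aw - ac^2*kh ac ag -3*ac^2*(ad-ac)) := by
  have hz := dY aa ab bt co av bl hd
  have bj : F 0 ad := Fm aa.F nN
  have cb : F 0 ac := Fm ab.F nN
  have y1F := bt.F
  have ci := co.F
  have dx := fo nN aa bt
  have fp := fo nN ab co
  have ew := En dx
  have eb := En fp
  have hke : F (v+8) (ke ad aw - ke ad ag) := by
    rw [ke, ke]; exact Cs du (Cm du hz (bc bj _) ci)
  have hkg : F (v+8) (kg ad aw - kg ad ag) := by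
    rw [kg, kg]; exact Cs (Cs du (Cm du hz (bc bj _) ci)) (Cm du hz (bc bj _) ci)
  have g1' := fo nN aa co
  have ey := ft nN aa bt
  have fu := ft nN ab co
  have k1' := ft nN aa co
  -- numerator
  have hnum : F (v+8) ((ad^2*ke ad aw*kg ac ag^2*aw - ac^2*ke ac ag*kg ad aw^2*ag)
      - (ad^2*ke ad ag*kg ac ag^2*ag - ac^2*ke ac ag*kg ad ag^2*ag)) := by
    refine Cs (Cm (Cm (Cm du hke (bc bj _) k1'.F) du (bu (bc bj _) ey.F) (bc fp.F _)) hz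
      (bu (bu (bc bj _) ey.F) (bc fp.F _)) ci) (Cm (Cm du (Cp hkg dx.F g1'.F 2) (bu (bc cb _) fu.F) (bc g1'.F _)) du ?_ ci)
    exact bu (bu (bc cb _) fu.F) (bc dx.F _)
  have p : ∀ (i j : ℕ),4 ≤ i+j→F 8 (ad^i*ac^j) := fun i j hij =>
    Fm (Fmu (Ep aa i).F (Ep ab j).F) (by zify at hij; omega)
  have jy : F 8 (((ad+ac) + (ad^2+ad*ac+ac^2) + (-ag*(ad^4+ad^3*ac+ad^2*ac^2+ad*ac^3+ac^4) + ad^2*ac^2*(2*ag^2*(ad^2+ad*ac+ac^2+ad*ac*(ad+ac))-ag^2*(1+ad)*(1+ac)*(ad+ac+(ad^2+ad*ac+ac^2))-ag^3*ad^2*ac^2*(1-ad*ac)))) -3*ac^2) := by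
    have ar : F 8 (ad+ac) := by
      have : ad+ac = (ad-ac)+2*ac := by ring
      rw [this]
      exact Fa (Fm hd oO) (Fm (Fmu Et.F ab.F) nN)
    have az : F 8 ((ad^2+ad*ac+ac^2)-3*ac^2) := by
      have : (ad^2+ad*ac+ac^2)-3*ac^2 = (ad-ac)*(ad+2*ac) := by ring
      rw [this]
      exact bm (Fm hd oO) (dz bj (bu F0two cb))
    have cj : F 8 (ad^4+ad^3*ac+ad^2*ac^2+ad*ac^3+ac^4) := by
      have mg : F 8 (ad^4) := by simpa using p 4 0 nN
      have mf : F 8 (ad^3*ac) := by simpa using p 3 1 nN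
      have md : F 8 (ad*ac^3) := by simpa using p 1 3 nN
      have mc : F 8 (ac^4) := by simpa using p 0 4 nN
      exact Fa (Fa (Fa (Fa mg mf) (p 2 2 nN)) md) mc
    have dn : F 0 (2*ag^2*(ad^2+ad*ac+ac^2+ad*ac*(ad+ac))-ag^2*(1+ad)*(1+ac)*(ad+ac+(ad^2+ad*ac+ac^2))-ag^3*ad^2*ac^2*(1-ad*ac)) := by
      clear * - bj cb ci
      repeat' with_reducible first | assumption | exact F0two | exact Eo.F | apply dz | apply F0sub | apply bu | apply bc
    have cs := bm (p 2 2 nN) dn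
    have dm := bm cj (Fn ci)
    have := Fa (Fa ar az) (Fa dm cs)
    convert this using 1; ring
  have fx : F 3 (kg ad aw -1) := Fm (jj nN aa bt) nN
  have hG2 : F 4 (kg ad aw -1) := Fm (jj nN aa bt) nN
  have hG3 : F 4 (kg ac ag -1) := Fm (jj nN ab co) nN
  have hgg : F 4 (kg ad aw^2*kg ac ag^2 -1) := by
    have := Cm (Cp hG2 dx.F Eo.F 2) (Cp hG3 fp.F Eo.F 2) (bc dx.F 2) (bc Eo.F 2)
    simpa using this
  have hden : E 0 (kg ad aw^2*kg ac ag^2) := by simpa using Em (Ep dx 2) (Ep fp 2)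
  have bq := Bid ad ac ag
  generalize hq : ((ad+ac) + (ad^2+ad*ac+ac^2) + (-ag*(ad^4+ad^3*ac+ad^2*ac^2+ad*ac^3+ac^4) + ad^2*ac^2*(2*ag^2*(ad^2+ad*ac+ac^2+ad*ac*(ad+ac))-ag^2*(1+ad)*(1+ac)*(ad+ac+(ad^2+ad*ac+ac^2))-ag^3*ad^2*ac^2*(1-ad*ac)))) = q at *
  have e : ad^2*kh ad aw - ac^2*kh ac ag -3*ac^2*(ad-ac) =
    (((ad^2*ke ad aw*kg ac ag^2*aw - ac^2*ke ac ag*kg ad aw^2*ag)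
      - (ad^2*ke ad ag*kg ac ag^2*ag - ac^2*ke ac ag*kg ad ag^2*ag))
     + (ad-ac)*((q-3*ac^2)*ag+3*ac^2*((ag-1)-(kg ad aw^2*kg ac ag^2-1))))/(kg ad aw^2*kg ac ag^2) := by
    have hB' : ad^2*ke ad ag*kg ac ag^2 - ac^2*ke ac ag*kg ad ag^2 = (ad-ac)*q := bq
    have : ad^2*kh ad aw - ac^2*kh ac ag = (ad^2*ke ad aw*kg ac ag^2*aw - ac^2*ke ac ag*kg ad aw^2*ag)/(kg ad aw^2*kg ac ag^2) := by
      rw [kh, kh]; field_simp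
    rw [this, eq_div_iff (En hden), sub_mul, div_mul_cancel₀ _ (En hden)]
    linear_combination ag*hB'
  rw [e]
  have ij : F 4 (3*ac^2) := by
    have := Fmu (F0nat (K:=K) 3) (Ep ab 2).F
    exact_mod_cast this
  have cr : F 8 ((q-3*ac^2)*ag+3*ac^2*((ag-1)-(kg ad aw^2*kg ac ag^2-1))) :=
    Fa (bm jy ci) (Fmu ij (Fs (Fm jv nN) hgg))
  simpa using Fd (Fa hnum (Fmu hd cr)) hden
end
end MF
end
section
open NumberField Module Ideal
namespace MF
section
variable {K : Type*} [Field K] [NumberField K] [MF K]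
theorem addlaw {bp bo cd dl : K} (aa : bp≠0) (ab : bo≠0) (bz : bp - bo≠0) (ck : cd+dl≠0)
    (av : cd^2 = bp+21+112/bp) (bl : dl^2 = bo+21+112/bo) :
    ((bp*cd+bo*dl)/(bp-bo) - (bp-bo)/(cd+dl))^2 =
     (((bp*cd+bo*dl)/(bp-bo))^2-21-bp-bo) +21 +112/(((bp*cd+bo*dl)/(bp-bo))^2-21-bp-bo) := by
  have e1' : cd^2*bp = bp^2+21*bp+112 := by rw [av]; field_simp
  have e2' : dl^2*bo = bo^2+21*bo+112 := by rw [bl]; field_simp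
  have hx : ((bp*cd+bo*dl)/(bp-bo))^2-21-bp-bo = bp*bo*(cd+dl)^2/(bp-bo)^2 := by
    rw [div_pow, eq_div_iff (pow_ne_zero 2 bz), sub_mul, sub_mul, sub_mul, div_mul_cancel₀ _ (pow_ne_zero 2 bz)]
    linear_combination (bp-bo)*e1' - (bp-bo)*e2'
  have ae : 112/(((bp*cd+bo*dl)/(bp-bo))^2-21-bp-bo) =112*(bp-bo)^2/(bp*bo*(cd+dl)^2) := by
    rw [hx, div_div_eq_mul_div]
  have key : 112*(bp-bo)^2 = bp*bo*((bp-bo)^2 - (cd^2-dl^2)*(bp-bo)) := by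
    linear_combination (bp-bo)*bo*e1' - (bp-bo)*bp*e2'
  have au : 112*(bp-bo)^2/(bp*bo*(cd+dl)^2) = (bp-bo)^2/(cd+dl)^2 - (cd-dl)*(bp-bo)/(cd+dl) := by
    rw [key]; field_simp; ring
  rw [ae, au]
  field_simp
  ring
theorem kchi {s y : K} (hs : E 2 s) (ay : E 0 y) (hy : y + s^7*y^3 =1) :
    ((2*cn s y+5*s*kh s y)/(s*kh s y))^2 =28*s^2*kh s y +21 +112/(28*s^2*kh s y) := by
  have := kl nN hs ay hy
  have hh := En (gv nN hs ay)
  have ak := En hs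
  rw [kr, one_div_div, kx] at this
  rw [this]; field_simp; ring
theorem lv : E 14 (28:K) := by
  have := Em (Ep (Et (K:=K)) 2) eo
  norm_num at this; exact this
theorem fz : E 0 (5:K) := by have := Eod (K:=K) 5 nN; exact_mod_cast this
theorem ks : E 0 (3:K) := by have := Eod (K:=K) 3 nN; exact_mod_cast this
theorem diffpt {ad ac aw ag : K} {v : ℤ} (hv : 16 ≤ v) (aa : E 2 ad) (ab : E 2 ac) (bt : E 0 aw) (co : E 0 ag)
    (hy1F : F 14 (aw-1)) (jv : F 14 (ag-1))
    (av : aw+ad^7*aw^3 =1) (bl : ag+ac^7*ag^3=1) (hd : E v (ad-ac)) :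
    ∃ x N D : K, E (2*(7-v)) x∧(1/(N/D))^2 = x+21+112/x∧F (v+8) (N -3*ac^2*(ad-ac))∧F 14 (D-10*ac^2*(1+ac)) := by
  have hNF := dN hv aa ab bt co jv av bl hd.F
  have hz := Fm (dY aa ab bt co av bl hd.F) (show (5:ℤ) ≤ v+8 by omega)
  have ig : F 5 (ad-ac) := Fm hd.F oO
  have bj : F 0 ad := Fm aa.F nN
  have cb : F 0 ac := Fm ab.F nN
  have y1F := bt.F
  have ci := co.F
  have dx := fo nN aa bt
  have fp := fo nN ab co
  have ey := ft nN aa bt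
  have fu := ft nN ab co
  have fr := gv nN aa bt
  have fy := gv nN ab co
  have G1 : E 0 (cn ad aw) := by
    have := Ea Eo (Fm (mn nN aa hy1F bt) (show (0+1:ℤ) ≤2 by norm_num))
    rwa [add_sub_cancel] at this
  have oe : E 0 (cn ac ag) := by
    have := Ea Eo (Fm (mn nN ab jv co) (show (0+1:ℤ) ≤2 by norm_num))
    rwa [add_sub_cancel] at this
  have dke : F 5 (ke ad aw - ke ac ag) := by
    rw [ke, ke]; exact Cs (Ca du ig) (Cm (Cp ig bj cb 3) hz (bc bj _) ci)
  have dkg : F 5 (kg ad aw - kg ac ag) := by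
    rw [kg, kg]; exact Cs (Cs du (Cm (Cp ig bj cb 2) hz (bc bj _) ci)) (Cm (Cp ig bj cb 3) hz (bc bj _) ci)
  have dkh : F 5 (kh ad aw - kh ac ag) := by
    rw [kh, kh]
    exact Cd (Cm dke hz ey.F ci) (Cp dkg dx.F fp.F 2) (by simpa using Ep dx 2) (by simpa using Ep fp 2) (bu ey.F y1F)
  have og : F 0 (7:K) := eo.F
  have dkG : F 5 (cn ad aw - cn ac ag) := by
    rw [cn, cn]
    have eg : F 5 ((7*ad^4*kh ad aw^2-ad^2*kh ad aw+1) - (7*ac^4*kh ac ag^2-ac^2*kh ac ag+1)) :=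
      Ca (Cs (Cm (Cm du (Cp ig bj cb 4) og (bc cb _)) (Cp dkh fr.F fy.F 2) (bu og (bc bj _)) (bc fy.F _))
        (Cm (Cp ig bj cb 2) dkh (bc bj _) fy.F)) du
    have u1 : ∀ {s h : K}, F 0 s→F 0 h→F 0 (7*s^4*h^2-s^2*h+1) := fun hs hh =>
      dz (F0sub (bu (bu og (bc hs _)) (bc hh _)) (bu (bc hs _) hh)) Eo.F
    exact Cd (Cm dkg eg dx.F (u1 cb fy.F)) (Cp dke ey.F fu.F 2) (by simpa using Ep ey 2) (by simpa using Ep fu 2)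
      (bu dx.F (u1 bj fr.F))
  clear dke dkg
  have ew := En aa
  have eb := En ab
  have m1 := En fr
  have m2 := En fy
  have cd := kchi aa bt av
  have dl := kchi ab co bl
  have hh2 := lb nN ab jv co
  generalize kh ad aw = ar at *
  generalize kh ac ag = az at *
  generalize cn ad aw = br at *
  generalize cn ac ag = bn at *
  -- N
  have bz : E (v+4) (ad^2*ar-ac^2*az) := by
    have f := Em (Em ks (Ep ab 2)) hd
    have := Ea (n := v+4) (by convert f using 1; push_cast; ring) (Fm hNF oO)
    rwa [add_sub_cancel] at this
  have ck : E 7 ((2*br+5*ad*ar)/(ad*ar) + (2*bn+5*ac*az)/(ac*az)) := by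
    have e : (2*br+5*ad*ar)/(ad*ar) + (2*bn+5*ac*az)/(ac*az) =
      2*(5+ (ac*((br*az-bn*ar) +2*(bn*ar)) + (ad-ac)*(bn*ar))/(ad*ar*(ac*az))) := by field_simp; ring
    rw [e]
    refine Em (n :=7) (m :=0) Et (Ea fz ?_)
    have cr : F 5 (br*az-bn*ar) := Cm dkG (by convert Fn dkh using 1; ring) G1.F fr.F
    have dd : F 5 (2*(bn*ar)) := Fm (bm Et.F (bu oe.F fr.F)) nN
    have ij : F 5 (ac*((br*az-bn*ar) +2*(bn*ar))) := by
      rw [mul_comm]; exact bm (Fa cr dd) cb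
    have ki : F 5 ((ad-ac)*(bn*ar)) := bm ig (bu oe.F fr.F)
    exact Fm (Fd (Fa ij ki) (Em (Em aa fr) (Em ab fy))) nN
  have nu : 28*ad^2*ar-28*ac^2*az =28*(ad^2*ar-ac^2*az) := by ring
  have hN0 := En bz
  have hS0 := En ck
  have lm := En (lv (K:=K))
  have al := addlaw (bp :=28*ad^2*ar) (bo :=28*ac^2*az) (by simp [ew, m1, lm]) (by simp [eb, m2, lm])
    (by rw [nu]; exact mul_ne_zero lm hN0) hS0 cd dl
  have el : (28*ad^2*ar*((2*br+5*ad*ar)/(ad*ar)) +28*ac^2*az*((2*bn+5*ac*az)/(ac*az)))/(28*ad^2*ar-28*ac^2*az) =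
    (2*(ad*br+ac*bn)+5*(ad^2*ar+ac^2*az))/(ad^2*ar-ac^2*az) := by
    have : 28*ad^2*ar*((2*br+5*ad*ar)/(ad*ar)) +28*ac^2*az*((2*bn+5*ac*az)/(ac*az)) =28*(2*(ad*br+ac*bn)+5*(ad^2*ar+ac^2*az)) := by
      field_simp; ring
    rw [this, nu, mul_div_mul_left _ _ lm]
  rw [el] at al
  -- D'
  have dv : F 14 (2*(ad*br+ac*bn)+5*(ad^2*ar+ac^2*az) -10*ac^2*(1+ac)) := by
    have e : 2*(ad*br+ac*bn)+5*(ad^2*ar+ac^2*az) -10*ac^2*(1+ac) =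
      2*((ad-ac)*br + ac*(br-bn) + ac*2*bn) +5*(ad^2*ar-ac^2*az) +2*(5*ac^2*(az-(1+ac))) := by ring
    rw [e]
    have cr : F 7 ((ad-ac)*br) := bm (Fm hd.F oO) G1.F
    have dd : F 7 (ac*(br-bn)) := Fmu ab.F dkG
    have ij : F 7 (ac*2*bn) := Fm (Fmu (Fmu ab.F Et.F) oe.F) nN
    have ki : F 14 (5*(ad^2*ar-ac^2*az)) := by
      rw [mul_comm]; exact bm (Fm bz.F oO) fz.F
    have f5 : F 7 (5*ac^2*(az-(1+ac))) := Fm (Fmu (Fmu fz.F (Ep ab 2).F) hh2) nN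
    exact Fa (Fa (Fm (Fmu Et.F (Fa (Fa cr dd) ij)) nN) ki) (Fm (Fmu Et.F f5) nN)
  have oi : E 11 (10*ac^2*(1+ac)) := by
    have f := Em (Em (Em Et fz) (Ep ab 2)) (Ea Eo (Fm ab.F (show (0+1:ℤ) ≤2 by norm_num)))
    convert f using 1 <;> norm_num
  have jp : E 11 (2*(ad*br+ac*bn)+5*(ad^2*ar+ac^2*az)) := by
    have := Ea oi (Fm dv nN)
    rwa [add_sub_cancel] at this
  have hl := Ed jp bz
  refine ⟨((2*(ad*br+ac*bn)+5*(ad^2*ar+ac^2*az))/(ad^2*ar-ac^2*az))^2-21-28*ad^2*ar-28*ac^2*az, ad^2*ar-ac^2*az,2*(ad*br+ac*bn)+5*(ad^2*ar+ac^2*az) -28*(ad^2*ar-ac^2*az)^2/((2*br+5*ad*ar)/(ad*ar) + (2*bn+5*ac*az)/(ac*az)),?_,?_, hNF,?_⟩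
  rotate_left
  · rw [← al, nu]
    congr 1
    rw [one_div_div, sub_div]
    congr 1
    field_simp
  · have f := Fd (Fmu lv.F (Ep bz 2).F) ck
    have := Fs dv (Fm f (m :=14) (by push_cast; omega))
    convert this using 1; ring
  · have bp : F 0 (28*ad^2*ar) := Fm (Fmu (Fmu lv.F (Ep aa 2).F) fr.F) nN
    have bo : F 0 (28*ac^2*az) := Fm (Fmu (Fmu lv.F (Ep ab 2).F) fy.F) nN
    have f := Fn (dz (dz (oh (K:=K)).F bp) bo)
    have := Ea (n :=2*(7-v)) (by convert Ep hl 2 using 1; push_cast; ring) (Fm f oO)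
    convert this using 1; ring
end
end MF
end
section
open NumberField Module Ideal
namespace MF
section
variable {K : Type*} [Field K] [NumberField K] [MF K]
noncomputable def fl : K := (1-th^2+th^6) - (1+th+th^3+th^4+th^5)^2*(1+th^9+th^11)
theorem cB4 : F 14 (fl : K) := by
  refine FP 14 _ 1 (-1953) (-581) (-500) (-500) (-334) (-343) (-185) 2 2 2 2 2 2 2 nN nN ?_
  rw [fl]
  push_cast
  linear_combination ((-434) + (-129)*th + (-111)*th^2 + (-111)*th^3 + (-74)*th^4 + (-76)*th^5 + (-41)*th^6 + (-24)*th^7 + (-7)*th^8 + (-6)*th^9 + (-6)*th^10 + (-4)*th^11 + (-4)*th^12 + (-2)*th^13 + (-1)*th^14)*bv (K:=K)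
theorem odd_a {s t y : K} (hs : E 2 s) (ht : t = -s^3*y) (bt : F 14 (y-1)) (ay : E 0 y) (hy : y + s^7*y^3 =1)
    (aa : F 14 (s + th^2)) (ab : F 14 (t - th^6)) : False := by
  have hn : (1:ℤ) ≤2 := by norm_num
  have hg := fo hn hs ay
  have ck : E 0 (1+th+th^3+th^4+th^5 : K) := by
    have cr : F 1 (th:K) := Ett.F
    have := Ea (Eo (K:=K)) (Fa (Fa (Fa cr (Ft 3 nN)) (Ft 4 nN)) (Ft 5 nN))
    convert this using 1; ring
  refine bad911S (z := ke s y*y) (s := s*kh s y/2*kg s y) (ml hn hs ay hy) ck ?_ ?_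
  · have e : ke s y =1+s+t := by rw [ke, ht]; ring
    have hk := ft hn hs ay
    have cr := bm bt hk.F
    have := Fa (Fa cr (Fa aa ab)) cB4
    rw [fl] at this
    rw [e] at *
    convert this using 1; ring
  · rw [mul_pow, ← mul_assoc, kxsq hn hs ay, kh, div_mul_cancel₀ _ (pow_ne_zero 2 (En hg))]
theorem odd_b (j : ℕ) {ad ac eg : K} (p q : ℤ) (hp : ¬ 2∣p) (hq : ¬ 2∣q) (aa : E 2 ad) (ht1 : F 0 eg)
   (av : ad^3+eg+eg^3*ad =0) (mv : ac = -th^2/3) (hd : ad - ac =2^(j+2)*th^2*((p:K)/q)) : False := by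
  have hn : (1:ℤ) ≤2 := by norm_num
  have ab : E 2 ac := by rw [mv]; simpa using Ed (Ene (Eth (K:=K) 2)) ks
  have f6 : F 0 (th^6/9:K) := Fm (Fd (Eth (K:=K) 6).F E9) nN
  have bl : ac^3 + (-(th^6/9)) + (-(th^6/9))^3*ac =0 := by
    rw [mv]
    linear_combination (th^6*(th^7+18)/2187)*(bv (K:=K))
  obtain ⟨aw, bt, hyE1, hyy1, -⟩ := jt hn aa ht1 av
  obtain ⟨ag, co, hyE2, hyy2, -⟩ := jt hn ab (Fn f6) bl
  have hv : E (7*(j+2)+2) (ad-ac) := by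
    rw [hd]; have := ky (K:=K) (m:=j+2) (e:=2) hp hq; push_cast at this; exact this
  obtain ⟨x, N, D, hx, hl, bz, dv⟩ := diffpt oO aa ab hyE1 hyE2 bt co hyy1 hyy2 hv
  have jp : E 11 D := by
    have f := Em (Em (Em Et fz) (Ep ab 2)) (Ea Eo (Fm ab.F (show (0+1:ℤ) ≤2 by norm_num)))
    have oi : E 11 (10*ac^2*(1+ac)) := by convert f using 1 <;> norm_num
    have := Ea oi (Fm dv nN)
    rwa [add_sub_cancel] at this
  have hNE : E (7*(j+2)+6) N := by
    have f := Em (Em ks (Ep ab 2)) hv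
    have := Ea (n :=7*(j+2)+6) (by convert f using 1; push_cast; ring) (Fm bz oO)
    rwa [add_sub_cancel] at this
  refine fy (j+1) (x := x) (r := N/D) ?_ ?_ hl ?_
  · convert Ed hNE jp using 1; push_cast; ring
  · convert hx using 1; push_cast; ring
  · have e : N/D -2^(j+1)*(th^2+th^4) = ((N -3*ac^2*(ad-ac)) -2^(j+1)*(th^2*(1+th^2))*(D-10*ac^2*(1+ac))
       +2^(j+2)*(ac^2*(th^2*(3*((p:K)/q) -5*((1+th^2)*(1+ac))))))/D := by
      rw [eq_div_iff (En jp), hd, sub_mul, div_mul_cancel₀ _ (En jp)]; ring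
    rw [e]
    have o1 : F 3 (3*((p:K)/q) -5*((1+th^2)*(1+ac))) := by
      have er := ratio (K:=K) 1 (3*p) (5*q) oO oO
      have e : 3*((p:K)/q) -5*((1+th^2)*(1+ac)) =5*((((3*p:ℤ):K)/((5*q:ℤ):K)) -1) -5*(2*(th^2/3) - th^4/3) := by
        have := En (Eod (K:=K) q hq)
        rw [mv]; push_cast; field_simp; ring
      rw [e]
      have ar : F 7 (2*(th^2/3):K) := Fm (Fmu Et.F (Fd (Eth (K:=K) 2).F ks)) nN
      have az : F 3 (th^4/3:K) := Fm (Fd (Eth (K:=K) 4).F ks) nN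
      have cj := Fmu fz.F (Fs (Fm ar (show (3:ℤ) ≤7 by norm_num)) az)
      have dn := Fmu fz.F (Fm er (show (3:ℤ) ≤ _ by norm_num))
      exact Fs dn cj
    have bn : F (7*(j+2)+9) (2^(j+2)*(ac^2*(th^2*(3*((p:K)/q) -5*((1+th^2)*(1+ac)))))) :=
      Fm (Fmu (Ep Et (j+2)).F (Fmu (Ep ab 2).F (Fmu (Eth 2).F o1))) (by push_cast; omega)
    have br : F (7*(j+2)+9) (2^(j+1)*(th^2*(1+th^2))*(D-10*ac^2*(1+ac))) :=
      Fm (Fmu (Fmu (Ep Et (j+1)).F (Fmu (Eth 2).F (ths 2 nN).F)) dv) (by push_cast; omega)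
    exact Fm (Fd (Fa (Fs (Fm bz oO) br) bn) jp) (by push_cast; omega)
end
end MF
end
section
open NumberField Module Ideal
namespace MF
section
theorem z8a : ∀ a b c : ZMod 8,4*a =4→4*c =4→3*a^7+b^7+4*c^7 =0 →
  (2*(c-a) =0∧2*(b^2*c-(-3*a^3)) =0∧2*(c^3-9*a^2*b)=0)∨2*(b^2*c+a^3) =0 := by decide
theorem il (n : ℤ) : (2*(n:ZMod 8) =0 ↔ 2^2∣n) := by
  have := ZMod.intCast_zmod_eq_zero_iff_dvd (2*n) 8
  push_cast at this
  rw [this]; constructor <;> intro h <;> omega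
theorem z8odd (n : ℤ) (h : ¬ 2∣n) : 4*(n:ZMod 8) =4 := by
  have := (ZMod.intCast_eq_intCast_iff_dvd_sub 4 (4*n) 8).2 oO
  push_cast at this; exact this.symm
theorem eq314_odd (A B C : ℤ) (h : 3*A^7+B^7+4*C^7 =0) (cq : ¬ 2∣C) (bk : ¬ 2∣A) (bq : ¬ 2∣B)
    (K : Type*) [Field K] [NumberField K] [MF K] : B^2*C = -A^3 := by
  have hA' := En (Eod (K:=K) A bk)
  have hB' := En (Eod (K:=K) B bq)
  have gx : 3*(A:K)^7+(B:K)^7+4*(C:K)^7 =0 := by exact_mod_cast congrArg (Int.cast : ℤ→K) h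
  have hid := id314 (K:=K) th A B C bv hA' hB' gx
  have ht : F 0 (th^6*(C:K)^3/(9*A^2*B)) := by
    have := Fmu (Eth (K:=K) 6).F (Fq (K:=K) (p := C^3) (oddm (oddm (by norm_num : ¬ (2:ℤ)∣9) (oddp bk 2)) bq))
    push_cast at this
    rw [mul_div_assoc]
    exact Fm this nN
  have hs : E 2 (th^2*(B:K)^2*(C:K)/(3*A^3)) := by
    have := ky (K:=K) (m :=0) (e :=2) (oddm (oddp bq 2) cq) (oddm (by norm_num : ¬ (2:ℤ)∣3) (oddp bk 3))
    push_cast at this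
    convert this using 1
    ring
  have nr : 3*(A:ZMod 8)^7+(B:ZMod 8)^7+4*(C:ZMod 8)^7 =0 := by exact_mod_cast congrArg (Int.cast : ℤ→ZMod 8) h
  have hz := z8a A B C (z8odd A bk) (z8odd C cq) nr
  rcases hz with ⟨-, aa, ab⟩ | aa
  · exfalso
    obtain ⟨y, bt, ay, hy, hty⟩ := jt nN hs ht hid
    refine odd_a hs hty bt ay hy ?_ ?_
    · have := ratio (K:=K) 2 (B^2*C) (-3*A^3) (oddm nN (oddp bk 3)) ((il _).1 (by push_cast; exact aa))
      have e : th^2*(B:K)^2*(C:K)/(3*A^3) + th^2 = -(th^2)*(((B^2*C:ℤ):K)/((-3*A^3:ℤ):K)-1) := by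
        push_cast; field_simp; ring
      rw [e]
      exact Fm (Fmu (Fn (Eth 2).F) this) nN
    · have := ratio (K:=K) 2 (C^3) (9*A^2*B) (oddm (oddm nN (oddp bk 2)) bq) ((il _).1 (by push_cast; exact ab))
      have e : th^6*(C:K)^3/(9*A^2*B) - th^6 = (th^6)*(((C^3:ℤ):K)/((9*A^2*B:ℤ):K)-1) := by
        push_cast; ring
      rw [e]
      exact Fm (Fmu ((Eth 6).F) this) nN
  · by_contra hne
    have fw : B^2*C+A^3≠0 := fun h => hne (by linarith)
    have au := (il (B^2*C+A^3)).1 (by push_cast; exact aa)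
    obtain ⟨m, p, hm, hp, hmp⟩ := lx fw oO
    obtain ⟨j, rfl⟩ : ∃ j, m = j+2 := by
      rcases Nat.lt_or_ge m 2 with h | h
      · exfalso
        obtain rfl : m =1 := by omega
        omega
      · exact ⟨m-2, by omega⟩
    refine odd_b j p (3*A^3) hp (oddm nN (oddp bk 3)) hs ht hid rfl ?_
    have hmK : (B:K)^2*C+(A:K)^3 =2^(j+2)*(p:K) := by exact_mod_cast congrArg (Int.cast : ℤ→K) hmp
    push_cast
    field_simp
    linear_combination th^2*hmK
theorem pow_cop_eq {A B C : ℤ} (h : B^2*C = -A^3) (ii : IsCoprime A B) (kb : IsCoprime A C) : IsUnit A∧IsUnit B∧IsUnit C := by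
  have aa : IsCoprime (A^3) (B^2*C) := (ii.pow_left.pow_right).mul_right kb.pow_left
  have ab : IsUnit (A^3) := by
    rw [h] at aa
    exact aa.isUnit_of_dvd' dvd_rfl (Dvd.intro_left (-1) (by ring) : A^3∣-A^3)
  have ae : IsUnit (B^2*C) := by rw [h]; exact ab.neg
  have au := isUnit_of_mul_isUnit_left ae
  exact ⟨(isUnit_pow_iff nN).1 ab, (isUnit_pow_iff nN).1 au, isUnit_of_mul_isUnit_right ae⟩
end
end MF
end
section
open NumberField Module Ideal Polynomial
namespace MF
theorem irrP : Irreducible (X ^ 7 - C 18 : ℚ[X]) := by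
  have hp : Fact (Nat.Prime 2) := ⟨Nat.prime_two⟩
  refine irr7 18 1 ?_ nN
  have : (18:ℚ) =2*9 := by norm_num
  rw [this, padicValRat.mul nN nN]
  have dw : padicValRat 2 (9:ℚ) =0 := by
    have : padicValRat 2 ((9:ℕ):ℚ) =0 := by
      rw [padicValRat.of_nat, padicValNat.eq_zero_of_not_dvd nN]; rfl
    exact_mod_cast this
  have ab : padicValRat 2 (2:ℚ) =1 := by
    have := padicValRat.self (p :=2) nN; exact_mod_cast this
  rw [dw, ab]; norm_num
instance factP : Fact (Irreducible (X ^ 7 - C 18 : ℚ[X])) := ⟨irrP⟩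
abbrev L := AdjoinRoot (X ^ 7 - C 18 : ℚ[X])
instance : Module.Finite ℚ L := (AdjoinRoot.powerBasis irrP.ne_zero).finite
instance : NumberField L where
noncomputable instance : MF L where
  th := AdjoinRoot.root _
  bv := by
    have := AdjoinRoot.eval₂_root (X ^ 7 - C 18 : ℚ[X])
    simp only [eval₂_sub, eval₂_pow, eval₂_X, eval₂_C] at this
    rw [sub_eq_zero.1 this, map_ofNat]
  hd := by
    rw [(AdjoinRoot.powerBasis irrP.ne_zero).finrank, AdjoinRoot.powerBasis_dim, natDegree_X_pow_sub_C]
theorem eq281 (A B C : ℤ) (h : 2*A^7+81*B^7+C^7 =0) (ak : A≠0) (ii : IsCoprime A B) (gy : IsCoprime B C)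
    (je : ¬ 3∣A) (jd : ¬ 3∣C) (cq : ¬ 2∣C) (bq : ¬ 2∣B) : False := by
  by_cases bk : 2∣A
  · exact eq281_even A B C h ak bk bq cq L
  · exact eq281_odd A B C h bk bq cq je jd ii gy L
theorem eq314 (A B C : ℤ) (h : 3*A^7+B^7+4*C^7 =0) (ak : C≠0) (bk : ¬ 2∣A) (bq : ¬ 2∣B)
    (ii : IsCoprime A B) (kb : IsCoprime A C) : IsUnit A∧IsUnit B∧IsUnit C := by
  by_cases cq : 2∣C
  · exact (eq314_even A B C h ak cq bk bq L).elim
  · exact pow_cop_eq (eq314_odd A B C h cq bk bq L) ii kb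
end MF
end
section
open NumberField Module Ideal
namespace Y7
section
def cx : Type := CyclotomicField 7 ℚ
noncomputable instance : Field cx := inferInstanceAs (Field (CyclotomicField 7 ℚ))
instance : NumberField cx := inferInstanceAs (NumberField (CyclotomicField 7 ℚ))
instance : IsCyclotomicExtension {7} ℚ cx := by
  have h := CyclotomicField.isCyclotomicExtension 7 ℚ
  have e : (DivisionRing.toRatAlgebra : Algebra ℚ (CyclotomicField 7 ℚ)) = CyclotomicField.algebra 7 ℚ := Subsingleton.elim _ _
  show @IsCyclotomicExtension {7} ℚ (CyclotomicField 7 ℚ) _ _ DivisionRing.toRatAlgebra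
  rw [e]; exact h
abbrev af := 𝓞 cx
instance f7 : Fact (Nat.Prime 7) := ⟨by norm_num⟩
theorem zsp : IsPrimitiveRoot (IsCyclotomicExtension.zeta 7 ℚ cx) 7 := IsCyclotomicExtension.zeta_spec 7 ℚ cx
noncomputable def z : af := zsp.toInteger
noncomputable def l : af := z -1
theorem zl : z =1 + l := by rw [l]; ring
theorem zpr : IsPrimitiveRoot z 7 := zsp.toInteger_isPrimitiveRoot
theorem ek : z^7 =1 := zpr.pow_eq_one
theorem phi : 1 + z + z^2 + z^3 + z^4 + z^5 + z^6 =0 := by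
  have h := zpr.geom_sum_eq_zero nN
  simpa [Finset.sum_range_succ] using h
theorem lp : Prime l := zsp.zeta_sub_one_prime'
theorem ic : l^6∣7 := by
  refine ⟨(1+z)*(1+z+z^2)*(1+z+z^2+z^3)*(1+z+z^2+z^3+z^4)*(1+z+z^2+z^3+z^4+z^5),?_⟩
  rw [l]
  linear_combination -(-6+5*z+z^3+z^5-z^6-4*z^7+3*z^8-z^9+z^10+z^12-2*z^14+z^15)*phi
theorem l7 : l∣7 := (dvd_pow_self l nN).trans ic
theorem lint (n : ℤ) (h : l∣(n : af)) : (7:ℤ)∣n := by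
  by_contra hc
  have : IsCoprime (7:ℤ) n := (Int.isCoprime_iff_gcd_eq_one.2 ((Int.prime_iff_natAbs_prime.2 nN : Prime (7:ℤ)).coprime_iff_not_dvd.2 hc |> Int.isCoprime_iff_gcd_eq_one.1))
  obtain ⟨a, b, hab⟩ := this
  have ab : (a:af)*7 + b * n =1 := by exact_mod_cast congrArg (Int.cast : ℤ→af) hab
  exact lp.not_isUnit (isUnit_of_dvd_one (ab ▸ dvd_add (l7.mul_left _) (h.mul_left _)))
theorem intl (n : ℤ) (h : (7:ℤ)∣n) : l^6∣(n : af) := by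
  obtain ⟨k, rfl⟩ := h
  push_cast
  exact ic.mul_right _
theorem modi (x : af) : ∃ n : ℤ, l∣x - n := by
  have h : Nat.card (af⧸Ideal.span {l}) =7 := by
    have aa := zsp.card_quotient_toInteger_sub_one
    rw [zsp.norm_toInteger_sub_one_of_prime_ne_two' nN] at aa
    exact aa
  have : Finite (af⧸Ideal.span {l}) := Nat.finite_of_card_ne_zero (by rw [h]; norm_num)
  let := Fintype.ofFinite (af⧸Ideal.span {l})
  let e := ZMod.ringEquivOfPrime (af⧸Ideal.span {l}) (p :=7) nN (by rw [← h, Nat.card_eq_fintype_card])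
  obtain ⟨k, hk⟩ := e.surjective (Ideal.Quotient.mk _ x)
  refine ⟨k.val,?_⟩
  rw [← Ideal.mem_span_singleton, ← Ideal.Quotient.eq, ← hk]
  conv_lhs => rw [← ZMod.natCast_zmod_val k, map_natCast]
  rw [Int.cast_natCast, map_natCast]
theorem nosmall (I : Ideal af) (n : ℕ) (jz : absNorm I = n) (hn : n =2∨n =3∨n =4∨n =9) : False := by
  have h : Nat.card (af⧸I) = n := by rw [← jz]; rfl
  have : Finite (af⧸I) := Nat.finite_of_card_ne_zero oO
  have : Nontrivial (af⧸I) := by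
    rw [← Finite.one_lt_card_iff_nontrivial]; omega
  have lj : ((n:ℕ) : af⧸I) =0 := by
    have := card_nsmul_eq_zero' (G := af⧸I) (x :=1)
    rw [h] at this; simpa using this
  have ao : ((7:ℕ) : af⧸I)≠0 := by
    intro ao
    have : IsCoprime ((n:ℕ):ℤ) ((7:ℕ):ℤ) := by rw [Nat.isCoprime_iff_coprime]; rcases hn with h|h|h|h <;> rw [h] <;> norm_num
    obtain ⟨a, b, hab⟩ := this
    have ab : (a: af⧸I)*(n:ℕ) + b * (7:ℕ) =1 := by exact_mod_cast congrArg (Int.cast : ℤ→af⧸I) hab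
    rw [lj, ao] at ab
    simp at ab
  have hlt := natCard_units_lt (af⧸I)
  let w : (af⧸I)ˣ := Units.map (Ideal.Quotient.mk I).toMonoidHom (Units.ofPowEqOne z 7 ek nN)
  have hw : w^7 =1 := by
    ext
    simp only [w, Units.val_pow_eq_pow_val, Units.coe_map]
    show (Ideal.Quotient.mk I z)^7 =1
    rw [← map_pow, ek, map_one]
  have hw1 : w≠1 := by
    intro aa
    have ab : Ideal.Quotient.mk I z =1 := congrArg Units.val aa
    have ae := congrArg (Ideal.Quotient.mk I) phi
    simp only [map_add, map_pow, ab, map_one, map_zero] at ae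
    apply ao; rw [← ae]; norm_num
  have ho : orderOf w =7 := orderOf_eq_prime hw hw1
  have hd : 7∣Nat.card (af⧸I)ˣ := ho ▸ orderOf_dvd_natCard w
  rw [h] at hlt
  have hpos : 0 < Nat.card (af⧸I)ˣ := Nat.card_pos
  obtain rfl : n =9 := by have := Nat.le_of_dvd hpos hd; omega
  have hm : orderOf (-1 : (af⧸I)ˣ) =2 := by
    refine orderOf_eq_prime (by simp) ?_
    intro hm
    have aa : (-1 : af⧸I) =1 := by simpa using congrArg Units.val hm
    have ab : (1 : af⧸I) =0 := by
      have : ((9:ℕ):af⧸I) =1 -4 * (-1 -1) := by push_cast; ring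
      rw [lj, aa] at this; simpa using this.symm
    exact one_ne_zero ab
  have ni : 2∣Nat.card (af⧸I)ˣ := hm ▸ orderOf_dvd_natCard _
  omega
open Real in
theorem mink : (4 / π) ^ InfinitePlace.nrComplexPlaces cx * ((finrank ℚ cx).factorial / (finrank ℚ cx) ^ (finrank ℚ cx) * √|discr cx|) <5 := by
  rw [IsCyclotomicExtension.Rat.discr_prime 7 cx, IsCyclotomicExtension.finrank (n :=7) cx
    (Polynomial.cyclotomic.irreducible_rat nN), IsCyclotomicExtension.Rat.nrComplexPlaces_eq_totient_div_two 7, Nat.totient_prime nN]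
  have aa : √(((|(-1)^((7-1)/2)*7^(7-2)|:ℤ):ℝ)) ≤130 := by
    rw [Real.sqrt_le_left nN]; norm_num
  have ab : (4/π)^3 ≤ (4/3.14)^3 := by
    gcongr; exact Real.pi_gt_d2.le
  have ae : (0:ℝ) ≤ (4/π)^3 := by positivity
  push_cast at aa ⊢
  norm_num [Nat.factorial] at aa ⊢
  norm_num at ab
  nlinarith [Real.sqrt_nonneg 16807]
instance pid : IsPrincipalIdealRing af := by
  apply RingOfIntegers.isPrincipalIdealRing_of_isPrincipal_of_norm_le_of_isPrime
  intro I jz h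
  have aa := h.trans_lt mink
  have ak : (I : Ideal af) ≠ ⊥ := nonZeroDivisors.coe_ne_zero I
  have ab : absNorm (I : Ideal af) <5 := by exact_mod_cast aa
  have ae : absNorm (I : Ideal af)≠0 := by rwa [Ne, absNorm_eq_zero_iff]
  have au : absNorm (I : Ideal af)≠1 := by rw [Ne, absNorm_eq_one_iff]; exact jz.ne_top
  exact (nosmall (I : Ideal af) _ rfl oO).elim
theorem rank7 : Units.rank cx =2 := by
  have : IsTotallyComplex cx := IsCyclotomicExtension.Rat.isTotallyComplex cx (n :=7) nN
  rw [Units.rank, InfinitePlace.card_eq_nrRealPlaces_add_nrComplexPlaces, IsTotallyComplex.nrRealPlaces_eq_zero, IsCyclotomicExtension.Rat.nrComplexPlaces_eq_totient_div_two 7, Nat.totient_prime nN]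
end
end Y7
end
section
open NumberField Module Ideal
namespace Y7
section
theorem dmul {d a a' b b' : af} (h : d∣a - a') (h' : d∣b - b') : d∣a*b - a'*b' := by
  have : a*b - a'*b' = (a-a')*b + a'*(b-b') := by ring
  rw [this]; exact dvd_add (h.mul_right _) (h'.mul_left _)
theorem dtr {d a b c : af} (h : d∣a - b) (h' : d∣a - c) : d∣b - c := by
  have : b - c = (a-c)-(a-b) := by ring
  rw [this]; exact dvd_sub h' h
theorem powl {x c e t : af} {k : ℕ} (hk : 1 ≤ k) (ht : l^k∣t) (h : l^(k+1)∣x - c*(1+e*t)) (B : ℕ) :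
    l^(k+1)∣x^B - c^B*(1+B*e*t) := by
  induction B with
  | zero => simp
  | succ B ih =>
    have : x^(B+1) - c^(B+1)*(1+(B+1:ℕ)*e*t) = x^B*(x - c*(1+e*t)) + c*(1+e*t)*(x^B - c^B*(1+B*e*t)) + c^(B+1)*B*e^2*(t*t) := by
      push_cast; ring
    rw [this]
    refine dvd_add (dvd_add (h.mul_left _) (ih.mul_left _)) (Dvd.dvd.mul_left ?_ _)
    exact (pow_dvd_pow l oO).trans (pow_add l k k ▸ mul_dvd_mul ht ht)
theorem core (P m A : ℤ) (k : ℕ) (hk : k ≤5) (v t : af) (hv : IsUnit v) (ht : t = l^k*v) (hk1 : 1 ≤ k) (aj : ¬ (7:ℤ)∣P)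
    (h : l^(k+1)∣(P:af)*(1+A*t) - m) : (7:ℤ)∣A := by
  have aa : l∣((P - m : ℤ) : af) := by
    have e : ((P - m : ℤ) : af) = ((P:af)*(1+A*t) - m) - P*A*t := by push_cast; ring
    rw [e]
    refine dvd_sub ((dvd_pow_self l oO).trans h) (Dvd.dvd.mul_left ?_ _)
    rw [ht]; exact (dvd_pow_self l oO).mul_right _
  have ab := (pow_dvd_pow l (by omega : k+1 ≤6)).trans (intl _ (lint _ aa))
  have ae : l^k*l∣l^k*(((P*A:ℤ):af)*v) := by
    have e : l^k*(((P*A:ℤ):af)*v) = ((P:af)*(1+A*t) - m) - ((P - m : ℤ) : af) := by rw [ht]; push_cast; ring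
    rw [e, ← pow_succ]; exact dvd_sub h ab
  have au := (mul_dvd_mul_iff_left (pow_ne_zero k lp.ne_zero)).1 ae
  rw [hv.dvd_mul_right] at au
  exact ((Int.prime_iff_natAbs_prime.2 nN : Prime (7:ℤ)).dvd_or_dvd (lint _ au)).resolve_left aj
theorem jk (x : af) : ∃ n : ℤ, l^6∣x^7 - n := by
  obtain ⟨n, q, hq⟩ := modi x
  refine ⟨n^7,?_⟩
  have : x = n + l*q := by rw [← hq]; ring
  have e : x^7 - ((n^7:ℤ):af) =7*(n^6*(l*q)+3*n^5*(l*q)^2+5*n^4*(l*q)^3+5*n^3*(l*q)^4+3*n^2*(l*q)^5+n*(l*q)^6) + l^6*(l*q^7) := by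
    rw [this]; push_cast; ring
  rw [e]
  exact dvd_add (ic.mul_right _) (dvd_mul_right _ _)
noncomputable def zu : afˣ := Units.ofPowEqOne z 7 ek nN
theorem zuv : (zu : af) = z := rfl
noncomputable def s : af := z + z^6
theorem smin : s^3 + s^2 -2*s -1 =0 := by
  rw [s]; linear_combination phi + (3*z+3*z^6+z^11+z^4+2+z^5)*ek
noncomputable def su : afˣ := ⟨s, s^2+s-2, by linear_combination smin, by linear_combination smin⟩
noncomputable def tu : afˣ := ⟨s+1, -(s+1)^2+2*(s+1)+1, by linear_combination -smin, by linear_combination -smin⟩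
noncomputable def wu : afˣ := su^4*tu
theorem wv : (wu:af) = s^4*(s+1) := by simp [wu, su, tu]
theorem suv : (su:af) = s := rfl
noncomputable def th : af := s -2
theorem thl : th = l^2*z^6 := by
  rw [th, s, l]; linear_combination (2 - z)*ek
theorem th3 : th^3 =7*(-(th^2+2*th+1)) := by
  rw [th]; linear_combination smin
theorem zun (k : ℕ) : IsUnit (z^k) := (zu^k).isUnit
theorem kum1 (A B C : ℕ) (m : ℤ) (h : l^6∣z^A * s^B * (wu:af)^C - m) : 7∣A∧7∣B∧7∣C := by
  have h21 : ∀ B C : ℕ, ¬ (7:ℤ)∣2^B*(-1)^C := by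
    intro B C hd
    have jh : Prime (7:ℤ) := Int.prime_iff_natAbs_prime.2 nN
    rcases jh.dvd_or_dvd hd with h | h
    · have := jh.dvd_of_dvd_pow h; norm_num at this
    · have := jh.dvd_of_dvd_pow h; norm_num at this
  have lth : l^2∣th := by rw [thl]; exact dvd_mul_right _ _
  have hw : l^6∣(wu:af) - (-1)*(1+1*th^2) := by
    have : (wu:af) - (-1)*(1+1*th^2) =7*(7+16*th+15*th^2 - (th^2+2*th+1)*(48+11*th+th^2)) := by
      rw [wv]; have := th3; rw [th] at *; linear_combination (48+11*(s-2)+(s-2)^2)*this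
    rw [this]; exact ic.mul_right _
  have hw4 : l^4∣(wu:af) - (-1) := by
    have e : (wu:af) - (-1) = ((wu:af) - (-1)*(1+1*th^2)) - th*th := by ring
    rw [e]; refine dvd_sub ((pow_dvd_pow l nN).trans hw) (pow_add l 2 2 ▸ mul_dvd_mul lth lth)
  have hwC : l^4∣(wu:af)^C - (-1)^C := hw4.trans (sub_dvd_pow_sub_pow _ _ _)
  have bk : 7∣A := by
    have aa := powl (x := z) (c :=1) (e :=1) (t := l) (k :=1) le_rfl (by simp) (by rw [zl]; simp) A
    have ab : l^2∣s^B -2^B := lth.trans (sub_dvd_pow_sub_pow _ _ _)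
    have ae := dtr (dmul (dmul aa ab) ((pow_dvd_pow l nN).trans hwC)) ((pow_dvd_pow l nN).trans h)
    have := core (2^B*(-1)^C) m A 1 nN 1 l isUnit_one (by simp) le_rfl (h21 B C) (by
      refine ae.trans (dvd_of_eq ?_); push_cast; ring)
    exact_mod_cast this
  have hz : z^A =1 := by obtain ⟨k, rfl⟩ := bk; rw [pow_mul, ek, one_pow]
  rw [hz, one_mul] at h
  have bq : 7∣B := by
    have aa := powl (x := s) (c :=2) (e :=4) (t := th) (k :=2) nN lth (by
      have e : s -2*(1+4*th) =7*(-th) := by rw [th]; ring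
      rw [e]; exact ((pow_dvd_pow l nN).trans ic).mul_right _) B
    have ae := dtr (dmul aa ((pow_dvd_pow l nN).trans hwC)) ((pow_dvd_pow l nN).trans h)
    have := core (2^B*(-1)^C) m (B*4) 2 nN (z^6) th (zun 6) thl nN (h21 B C) (by
      refine ae.trans (dvd_of_eq ?_); push_cast; ring)
    omega
  refine ⟨bk, bq,?_⟩
  obtain ⟨b, rfl⟩ := bq
  obtain ⟨n, hn⟩ := jk (s^b)
  rw [← pow_mul, mul_comm b] at hn
  have nb : ¬ (7:ℤ)∣n := by
    intro hc
    have aa : l∣s^(7*b) := by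
      have := dvd_add ((dvd_pow_self l nN).trans hn) ((dvd_pow_self l nN).trans (intl _ hc))
      simpa using this
    exact lp.not_isUnit (isUnit_of_dvd_unit aa (su^(7*b)).isUnit)
  have aa := powl (x := (wu:af)) (c := -1) (e :=1) (t := th^2) (k :=4) nN (by rw [sq]; exact pow_add l 2 2 ▸ mul_dvd_mul lth lth) ((pow_dvd_pow l nN).trans hw) C
  have ae := dtr (dmul ((pow_dvd_pow l nN).trans hn) aa) ((pow_dvd_pow l nN).trans h)
  have := core (n*(-1)^C) m C 4 nN (z^12) (th^2) (zun 12) (by rw [thl]; ring) nN (by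
      intro hd
      have jh : Prime (7:ℤ) := Int.prime_iff_natAbs_prime.2 nN
      rcases jh.dvd_or_dvd hd with h | h
      · exact nb h
      · have := jh.dvd_of_dvd_pow h; norm_num at this) (by
      refine ae.trans (dvd_of_eq ?_); push_cast; ring)
  exact_mod_cast this
theorem kummer (u : afˣ) (n : ℤ) (h : l^6∣(u:af) - n) : ∃ v : afˣ, u = v^7 := by
  let f : Fin 7×Fin 7×Fin 7→afˣ := fun i => zu^(i.1:ℕ) * su^(i.2.1:ℕ) * wu^(i.2.2:ℕ)
  have fv : ∀ i, (f i : af) = z^(i.1:ℕ) * s^(i.2.1:ℕ) * (wu:af)^(i.2.2:ℕ) := fun i => by simp [f, zuv, suv]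
  have hf : ∀ i j w, f i = f j * w^7→i = j := by
    intro i j w hij
    have e : f i * (f j)^6 = (f j * w)^7 := by rw [hij, mul_right_comm, mul_pow (f j) w 7, ← pow_succ' (f j) 6]
    obtain ⟨m, hm⟩ := jk ((f j * w : afˣ) : af)
    have bl := congrArg Units.val e
    simp only [Units.val_mul, Units.val_pow_eq_pow_val] at bl hm
    rw [← bl, fv, fv] at hm
    obtain ⟨aa, ab, ae⟩ := kum1 (i.1+6*j.1) (i.2.1+6*j.2.1) (i.2.2+6*j.2.2) m (by
      refine hm.trans (dvd_of_eq ?_); ring)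
    have := i.1.2; have := i.2.1.2; have := i.2.2.2
    have := j.1.2; have := j.2.1.2; have := j.2.2.2
    ext <;> omega
  obtain ⟨i, v, hu⟩ := unitsm (K := cx) 7 f (by rw [rank7]; simp) hf u
  obtain ⟨m, hm⟩ := jk ((v⁻¹ : afˣ) : af)
  have aa := dmul h hm
  have e : (u:af) * ((v⁻¹ : afˣ) : af)^7 = f i := by
    rw [hu]; simp only [Units.val_mul, Units.val_pow_eq_pow_val]
    rw [mul_assoc, ← mul_pow, Units.mul_inv, one_pow, mul_one]
  rw [e, fv] at aa
  obtain ⟨aa, ab, ae⟩ := kum1 _ _ _ (n*m) (by push_cast; exact aa)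
  have := i.1.2; have := i.2.1.2; have := i.2.2.2
  refine ⟨v,?_⟩
  rw [hu]
  simp only [f]
  rw [show (i.1:ℕ) =0 by omega, show (i.2.1:ℕ) =0 by omega, show (i.2.2:ℕ) =0 by omega]
  simp
end
end Y7
end
section
open NumberField Module Ideal
namespace Y7
section
theorem normp (p : ℕ) : absNorm (span {(p:af)}) = p^6 := by
  rw [absNorm_span_singleton]
  have : (p:af) = algebraMap ℤ af p := by simp
  rw [this, Algebra.norm_algebraMap, RingOfIntegers.rank, IsCyclotomicExtension.finrank (n :=7) cx
    (Polynomial.cyclotomic.irreducible_rat nN), Nat.totient_prime nN]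
  simp [Int.natAbs_pow]
theorem normq (p : ℕ) (hp : p =2∨p =3) (q : af) (hq : ¬ IsUnit q) (hd : q∣(p:af)) : p^3∣absNorm (span {q}) := by
  have hpp : p.Prime := by rcases hp with rfl | rfl <;> norm_num
  have aa : absNorm (span {q})∣p^6 := by
    rw [← normp]; exact absNorm_dvd_absNorm_of_le (span_singleton_le_span_singleton.2 hd)
  obtain ⟨k, hk, jn⟩ := (Nat.dvd_prime_pow hpp).1 aa
  rw [jn]; apply pow_dvd_pow
  by_contra hc
  have ab : k =0∨k =1∨k =2 := by omega
  rcases ab with rfl | ab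
  · rw [pow_zero, absNorm_eq_one_iff, span_singleton_eq_top] at jn; exact hq jn
  · refine nosmall _ _ jn ?_
    rcases hp with rfl | rfl <;> rcases ab with rfl | rfl <;> norm_num
theorem ls (p : ℕ) (hp : p =2∨p =3) (a b c : af) (hab : IsCoprime a b) (hac : IsCoprime a c) (hbc : IsCoprime b c)
    (ha : ¬ IsCoprime a p) (hb : ¬ IsCoprime b p) (hc : ¬ IsCoprime c p) : False := by
  have mz : (p:af)≠0 := by rcases hp with rfl | rfl <;> norm_num
  have key : ∀ a : af, ¬ IsCoprime a p → ∃ q, ¬ IsUnit q∧q∣a∧q∣(p:af) := by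
    intro a ha
    by_contra hc; push Not at hc
    exact ha (isCoprime_of_dvd a p (fun h => mz h.2) (fun z hz _ aa ab => hc z hz aa ab))
  obtain ⟨x, hx, hxa, hxp⟩ := key a ha
  obtain ⟨y, hy, hyb, hyp⟩ := key b hb
  obtain ⟨w, hw, hwc, hwp⟩ := key c hc
  have aa : x*y*w∣(p:af) := by
    refine IsCoprime.mul_dvd (IsCoprime.mul_left ?_ ?_) (IsCoprime.mul_dvd ?_ hxp hyp) hwp
    · exact (hac.of_isCoprime_of_dvd_left hxa).of_isCoprime_of_dvd_right hwc
    · exact (hbc.of_isCoprime_of_dvd_left hyb).of_isCoprime_of_dvd_right hwc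
    · exact (hab.of_isCoprime_of_dvd_left hxa).of_isCoprime_of_dvd_right hyb
  have ab : absNorm (span {x*y*w})∣p^6 := by
    rw [← normp]; exact absNorm_dvd_absNorm_of_le (span_singleton_le_span_singleton.2 aa)
  rw [← span_singleton_mul_span_singleton, ← span_singleton_mul_span_singleton, map_mul, map_mul] at ab
  have ae := (mul_dvd_mul (mul_dvd_mul (normq p hp x hx hxp) (normq p hp y hy hyp)) (normq p hp w hw hwp)).trans ab
  rcases hp with rfl | rfl <;> norm_num at ae
theorem fac (a b : af) : a^7 + b^7 = ∏ i∈Finset.range 7, (a + z^i*b) := by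
  classical
  rw [zpr.pow_add_pow_eq_prod_add_mul a b (by decide)]
  have : Polynomial.nthRootsFinset 7 (1:af) = (Finset.range 7).image (fun i => z^i) := by
    symm
    refine Finset.eq_of_subset_of_card_le ?_ ?_
    · intro x hx
      obtain ⟨i, -, rfl⟩ := Finset.mem_image.1 hx
      rw [Polynomial.mem_nthRootsFinset nN]
      rw [← pow_mul, mul_comm, pow_mul, ek, one_pow]
    · rw [zpr.card_nthRootsFinset, Finset.card_image_of_injOn]
      · simp
      · intro i hi j hj h
        exact zpr.pow_inj (by simpa using hi) (by simpa using hj) h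
  rw [this, Finset.prod_image]
  intro i hi j hj h
  exact zpr.pow_inj (by simpa using hi) (by simpa using hj) h
theorem splt {x y d c : af} (hxy : IsCoprime x y) (h : x*y = d*c^7) : ∃ e r, e∣d∧x = e*r^7 := by
  by_cases nj : d =0
  · exact ⟨x,1, by simp [nj], by simp⟩
  obtain ⟨nv, d2,⟨ep, hx⟩,⟨aw, hy⟩, rfl⟩ := exists_dvd_and_dvd_of_dvd_mul (Dvd.intro _ h.symm)
  have aa : ep*aw = c^7 := by
    apply mul_left_cancel₀ nj
    rw [← h, hx, hy]; ring
  have ab : IsCoprime ep aw := (hxy.of_isCoprime_of_dvd_left ⟨nv, by rw [hx]; ring⟩).of_isCoprime_of_dvd_right ⟨d2, by rw [hy]; ring⟩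
  obtain ⟨r, u, hr⟩ := exists_associated_pow_of_mul_eq_pow' ab aa
  refine ⟨nv*u, r,?_, by rw [hx, ← hr]; ring⟩
  exact mul_dvd_mul_left nv u.isUnit.dvd
noncomputable def e (i : ℕ) : af := ∑ k∈Finset.range i, z^k
theorem el (i : ℕ) : z^i =1 + e i * l := by rw [e, l, geom_sum_mul]; ring
theorem eu (i : ℕ) (aa : 1 ≤ i) (ao : i <7) : IsUnit (e i) := zpr.geom_sum_isUnit nN (by
  rw [Nat.coprime_comm, Nat.Prime.coprime_iff_not_dvd nN]; intro h; have := Nat.le_of_dvd aa h; omega)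
theorem ed (i j : ℕ) (hij : i < j) (ao : j <7) : IsUnit (e j - e i) := by
  have : e j - e i = z^i * e (j-i) := by
    apply mul_right_cancel₀ lp.ne_zero
    have h := el j
    rw [show j = i + (j-i) by omega, pow_add] at h
    have aa := el i
    have ab := el (j-i)
    rw [show i + (j-i) = j by omega] at h
    linear_combination -h + aa + z^i*ab
  rw [this]
  exact (zun i).mul (eu _ oO oO)
theorem ed' (i j : ℕ) (hij : i≠j) (hi : i <7) (ao : j <7) : IsUnit (e j - e i) := by
  rcases lt_or_gt_of_ne hij with h | h
  · exact ed i j h ao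
  · rw [← neg_sub]; exact (ed j i h hi).neg
def Sol (m : ℕ) : Prop := ∃ a b c d : af, IsCoprime a b∧d∣1296∧¬ l∣c∧a^7 + b^7 = d*(l^m*c)^7
theorem fin1 (u v : afˣ) (r t c q : af) (k : ℕ) (hk : 1 ≤ k) (hc : c∣1296) (hrt : IsCoprime r t) (hq : ¬ l∣q)
    (h : u*r^7 + v*t^7 = c*(l^k*q)^7) : Sol k := by
  have aa : r^7 + (u⁻¹*v : afˣ)*t^7 = (u⁻¹ : afˣ)*c*(l^k*q)^7 := by
    have e : ((u⁻¹ : afˣ) : af) * u =1 := Units.inv_mul u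
    rw [Units.val_mul]
    linear_combination ((u⁻¹ : afˣ) : af)*h - r^7*e
  have cf : l^6∣r^7 + (u⁻¹*v : afˣ)*t^7 := by
    rw [aa]; refine Dvd.dvd.mul_left ?_ _
    rw [mul_pow, ← pow_mul]; exact (pow_dvd_pow l oO).mul_right _
  have hl : ¬ l∣t := by
    intro hd
    have ab : l∣r^7 := by
      have := dvd_sub ((dvd_pow_self l nN).trans cf) ((hd.trans (dvd_pow_self t (by norm_num : 7≠0))).mul_left ((u⁻¹*v : afˣ):af))
      simpa using this
    exact lp.not_isUnit (hrt.isUnit_of_dvd' (lp.dvd_of_dvd_pow ab) hd)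
  obtain ⟨A, bk⟩ := jk r
  obtain ⟨B, bq⟩ := jk t
  have jb : ¬ (7:ℤ)∣B := by
    intro hd
    have := dvd_add ((dvd_pow_self l nN).trans bq) ((dvd_pow_self l nN).trans (intl _ hd))
    exact hl (lp.dvd_of_dvd_pow (by simpa using this))
  obtain ⟨x, y, hxy⟩ : IsCoprime (7:ℤ) B := (Prime.coprime_iff_not_dvd (Int.prime_iff_natAbs_prime.2 nN)).2 jb
  obtain ⟨w, hw⟩ := kummer (u⁻¹*v) (-A*y) (by
    have hxy' : (x:af)*7 + y*B =1 := by exact_mod_cast congrArg (Int.cast : ℤ→af) hxy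
    have e : ((u⁻¹*v : afˣ):af) - ((-A*y : ℤ):af) = y*(r^7 + (u⁻¹*v : afˣ)*t^7) - y*(r^7 - A) - (u⁻¹*v : afˣ)*y*(t^7-B) +7*((u⁻¹*v : afˣ)*x) := by
      push_cast
      linear_combination -((u⁻¹ : afˣ) : af)*v*hxy'
    rw [e]
    exact dvd_add (dvd_sub (dvd_sub (cf.mul_left _) (bk.mul_left _)) (bq.mul_left _)) (ic.mul_right _))
  refine ⟨r, w*t, q, (u⁻¹:afˣ)*c,?_,?_, hq,?_⟩
  · exact (isCoprime_mul_unit_left_right w.isUnit r t).2 hrt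
  · rw [mul_comm]; exact (Units.mul_right_dvd).2 hc
  · rw [← aa, hw]; push_cast; ring
end
end Y7
end
section
open NumberField Module Ideal
namespace Y7
section
theorem nl1296 {d : af} (h : d∣1296) : ¬ l∣d := by
  intro aa
  have := lint 1296 (by simpa using aa.trans h)
  norm_num at this
theorem two_good (y : ℕ→af) (hy : ∀ i j, i <7→j <7→i≠j→IsCoprime (y i) (y j)) :
    ∃ i j, i≠j∧1 ≤ i∧i <7∧1 ≤ j∧j <7∧IsCoprime (y i) 1296∧IsCoprime (y j) 1296 := by
  classical
  let B : ℕ→Finset ℕ := fun p => (Finset.Ico 1 7).filter (fun i => ¬ IsCoprime (y i) (p:af))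
  have bq : ∀ p, p =2∨p =3→(B p).card ≤2 := by
    intro p hp
    by_contra hc
    obtain ⟨i, j, k, hi, hj, hk, aa, ab, ae⟩ := Finset.two_lt_card_iff.1 (not_le.1 hc)
    simp only [B, Finset.mem_filter, Finset.mem_Ico] at hi hj hk
    exact ls p hp _ _ _ (hy i j oO oO aa) (hy i k oO oO ab) (hy j k oO oO ae) hi.2 hj.2 hk.2
  have hc : 1 < ((Finset.Ico 1 7) \ (B 2 ∪ B 3)).card := by
    have aa := Finset.le_card_sdiff (B 2 ∪ B 3) (Finset.Ico 1 7)
    have ab := Finset.card_union_le (B 2) (B 3)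
    have := bq 2 (Or.inl rfl); have := bq 3 (Or.inr rfl)
    simp only [Nat.card_Ico] at aa
    omega
  obtain ⟨i, j, hi, hj, hij⟩ := Finset.one_lt_card_iff.1 hc
  have g : ∀ i, i∈(Finset.Ico 1 7) \ (B 2 ∪ B 3)→1 ≤ i∧i <7∧IsCoprime (y i) 1296 := by
    intro i hi
    simp only [B, Finset.mem_sdiff, Finset.mem_union, Finset.mem_filter, Finset.mem_Ico] at hi
    obtain ⟨aa, ab⟩ := hi
    push Not at ab
    refine ⟨aa.1, aa.2,?_⟩
    have a := ab.1 aa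
    have b := ab.2 aa
    have e : (1296:af) = ((2:ℕ):af)^4*((3:ℕ):af)^4 := by norm_num
    rw [e]
    exact IsCoprime.mul_right a.pow_right b.pow_right
  obtain ⟨ar, az, cj⟩ := g i hi
  obtain ⟨br, bn, da⟩ := g j hj
  exact ⟨i, j, hij, ar, az, br, bn, cj, da⟩
theorem step (m : ℕ) (hm : 1 ≤ m) (a b c d : af) (hab : IsCoprime a b) (hd : d∣1296) (hc : ¬ l∣c)
    (h : a^7 + b^7 = d*(l^m*c)^7) (ab : l^2∣a + b) : 2 ≤ m∧Sol (m-1) := by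
  obtain ⟨ax, jl⟩ := (dvd_pow_self l (by norm_num : 2≠0)).trans ab
  have hly0 : l∣ax := by
    rw [jl, sq] at ab; exact (mul_dvd_mul_iff_left lp.ne_zero).1 ab
  obtain ⟨y, hyd⟩ : ∃ y : ℕ→af, ∀ i, y i = ax + e i * b := ⟨_, fun _ => rfl⟩
  have hy : ∀ i, a + z^i*b = l * y i := by
    intro i; rw [hyd, el i]; linear_combination jl
  have kj : y 0 = ax := by simp [hyd, e]
  have hlb : ¬ l∣b := by
    intro aa
    have : l∣a := by
      have := dvd_sub (Dvd.intro ax jl.symm) aa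
      simpa using this
    exact lp.not_isUnit (hab.isUnit_of_dvd' this aa)
  have hby : ∀ i, IsCoprime b (y i) := by
    intro i
    have aa : IsCoprime b (a + z^i*b) := by
      rw [mul_comm]; exact (IsCoprime.add_mul_left_right hab.symm _)
    rw [hy] at aa
    exact aa.of_mul_right_right
  have hyc : ∀ i j, i <7→j <7→i≠j→IsCoprime (y i) (y j) := by
    intro i j hi hj hij
    have av : y j = (e j - e i)*b + y i*1 := by simp only [hyd]; ring
    rw [av]
    refine IsCoprime.add_mul_left_right ?_ _
    exact (isCoprime_mul_unit_left_right (ed' i j hij hi hj) _ _).2 (hby i).symm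
  have hly : ∀ i,1 ≤ i→i <7→¬ l∣y i := by
    intro i aa ao hd
    have : l∣e i * b := by have := dvd_sub hd hly0; simpa [hyd] using this
    rw [(eu i aa ao).dvd_mul_left] at this
    exact hlb this
  obtain ⟨Y, lk⟩ : ∃ Y, Y = ∏ i∈Finset.Ico 1 7, y i := ⟨_, rfl⟩
  have aj : ax * Y = d * ((l^(m-1))^7 * c^7) := by
    have ae := fac a b
    rw [h] at ae
    simp only [hy, Finset.prod_mul_distrib] at ae
    rw [Finset.prod_const, Finset.card_range, Finset.prod_range_eq_mul_Ico y nN, kj, ← lk] at ae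
    apply mul_left_cancel₀ (pow_ne_zero 7 lp.ne_zero)
    rw [← ae]
    obtain ⟨k, rfl⟩ : ∃ k, m = k +1 := ⟨m-1, by omega⟩
    simp only [Nat.add_sub_cancel]; ring
  have hlY : ¬ l∣Y := by
    intro aa
    rw [lk] at aa
    obtain ⟨i, hi, aa⟩ := (lp.dvd_finsetProd_iff _).1 aa
    rw [Finset.mem_Ico] at hi
    exact hly i hi.1 hi.2 aa
  have hm2 : 2 ≤ m := by
    by_contra hc2
    obtain rfl : m =1 := by omega
    simp only [Nat.sub_self, pow_zero, one_pow, one_mul] at aj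
    have aa : l∣d * c^7 := aj ▸ hly0.mul_right Y
    rcases lp.dvd_or_dvd aa with aa | aa
    · exact nl1296 hd aa
    · exact hc (lp.dvd_of_dvd_pow aa)
  refine ⟨hm2,?_⟩
  obtain ⟨w, hw⟩ : (l^(m-1))^7∣ax := by
    rw [← pow_mul]
    refine lp.pow_dvd_of_dvd_mul_right _ hlY ?_
    rw [aj, ← pow_mul]; exact ⟨d*c^7, by ring⟩
  have mu : w * Y = d * c^7 := by
    apply mul_left_cancel₀ (pow_ne_zero 7 (pow_ne_zero (m-1) lp.ne_zero))
    rw [hw] at aj; linear_combination aj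
  have hlw : ¬ l∣w := by
    intro aa
    have aa : l∣d * c^7 := mu ▸ aa.mul_right Y
    rcases lp.dvd_or_dvd aa with aa | aa
    · exact nl1296 hd aa
    · exact hc (lp.dvd_of_dvd_pow aa)
  have hwy : ∀ i,1 ≤ i→i <7→IsCoprime w (y i) := by
    intro i aa ao
    have := hyc 0 i nN ao oO
    rw [kj, hw] at this
    exact this.of_mul_left_right
  have hwYc : IsCoprime w Y := by
    rw [lk]; exact IsCoprime.prod_right (fun i hi => hwy i (Finset.mem_Ico.1 hi).1 (Finset.mem_Ico.1 hi).2)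
  obtain ⟨d', r0, hd', mx⟩ := splt hwYc mu
  have hpow : ∀ i,1 ≤ i→i <7→IsCoprime (y i) 1296 → ∃ (u : afˣ) (r : af), y i = u * r^7 := by
    intro i aa ao hi
    have hmem : i∈Finset.Ico 1 7 := Finset.mem_Ico.2 ⟨aa, ao⟩
    have ae : y i * (w * ∏ j∈(Finset.Ico 1 7).erase i, y j) = d * c^7 := by
      rw [← mu, lk, ← Finset.mul_prod_erase _ _ hmem]; ring
    have au : IsCoprime (y i) (w * ∏ j∈(Finset.Ico 1 7).erase i, y j) := (IsCoprime.mul_right (hwy i aa ao).symm (IsCoprime.prod_right (fun j hj => by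
      rw [Finset.mem_erase, Finset.mem_Ico] at hj
      exact hyc i j ao hj.2.2 (Ne.symm hj.1))))
    obtain ⟨e, r, he, hr⟩ := splt au ae
    have hu : IsUnit e := hi.isUnit_of_dvd' ⟨_, hr⟩ (he.trans hd)
    obtain ⟨u, hu⟩ := hu
    exact ⟨u, r, by rw [hu]; exact hr⟩
  obtain ⟨i, j, hij, i1, lg, j1, ld, hi, hj⟩ := two_good y hyc
  obtain ⟨u, r, hr⟩ := hpow i i1 lg hi
  obtain ⟨v, t, ht⟩ := hpow j j1 ld hj
  have hrt : IsCoprime r t := by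
    have := hyc i j lg ld hij
    rw [hr, ht] at this
    exact (IsCoprime.pow_iff nN nN).1 (this.of_mul_left_right.of_mul_right_right)
  refine fin1 ((eu j j1 ld).unit * u) (-((eu i i1 lg).unit * v)) r t ((e j - e i)*d') r0 (m-1) oO ?_ hrt ?_ ?_
  · rw [(ed' i j hij lg ld).mul_left_dvd]; exact hd'.trans hd
  · intro aa; apply hlw; rw [mx]; exact (aa.trans (dvd_pow_self r0 nN)).mul_left _
  · push_cast
    rw [IsUnit.unit_spec, IsUnit.unit_spec]
    have bh : (e j - e i) * ax = e j * y i - e i * y j := by simp only [hyd]; ring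
    rw [hr, ht, hw, mx] at bh
    linear_combination -bh
theorem nosol (m : ℕ) (hm : 1 ≤ m) : ¬ Sol m := by
  induction m with
  | zero => omega
  | succ m ih =>
    rintro ⟨a, b, c, d, hab, hd, hc, h⟩
    have aa : ∃ j, l∣a + z^j*b := by
      have ae := fac a b
      have au : l∣a^7+b^7 := by
        rw [h, mul_pow, ← pow_mul]
        exact ((dvd_pow_self l oO).mul_right _).mul_left _
      rw [ae] at au
      obtain ⟨i, -, hi⟩ := (lp.dvd_finsetProd_iff _).1 au
      exact ⟨i, hi⟩
    obtain ⟨j, hj⟩ := aa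
    have aa : l∣a + b := by
      have e : a + b = (a + z^j*b) - l*(e j * b) := by rw [el j]; ring
      rw [e]; exact dvd_sub hj (dvd_mul_right _ _)
    obtain ⟨ax, jl⟩ := aa
    have hlb : ¬ l∣b := by
      intro aa
      have : l∣a := by
        have := dvd_sub (Dvd.intro ax jl.symm) aa
        simpa using this
      exact lp.not_isUnit (hab.isUnit_of_dvd' this aa)
    obtain ⟨n, hn⟩ := modi ax
    obtain ⟨k, hk⟩ := modi b
    have hk7 : ¬ (7:ℤ)∣k := by
      intro hd
      have := dvd_add hk ((dvd_pow_self l nN).trans (intl _ hd))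
      exact hlb (by simpa using this)
    obtain ⟨p, q, hpq⟩ : IsCoprime (7:ℤ) k := (Prime.coprime_iff_not_dvd (Int.prime_iff_natAbs_prime.2 nN)).2 hk7
    obtain ⟨i, hi⟩ : ∃ i : ℕ, (7:ℤ)∣n + i * k := by
      refine ⟨((-n*q) % 7).toNat,?_⟩
      rw [Int.toNat_of_nonneg (Int.emod_nonneg _ nN)]
      have := Int.emod_add_mul_ediv (-n*q) 7
      refine ⟨n*p - k*((-n*q)/7),?_⟩
      linear_combination k*this - n*hpq
    have hl2 : l^2∣a + z^i*b := by
      have hp := powl (x := z) (c :=1) (e :=1) (t := l) (k :=1) le_rfl (by simp) (by rw [zl]; simp) i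
      have av : a + z^i*b = b*(z^i -1^i*(1+i*1*l)) + l*((ax - n) + i*(b - k) + ((n+i*k:ℤ):af)) := by
        push_cast; rw [one_pow]; linear_combination jl
      rw [av]
      refine dvd_add (hp.mul_left _) ?_
      rw [sq]
      exact mul_dvd_mul_left l (dvd_add (dvd_add hn (hk.mul_left _)) ((dvd_pow_self l nN).trans (intl _ hi)))
    obtain ⟨ab, ae⟩ := step (m+1) oO a (z^i*b) c d ((isCoprime_mul_unit_left_right (zun i) _ _).2 hab) hd hc (by
      rw [← h, mul_pow, ← pow_mul, mul_comm i, pow_mul, ek]; simp) hl2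
    exact ih oO ae
theorem cusp (A B C d : ℤ) (bk : A≠0) (h : d*A^7 + B^7 + C^7 =0) (hd : d∣1296) (ao : (7:ℤ)∣A) (gy : IsCoprime B C) : False := by
  have hA' : (A:af)≠0 := by exact_mod_cast bk
  obtain ⟨m, c, hc, nq⟩ := WfDvdMonoid.max_power_factor hA' lp.irreducible
  have hm : 1 ≤ m := by
    by_contra ak
    obtain rfl : m =0 := by omega
    rw [pow_zero, one_mul] at nq
    exact hc (nq ▸ (dvd_pow_self l nN).trans (intl A ao))
  refine nosol m hm ⟨B, C, c, ((-d:ℤ):af), gy.intCast,?_, hc,?_⟩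
  · have : ((-d:ℤ):af)∣((1296:ℤ):af) := Int.cast_dvd_cast _ _ ((neg_dvd).2 hd)
    simpa using this
  · rw [← nq]
    have : ((d*A^7+B^7+C^7:ℤ):af) =0 := by rw [h]; simp
    push_cast at this ⊢
    linear_combination this
end
end Y7
end
section
open NumberField Module Ideal
namespace Y7
section
theorem hom29 : ∃ f : af →+* ZMod 29, f z =16 := by
  have hg : zsp.integralPowerBasis.gen = z := by rw [zsp.integralPowerBasis_gen]; rfl
  have hm : Polynomial.aeval (16 : ZMod 29) (minpoly ℤ zsp.integralPowerBasis.gen) =0 := by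
    rw [hg, ← minpoly.algebraMap_eq (B := af) (B' := cx) RingOfIntegers.coe_injective z]
    have : algebraMap af cx z = IsCyclotomicExtension.zeta 7 ℚ cx := rfl
    rw [this, ← Polynomial.cyclotomic_eq_minpoly zsp nN, Polynomial.cyclotomic_prime]
    simp [Finset.sum_range_succ]
    decide
  refine ⟨(zsp.integralPowerBasis.lift (16 : ZMod 29) hm).toRingHom,?_⟩
  have := zsp.integralPowerBasis.lift_gen (16 : ZMod 29) hm
  rw [hg] at this
  exact this
set_option maxRecDepth 100000 in
theorem dec29 : ∀ b c : ZMod 29, (b+16*c)^5 = (1+16)^4*(b+16*c)→(b+16^2*c)^5 = (1+16^2)^4*(b+16^2*c) →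
    (b+16^3*c)^5 = (1+16^3)^4*(b+16^3*c)→(b+16^4*c)^5 = (1+16^4)^4*(b+16^4*c)→(b+16^5*c)^5 = (1+16^5)^4*(b+16^5*c) →
    (b+16^6*c)^5 = (1+16^6)^4*(b+16^6*c)→(b^7+c^7)^5 =36^4*(b^7+c^7)→b =0∧c =0 := by
  decide +kernel
theorem p35 : ∀ r : ZMod 29, r^35 = r^7 := by decide +kernel
theorem wun (i : ℕ) (aa : 1 ≤ i) (ao : i <7) : IsUnit (1 + z^i) := by
  have h := (zpr.pow_of_coprime i (by
    rw [Nat.coprime_comm, Nat.Prime.coprime_iff_not_dvd nN]; intro h; have := Nat.le_of_dvd aa h; omega)).geom_sum_eq_zero nN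
  have ab : (z^i)^7 =1 := by rw [← pow_mul, mul_comm, pow_mul, ek, one_pow]
  simp only [Finset.sum_range_succ, Finset.range_zero, Finset.sum_empty] at h
  generalize z^i = w at h ab ⊢
  exact IsUnit.of_mul_eq_one (1+w^2+w^4+w^6) (by linear_combination h + ab)
theorem first36 (A B C : ℤ) (h : 36*A^7 + B^7 + C^7 =0) (gy : IsCoprime B C) (hc7 : (7:ℤ)∣B - C) (jb : ¬ (7:ℤ)∣B) : False := by
  have cf : (6:ℤ)∣B + C := by
    have aa := congrArg (Int.cast : ℤ→ZMod 6) h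
    push_cast at aa
    rw [show (6:ℤ) = ((6:ℕ):ℤ) from rfl, ← ZMod.intCast_zmod_eq_zero_iff_dvd]
    push_cast
    rw [show (36:ZMod 6) =0 from by decide, (by decide : ∀ b : ZMod 6, b^7 = b) B, (by decide : ∀ b : ZMod 6, b^7 = b) C] at aa
    linear_combination aa
  have hBC' : IsCoprime (B:af) C := gy.intCast
  obtain ⟨x, hx⟩ : ∃ x : ℕ→af, ∀ i, x i = B + z^i*C := ⟨_, fun _ => rfl⟩
  have hxl : ∀ i, ¬ l∣x i := by
    intro i hd
    have aa : l∣((B + C : ℤ) : af) := by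
      have av : ((B + C : ℤ) : af) = x i - l*(e i*C) := by rw [hx, el i]; push_cast; ring
      rw [av]; exact dvd_sub hd (dvd_mul_right _ _)
    have ab := lint _ aa
    exact jb oO
  have hxc : ∀ i j, i <7→j <7→i≠j→IsCoprime (x i) (x j) := by
    intro i j hi hj hij
    have av : x j = (e j - e i)*(l*C) + x i*1 := by simp only [hx, el]; ring
    rw [av]
    refine IsCoprime.add_mul_left_right ?_ _
    refine (isCoprime_mul_unit_left_right (ed' i j hij hi hj) _ _).2 (IsCoprime.mul_right ?_ ?_)
    · exact ((Prime.coprime_iff_not_dvd lp).2 (hxl i)).symm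
    · rw [hx, mul_comm]; exact (IsCoprime.add_mul_left_right hBC'.symm _).symm
  have aj : ∏ i∈Finset.range 7, x i =36*((-A:ℤ):af)^7 := by
    simp only [hx]; rw [← fac]
    have := congrArg (Int.cast : ℤ→af) h
    push_cast at this ⊢; linear_combination this
  have key : ∀ i,1 ≤ i→i <7 → ∃ r, x i = (1+z^i)*r^7 := by
    intro i aa ao
    have hmem : i∈Finset.range 7 := Finset.mem_range.2 ao
    have ae : x i * (∏ j∈(Finset.range 7).erase i, x j) =36*((-A:ℤ):af)^7 := by
      rw [← aj, ← Finset.mul_prod_erase _ _ hmem]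
    have au : IsCoprime (x i) (∏ j∈(Finset.range 7).erase i, x j) := IsCoprime.prod_right (fun j hj => by
      rw [Finset.mem_erase, Finset.mem_range] at hj
      exact hxc i j ao hj.2 (Ne.symm hj.1))
    obtain ⟨d, r, hd, hr⟩ := splt au ae
    have bh : IsCoprime (x i) 36 := by
      have bh := hxc i 0 ao nN oO
      have nr : (6:af)∣x 0 := by
        have := Int.cast_dvd_cast (α := af) _ _ cf
        rw [hx]; simpa using this
      have := (bh.of_isCoprime_of_dvd_right nr).pow_right (n :=2)
      norm_num at this; exact this
    obtain ⟨u, rfl⟩ : IsUnit d := bh.isUnit_of_dvd' ⟨_, hr⟩ hd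
    obtain ⟨w, hw⟩ := wun i aa ao
    obtain ⟨n, hn⟩ := jk r
    have nb : ¬ (7:ℤ)∣n := by
      intro hd
      have := dvd_add ((dvd_pow_self l nN).trans hn) ((dvd_pow_self l nN).trans (intl _ hd))
      exact hxl i (hr ▸ ((by simpa using this : l∣r^7).mul_left _))
    obtain ⟨p, q, hpq⟩ : IsCoprime (7:ℤ) n := (Prime.coprime_iff_not_dvd (Int.prime_iff_natAbs_prime.2 nN)).2 nb
    obtain ⟨v, hv⟩ := kummer (w⁻¹*u) (B*q) (by
      obtain ⟨k, hk⟩ := hc7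
      have hpq' : (p:af)*7 + q*n =1 := by exact_mod_cast congrArg (Int.cast : ℤ→af) hpq
      have hk' : (B:af) - C =7*k := by exact_mod_cast congrArg (Int.cast : ℤ→af) hk
      have hw' : ((w⁻¹:afˣ):af)*w =1 := Units.inv_mul w
      have bl : (u:af)*r^7 = w*B -7*(z^i*k) := by rw [← hr, hx, hw]; linear_combination -z^i*hk'
      have av : ((w⁻¹*u : afˣ):af) - ((B*q:ℤ):af) =7*((w⁻¹:afˣ)*u*p - (w⁻¹:afˣ)*q*z^i*k) - (w⁻¹:afˣ)*u*q*(r^7-n) := by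
        push_cast
        linear_combination ((w⁻¹:afˣ):af)*q*bl + q*B*hw' - ((w⁻¹:afˣ):af)*u*hpq'
      rw [av]
      exact dvd_sub (ic.mul_right _) (hn.mul_left _))
    refine ⟨v*r,?_⟩
    have dj : u = w*v^7 := by rw [← hv]; simp
    rw [hr, dj, ← hw]; push_cast; ring
  obtain ⟨f, hf⟩ := hom29
  have hz : ∀ i,1 ≤ i→i <7→((B:ZMod 29)+16^i*C)^5 = (1+16^i)^4*(B+16^i*C) := by
    intro i aa ao
    obtain ⟨r, hr⟩ := key i aa ao
    have := congrArg f hr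
    rw [hx] at this
    simp only [map_add, map_mul, map_pow, map_intCast, hf, map_one] at this
    rw [this]; linear_combination (1+16^i)^5*p35 (f r)
  have ak : ((B:ZMod 29)^7+C^7)^5 =36^4*(B^7+C^7) := by
    have := congrArg (Int.cast : ℤ→ZMod 29) h
    push_cast at this
    rw [show (B:ZMod 29)^7+C^7 =36*(-A)^7 by linear_combination this]
    linear_combination 36^5*p35 (-A)
  have := dec29 B C (by simpa using hz 1) (hz 2 nN nN) (hz 3 nN nN) (hz 4 nN nN) (hz 5 nN nN) (hz 6 nN nN) ak
  rw [ZMod.intCast_zmod_eq_zero_iff_dvd, ZMod.intCast_zmod_eq_zero_iff_dvd] at this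
  have := gy.isUnit_of_dvd' this.1 this.2
  rw [Int.isUnit_iff] at this
  norm_num at this
end
end Y7
end
section
open NumberField Module Ideal
namespace Y7
section
theorem cpd (a b : ℤ) (ha : a≠0) : ∃ g a' b' : ℤ, g≠0∧a = g*a' ∧ b = g*b' ∧ IsCoprime a' b' := by
  obtain ⟨g, a', b', hg, aa, ab, ae⟩ := Int.exists_gcd_one' (Int.gcd_pos_of_ne_zero_left b ha)
  exact ⟨g, a', b', by exact_mod_cast hg.ne', by rw [ab]; ring, by rw [ae]; ring, Int.isCoprime_iff_gcd_eq_one.2 aa⟩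
theorem rat (n c e r : ℤ) (hc : c≠0) (he : e∣1296) (h : n*c^7 = e*r^7) : c∣r := by
  obtain ⟨g, c', r', hg, hc', hr', hcop⟩ := cpd c r hc
  subst hc' hr'
  have aa : c'^7∣e*r'^7 := ⟨n, by
    apply mul_left_cancel₀ (pow_ne_zero 7 hg)
    linear_combination -h⟩
  have ab : c'^7∣1296 := ((hcop.pow (m :=7) (n :=7)).dvd_of_dvd_mul_right aa).trans he
  have ae : c'.natAbs^7∣1296 := by
    rw [← Int.natAbs_pow]; exact Int.natAbs_dvd_natAbs.2 ab
  have au : c'.natAbs <3 := by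
    by_contra hc
    have := Nat.pow_le_pow_left (not_lt.1 hc) 7
    have := Nat.le_of_dvd nN ae
    omega
  have bh : IsUnit c' := by
    rw [Int.isUnit_iff_natAbs_eq]
    generalize c'.natAbs = k at *
    interval_cases k <;> first | rfl | (norm_num at ae)
  exact mul_dvd_mul_left g bh.dvd
theorem desc (a b c N : ℤ) (hb : b≠0) (hc : c≠0) (hab : IsCoprime a b) (hac : IsCoprime a c)
    (hbc : IsCoprime b c) (h : a*b^2*c^4 =6*N^7) :
    ∃ (bb aq ba : ℕ) (A B C : ℤ), bb*aq*ba =6∧a = bb*A^7∧b = aq^4*B^7∧c = ba^2*C^7 := by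
  have aa : (6:ℤ)∣a*(b^2*c^4) := ⟨N^7, by linear_combination h⟩
  obtain ⟨bb, d',⟨α, ga⟩, ab, hd⟩ := exists_dvd_and_dvd_of_dvd_mul aa
  obtain ⟨aq, ba,⟨β, ff⟩,⟨jg, fe⟩, rfl⟩ := exists_dvd_and_dvd_of_dvd_mul ab
  have ae : α*β*jg = N^7 := by
    apply mul_left_cancel₀ (by norm_num : (6:ℤ)≠0)
    rw [← h, mul_assoc a, ga, ff, fe]; rw [hd]; ring
  have cab : IsCoprime α β := ((hab.pow_right (n :=2)).of_isCoprime_of_dvd_left ⟨bb, by rw [ga]; ring⟩).of_isCoprime_of_dvd_right ⟨aq, by rw [ff]; ring⟩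
  have cac : IsCoprime α jg := ((hac.pow_right (n :=4)).of_isCoprime_of_dvd_left ⟨bb, by rw [ga]; ring⟩).of_isCoprime_of_dvd_right ⟨ba, by rw [fe]; ring⟩
  have cbc : IsCoprime β jg := ((hbc.pow (m :=2) (n :=4)).of_isCoprime_of_dvd_left ⟨aq, by rw [ff]; ring⟩).of_isCoprime_of_dvd_right ⟨ba, by rw [fe]; ring⟩
  have hodd : Odd 7 := by decide
  obtain ⟨A, rfl⟩ := Int.eq_pow_of_mul_eq_pow_odd_left (IsCoprime.mul_right cab cac) hodd (by rw [← ae]; ring : α*(β*jg) = N^7)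
  obtain ⟨r, rfl⟩ := Int.eq_pow_of_mul_eq_pow_odd_left (IsCoprime.mul_right cab.symm cbc) hodd (by rw [← ae]; ring : β*(A^7*jg) = N^7)
  obtain ⟨s, rfl⟩ := Int.eq_pow_of_mul_eq_pow_odd_left (IsCoprime.mul_right cac.symm cbc.symm) hodd (by rw [← ae]; ring : jg*(A^7*r^7) = N^7)
  have bl : aq∣6 := ⟨bb*ba, by rw [hd]; ring⟩
  have dj : ba∣6 := ⟨bb*aq, by rw [hd]; ring⟩
  obtain ⟨B, bq⟩ := rat b b (aq^4) (r^4) hb (by have := pow_dvd_pow_of_dvd bl 4; norm_num at this; exact this)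
    (by linear_combination (b^6+b^4*aq*r^7+b^2*(aq*r^7)^2+(aq*r^7)^3)*ff)
  obtain ⟨C, cq⟩ := rat c c (ba^2) (s^2) hc (by have := (pow_dvd_pow_of_dvd dj 2).trans (by norm_num : (6:ℤ)^2∣1296); exact this)
    (by linear_combination (c^4+ba*s^7)*fe)
  refine ⟨bb.natAbs, aq.natAbs, ba.natAbs, bb.sign*A, B, C,?_,?_,?_,?_⟩
  · rw [← Int.natAbs_mul, ← Int.natAbs_mul, mul_assoc, ← hd]; rfl
  · rw [ga, mul_pow, ← mul_assoc]
    congr 1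
    rcases Int.natAbs_eq bb with hh | hh
    all_goals
      have ak : bb≠0 := by rintro rfl; simp at hd
    · have : 0 < bb := by omega
      rw [Int.sign_eq_one_of_pos this]; omega
    · have : bb <0 := by omega
      rw [Int.sign_eq_neg_one_of_neg this]; omega
  · rw [show ((aq.natAbs:ℕ):ℤ)^4 = aq^4 by rw [Int.natCast_natAbs]; exact Even.pow_abs (by decide) _]
    apply mul_left_cancel₀ (pow_ne_zero 7 hb)
    have : b^8 = aq^4*(r^4)^7 := by linear_combination (b^6+b^4*aq*r^7+b^2*(aq*r^7)^2+(aq*r^7)^3)*ff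
    rw [bq] at this; linear_combination this
  · rw [show ((ba.natAbs:ℕ):ℤ)^2 = ba^2 by rw [Int.natCast_natAbs]; exact Even.pow_abs (by decide) _]
    apply mul_left_cancel₀ (pow_ne_zero 7 hc)
    have : c^8 = ba^2*(s^2)^7 := by linear_combination (c^4+ba*s^7)*fe
    rw [cq] at this; linear_combination this
def lu : List (ZMod 29) := [0,1,28,12,17]
theorem mj : ∀ r : ZMod 29, r^7∈lu := by decide +kernel
def ik : List (ZMod 49) := [0,1,48,18,31,19,30]
theorem ji : ∀ r : ZMod 49, r^7∈ik := by decide +kernel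
theorem lc (p q r : ℕ) (A B C : ℤ) (hd : ∀ a∈lu, ∀ b∈lu, ∀ c∈lu, p*a+q*b+r*c =0→a =0∧b =0)
    (h : p*A^7+q*B^7+r*C^7 =0) (hc : IsCoprime (p*A^7) (q*B^7)) : False := by
  have aa := congrArg (Int.cast : ℤ→ZMod 29) h
  push_cast at aa
  obtain ⟨ab, ae⟩ := hd _ (mj A) _ (mj B) _ (mj C) aa
  have f : ∀ A : ℤ, (A:ZMod 29)^7 =0→(29:ℤ)∣A^7 := by
    intro A bk
    rw [← Int.cast_pow, ZMod.intCast_zmod_eq_zero_iff_dvd] at bk; exact bk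
  have := hc.isUnit_of_dvd' ((f A ab).mul_left _) ((f B ae).mul_left _)
  rw [Int.isUnit_iff] at this
  norm_num at this
theorem f49 (A : ℤ) (h : (A:ZMod 49)^7 =0) : (7:ℤ)∣A := by
  rw [← Int.cast_pow, ZMod.intCast_zmod_eq_zero_iff_dvd] at h
  exact (Int.prime_iff_natAbs_prime.2 nN : Prime (7:ℤ)).dvd_of_dvd_pow ((by norm_num : (7:ℤ)∣49).trans h)
theorem k49 (d : ℕ) (A B C : ℤ) (hd : ∀ a∈ik, ∀ b∈ik, ∀ c∈ik, d*a+b+c =0→a =0) (bk : A≠0)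
    (hd' : (d:ℤ)∣1296) (h : d*A^7+B^7+C^7 =0) (hc : IsCoprime B C) : False := by
  have aa := congrArg (Int.cast : ℤ→ZMod 49) h
  push_cast at aa
  exact cusp A B C d bk h hd' (f49 A (hd _ (ji A) _ (ji B) _ (ji C) aa)) hc
theorem d36 : ∀ a∈ik, ∀ b∈ik, ∀ c∈ik,36*a+b+c =0→a =0∨(b = c∧b≠0) := by decide +kernel
theorem k36 (A B C : ℤ) (bk : A≠0) (h : 36*A^7+B^7+C^7 =0) (hc : IsCoprime B C) : False := by
  have aa := congrArg (Int.cast : ℤ→ZMod 49) h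
  push_cast at aa
  rcases d36 _ (ji A) _ (ji B) _ (ji C) aa with ab | ⟨ab, ae⟩
  · exact cusp A B C 36 bk h nN (f49 A ab) hc
  · refine first36 A B C h hc ?_ ?_
    · have au : ((B^7-C^7 : ℤ) : ZMod 49) =0 := by push_cast; rw [ab]; ring
      rw [ZMod.intCast_zmod_eq_zero_iff_dvd] at au
      have bh : (7:ℤ)∣B^7-C^7 := (by norm_num : (7:ℤ)∣(49:ℕ)).trans au
      have cf := (ZMod.intCast_zmod_eq_zero_iff_dvd _ 7).2 bh
      push_cast at cf
      rw [ZMod.pow_card, ZMod.pow_card] at cf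
      exact (ZMod.intCast_zmod_eq_zero_iff_dvd _ 7).1 (by push_cast; exact cf)
    · intro au
      apply ae
      rw [← Int.cast_pow, ZMod.intCast_zmod_eq_zero_iff_dvd]
      exact (by norm_num : ((49:ℕ):ℤ)∣7^7).trans (pow_dvd_pow_of_dvd au 7)
theorem final (a b c : ℤ) (A B C : ℤ) (bb aq ba : ℕ) (hd : bb*aq*ba =6) (ha : a = bb*A^7) (hb : b = aq^4*B^7) (hc : c = ba^2*C^7)
    (h : a + b + c =0) (dp : a≠0) (cw : b≠0) (dr : c≠0) (hab : IsCoprime a b) (hac : IsCoprime a c) (hbc : IsCoprime b c) :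
    a =3*b∧c = -4*b := by
  have A0 : A≠0 := by rintro rfl; simp at ha; exact dp ha
  have ku : B≠0 := by rintro rfl; simp at hb; exact cw hb
  have du : C≠0 := by rintro rfl; simp at hc; exact dr hc
  have cop : ∀ p q : ℤ, ∀ P Q : ℤ, IsCoprime (p*P^7) (q*Q^7)→IsCoprime P Q := fun p q P Q h =>
    (IsCoprime.pow_iff nN nN).1 (h.of_mul_left_right.of_mul_right_right)
  have nd : ∀ p u P v : ℤ, p∣u→¬ IsUnit p→IsCoprime u (v*P^7)→¬ p∣P := fun p u P v aa ab ae au =>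
    ab (ae.isUnit_of_dvd' aa ((au.trans (dvd_pow_self P nN)).mul_left v))
  have kw : ¬ IsUnit (2:ℤ) := by rw [Int.isUnit_iff]; norm_num
  have u3 : ¬ IsUnit (3:ℤ) := by rw [Int.isUnit_iff]; norm_num
  rw [ha, hb, hc] at h
  rw [ha, hb] at hab
  rw [ha, hc] at hac
  rw [hb, hc] at hbc
  have l1 : bb ≤6 := Nat.le_of_dvd nN ⟨aq*ba, by rw [← hd]; ring⟩
  have l2 : aq ≤6 := Nat.le_of_dvd nN ⟨bb*ba, by rw [← hd]; ring⟩
  have cases : (bb =6∧aq =1∧ba =1)∨(bb =1∧aq =6∧ba =1)∨(bb =1∧aq =1∧ba =6)∨(bb =2∧aq =3∧ba =1) ∨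
      (bb =3∧aq =1∧ba =2)∨(bb =2∧aq =1∧ba =3)∨(bb =3∧aq =2∧ba =1)∨(bb =1∧aq =2∧ba =3)∨(bb =1∧aq =3∧ba =2) := by
    clear ha hb hc h hab hac hbc
    interval_cases bb <;> interval_cases aq <;> omega
  rcases cases with ⟨rfl, rfl, rfl⟩ | ⟨rfl, rfl, rfl⟩ | ⟨rfl, rfl, rfl⟩ | ⟨rfl, rfl, rfl⟩ | ⟨rfl, rfl, rfl⟩ | ⟨rfl, rfl, rfl⟩ | ⟨rfl, rfl, rfl⟩ | ⟨rfl, rfl, rfl⟩ | ⟨rfl, rfl, rfl⟩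
  · exact (k49 6 A B C (by decide +kernel) A0 nN (by push_cast at h ⊢; linear_combination h) (cop _ _ _ _ hbc)).elim
  · exact (k49 1296 B A C (by decide +kernel) ku nN (by push_cast at h ⊢; linear_combination h) (cop _ _ _ _ hac)).elim
  · exact (k36 C A B du (by push_cast at h; linear_combination h) (cop _ _ _ _ hab)).elim
  · exact (MF.eq281 A B C (by push_cast at h; linear_combination h) A0 (cop _ _ _ _ hab) (cop _ _ _ _ hbc)
      (nd 3 _ _ _ (Dvd.dvd.mul_right nN _) u3 hab.symm) (nd 3 _ _ _ (Dvd.dvd.mul_right nN _) u3 hbc)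
      (nd 2 _ _ _ (Dvd.dvd.mul_right nN _) kw hac) (nd 2 _ _ _ (Dvd.dvd.mul_right nN _) kw hab)).elim
  · obtain ⟨bk, bq, cq⟩ := MF.eq314 A B C (by push_cast at h; linear_combination h) du
      (nd 2 _ _ _ (Dvd.dvd.mul_right nN _) kw hac.symm) (nd 2 _ _ _ (Dvd.dvd.mul_right nN _) kw hbc.symm) (cop _ _ _ _ hab) (cop _ _ _ _ hac)
    rw [Int.isUnit_iff] at bk bq cq
    rw [ha, hb, hc]
    rcases bk with rfl | rfl <;> rcases bq with rfl | rfl <;> rcases cq with rfl | rfl <;> revert h <;> norm_num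
  · exact (lc 2 1 9 A B C (by decide +kernel) (by push_cast at h ⊢; linear_combination h) (by push_cast at hab ⊢; simpa using hab)).elim
  · exact (lc 3 16 1 A B C (by decide +kernel) (by push_cast at h ⊢; linear_combination h) (by push_cast at hab ⊢; norm_num at hab ⊢; exact hab)).elim
  · exact (lc 1 16 9 A B C (by decide +kernel) (by push_cast at h ⊢; linear_combination h) (by push_cast at hab ⊢; norm_num at hab ⊢; exact hab)).elim
  · exact (lc 1 81 4 A B C (by decide +kernel) (by push_cast at h ⊢; linear_combination h) (by push_cast at hab ⊢; norm_num at hab ⊢; exact hab)).elim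
theorem nz (x y z : ℤ) (hx : x≠0) (hy : y≠0) (hz : z≠0) (h : 6 * x ^ 3 * y + y ^ 3 * z + z ^ 3 * x =0) : y = -x∧z =2*x := by
  have dp : 6*x^3*y≠0 := by positivity
  have cw : y^3*z≠0 := by positivity
  have dr : z^3*x≠0 := by positivity
  obtain ⟨g, a, b, hg, ha, hb, hab⟩ := cpd _ (y^3*z) dp
  have hc : z^3*x = g*(-(a+b)) := by linear_combination h - ha - hb
  obtain ⟨c, hcd⟩ : ∃ c, c = -(a+b) := ⟨_, rfl⟩
  rw [← hcd] at hc
  have hac : IsCoprime a c := by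
    rw [hcd]; refine IsCoprime.neg_right ?_
    rw [add_comm]; simpa using hab.add_mul_left_right 1
  have hbc : IsCoprime b c := by
    rw [hcd]; refine IsCoprime.neg_right ?_
    simpa using hab.symm.add_mul_left_right 1
  rw [ha] at dp; rw [hb] at cw; rw [hc] at dr
  have ar := right_ne_zero_of_mul dp
  have br := right_ne_zero_of_mul cw
  have cd := right_ne_zero_of_mul dr
  have av : (a*b^2*c^4)*g^7 =6*(x*y*z^2)^7 := by
    have : (g*a)*(g*b)^2*(g*c)^4 =6*(x*y*z^2)^7 := by rw [← ha, ← hb, ← hc]; ring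
    linear_combination this
  obtain ⟨N, bz⟩ := rat _ g 6 _ hg nN av
  have bl : a*b^2*c^4 =6*N^7 := by
    apply mul_right_cancel₀ (pow_ne_zero 7 hg)
    rw [av, bz]; ring
  obtain ⟨bb, aq, ba, A, B, C, hd, bk, bq, cq⟩ := desc a b c N br cd hab hac hbc bl
  obtain ⟨cr, dd⟩ := final a b c A B C bb aq ba hd bk bq cq (by rw [hcd]; ring) ar br cd hab hac hbc
  have dx : 2*x^3 = y^2*z := by
    apply mul_left_cancel₀ (mul_ne_zero (by norm_num : (3:ℤ)≠0) hy)
    linear_combination ha -3*hb + g*cr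
  have fp : z^2*x = -4*y^3 := by
    apply mul_left_cancel₀ hz
    linear_combination hc +4*hb + g*dd
  have g3 : x^7 = (-y)^7 := by
    apply mul_left_cancel₀ (by norm_num : (4:ℤ)≠0)
    linear_combination (2*x^4+y^2*z*x)*dx + y^4*fp
  have g4 : x = -y := (Odd.strictMono_pow (by decide : Odd 7)).injective g3
  have g5 : y = -x := by omega
  refine ⟨g5,?_⟩
  rw [g5] at dx
  apply mul_left_cancel₀ (pow_ne_zero 2 hx)
  linear_combination -dx
end
end Y7
end
theorem rational_points_C1 (x y z : ℤ)
    (hcop : Int.gcd x (Int.gcd y z : ℤ) = 1) (hnz : ¬ (x = 0 ∧ y = 0 ∧ z = 0))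
    (h : 6 * x ^ 3 * y + y ^ 3 * z + z ^ 3 * x = 0) :
    (x, y, z) = (1, 0, 0) ∨ (x, y, z) = (-1, 0, 0) ∨
    (x, y, z) = (0, 1, 0) ∨ (x, y, z) = (0, -1, 0) ∨
    (x, y, z) = (0, 0, 1) ∨ (x, y, z) = (0, 0, -1) ∨
    (x, y, z) = (1, -1, 2) ∨ (x, y, z) = (-1, 1, -2) := by
  have un : ∀ n : ℤ, n.natAbs = 1 → n = 1 ∨ n = -1 := fun n hn => Int.natAbs_eq_iff.1 hn
  by_cases hx : x = 0
  · subst hx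
    rcases mul_eq_zero.1 (by linear_combination h : y^3*z = 0) with h1 | h1
    · obtain rfl : y = 0 := by simpa using h1
      rcases un z (by simpa [Int.natAbs_abs] using hcop) with rfl | rfl <;> simp
    · subst h1
      rcases un y (by simpa [Int.natAbs_abs] using hcop) with rfl | rfl <;> simp
  by_cases hy : y = 0
  · subst hy
    have h1 : z^3 = 0 := (mul_eq_zero.1 (by linear_combination h : z^3*x = 0)).resolve_right hx
    obtain rfl : z = 0 := by simpa using h1
    rcases un x (by simpa [Int.natAbs_abs] using hcop) with rfl | rfl <;> simp
  by_cases hz : z = 0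
  · subst hz
    simp [hx, hy] at h
  obtain ⟨h1, h2⟩ := Y7.nz x y z hx hy hz h
  have h3 : x ∣ 1 := by
    have : x ∣ ((Int.gcd x (Int.gcd y z : ℤ) : ℕ) : ℤ) :=
      Int.dvd_coe_gcd dvd_rfl (Int.dvd_coe_gcd ⟨-1, by rw [h1]; ring⟩ ⟨2, by rw [h2]; ring⟩)
    rw [hcop] at this; exact_mod_cast this
  subst h1 h2
  rcases Int.isUnit_iff.1 (isUnit_of_dvd_one h3) with rfl | rfl <;> simp
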